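/- Fix a real α > −1 and an integer n ≥ 1. For every x ∈ (0,1) and every continuous function f : ℝⁿ → ℝ with compact support, lim_{N→∞} (N·ψ(x))^{−n} ∫_{ℝⁿ} f(t₁,…,tₙ) · R_n^{θ,(N+α)/4}( x + t₁/(N·ψ(x)), …, x + tₙ/(N·ψ(x)) ) dt₁⋯dtₙ = ∫_{ℝⁿ} f(t₁,…,tₙ) · det[ K_sin(tᵢ,tⱼ) ]_{i,j=1}^{n} dt₁⋯dtₙ. (Bulk universality of the bounded trace Laguerre unitary ensemble: the sine-kernel limit.) -/

import Mathlib

open MeasureTheory Filter Topology Finset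
open scoped Real Classical

noncomputable section

namespace RMT

/-- Extend a finite tuple by zero. -/
def extFun {n : ℕ} (t : Fin n → ℝ) : ℕ → ℝ := fun k => if h : k < n then t ⟨k, h⟩ else 0

/-- Squared Vandermonde determinant ∏_{i<j} (x_j - x_i)². -/
def vdm2 {N : ℕ} (x : Fin N → ℝ) : ℝ :=
  ∏ p ∈ Finset.univ.filter (fun p : Fin N × Fin N => p.1 < p.2), (x p.2 - x p.1) ^ 2

/-- Laguerre weight ∏ xᵢ^α (real power). -/
def lagWeight (α : ℝ) {N : ℕ} (x : Fin N → ℝ) : ℝ := ∏ i, x i ^ α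

/-- Partition function of the fixed trace LUE:
`Z_δ^r = r^{N(N+α)} ∏_{j=1}^N Γ(1+j)Γ(α+j) / Γ(N(N+α))`. -/
def ftlueZ (α : ℝ) (N : ℕ) (r : ℝ) : ℝ :=
  r ^ ((N : ℝ) * ((N : ℝ) + α)) *
    (∏ j ∈ Finset.range N, Real.Gamma (1 + ((j : ℝ) + 1)) * Real.Gamma (α + ((j : ℝ) + 1))) /
      Real.Gamma ((N : ℝ) * ((N : ℝ) + α))

/-- The full eigenvalue vector for the fixed trace LUE: the first `n` coordinates are the fixed
arguments `t`, the next `N-1-n` coordinates are the integration variables `y`, and the last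
coordinate is `r - ∑ t - ∑ y`. -/
def ftlueVec (N n : ℕ) (r : ℝ) (t : Fin n → ℝ) (y : Fin (N - 1 - n) → ℝ) : Fin N → ℝ :=
  fun i =>
    if (i : ℕ) < n then extFun t (i : ℕ)
    else if (i : ℕ) < N - 1 then extFun y ((i : ℕ) - n)
    else r - (∑ j, t j) - (∑ k, y k)

/-- `n`-point correlation function of the fixed trace LUE (FTLUE) with trace `r`. -/
def ftlueR (α : ℝ) (N n : ℕ) (r : ℝ) (t : Fin n → ℝ) : ℝ :=
  if (∀ i, 0 ≤ t i) ∧ (∑ i, t i) ≤ r then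
    ((N.factorial : ℝ) / ((N - n).factorial : ℝ)) / ftlueZ α N r *
      ∫ y : Fin (N - 1 - n) → ℝ,
        (if (∀ k, 0 ≤ y k) ∧ (∑ i, t i) + (∑ k, y k) ≤ r then
          vdm2 (ftlueVec N n r t y) * lagWeight α (ftlueVec N n r t y) else 0)
  else 0

/-- Full eigenvalue vector for ensembles where all of `x_{n+1},…,x_N` are integrated. -/
def fullVec (N n : ℕ) (t : Fin n → ℝ) (y : Fin (N - n) → ℝ) : Fin N → ℝ :=
  fun i => if (i : ℕ) < n then extFun t (i : ℕ) else extFun y ((i : ℕ) - n)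

/-- Partition function of the bounded trace LUE. -/
def btlueZ (α : ℝ) (N : ℕ) (r : ℝ) : ℝ :=
  ∫ x : Fin N → ℝ,
    (if (∀ i, 0 ≤ x i) ∧ (∑ i, x i) ≤ r then vdm2 x * lagWeight α x else 0)

/-- `n`-point correlation function of the bounded trace LUE (BTLUE). -/
def btlueR (α : ℝ) (N n : ℕ) (r : ℝ) (t : Fin n → ℝ) : ℝ :=
  if ∀ i, 0 ≤ t i then
    ((N.factorial : ℝ) / ((N - n).factorial : ℝ)) / btlueZ α N r *
      ∫ y : Fin (N - n) → ℝ,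
        (if (∀ k, 0 ≤ y k) ∧ (∑ i, t i) + (∑ k, y k) ≤ r then
          vdm2 (fullVec N n t y) * lagWeight α (fullVec N n t y) else 0)
  else 0

/-- Partition function of the LUE with scale `s`. -/
def lueZ (α : ℝ) (N : ℕ) (s : ℝ) : ℝ :=
  s ^ ((N : ℝ) * ((N : ℝ) + α)) *
    ∏ j ∈ Finset.range N, Real.Gamma (1 + ((j : ℝ) + 1)) * Real.Gamma (α + ((j : ℝ) + 1))

/-- Joint eigenvalue density of the LUE with scale `s`. -/
def luePdf (α : ℝ) (N : ℕ) (s : ℝ) (x : Fin N → ℝ) : ℝ :=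
  if ∀ i, 0 ≤ x i then
    (1 / lueZ α N s) * vdm2 x * ∏ i, x i ^ α * Real.exp (-(x i) / s)
  else 0

/-- `n`-point correlation function of the LUE with scale `s`. -/
def lueR (α : ℝ) (N n : ℕ) (s : ℝ) (t : Fin n → ℝ) : ℝ :=
  ((N.factorial : ℝ) / ((N - n).factorial : ℝ)) *
    ∫ y : Fin (N - n) → ℝ,
      (if ∀ k, 0 ≤ y k then luePdf α N s (fullVec N n t y) else 0)

/-- Gamma(N(N+α),1) density. -/
def gammaDens (α : ℝ) (N : ℕ) (x : ℝ) : ℝ :=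
  if 0 ≤ x then
    Real.exp (-x) * x ^ ((N : ℝ) * ((N : ℝ) + α) - 1) / Real.Gamma ((N : ℝ) * ((N : ℝ) + α))
  else 0

/-- Sine kernel. -/
def Ksin (u v : ℝ) : ℝ :=
  if u = v then 1 else Real.sin (π * (u - v)) / (π * (u - v))

/-- Marchenko–Pastur density. -/
def psiMP (x : ℝ) : ℝ :=
  if 0 < x ∧ x ≤ 1 then (2 / π) * Real.sqrt ((1 - x) / x) else 0

/-- Airy function, as a convergent improper integral. -/
def Ai (x : ℝ) : ℝ :=
  limUnder atTop (fun T : ℝ => (1 / π) * ∫ t in (0 : ℝ)..T, Real.cos (t ^ 3 / 3 + x * t))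

/-- Airy kernel. -/
def KAiry (u v : ℝ) : ℝ :=
  if u = v then (deriv Ai u) ^ 2 - u * (Ai u) ^ 2
  else (deriv Ai u * Ai v - deriv Ai v * Ai u) / (u - v)

/-- Bessel function of the first kind of (real) index `α`, as a power series. -/
def besselJ (α : ℝ) (x : ℝ) : ℝ :=
  ∑' m : ℕ,
    ((-1 : ℝ) ^ m / ((m.factorial : ℝ) * Real.Gamma ((m : ℝ) + α + 1))) *
      (x / 2) ^ (2 * (m : ℝ) + α)

/-- Bessel kernel off the diagonal. -/
def KBesselOff (α : ℝ) (u v : ℝ) : ℝ :=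
  (besselJ α (Real.sqrt u) * Real.sqrt v * deriv (besselJ α) (Real.sqrt v) -
      besselJ α (Real.sqrt v) * Real.sqrt u * deriv (besselJ α) (Real.sqrt u)) /
    (2 * (u - v))

/-- Bessel kernel, extended to the diagonal by its limiting value. -/
def KBessel (α : ℝ) (u v : ℝ) : ℝ :=
  if u = v then limUnder (𝓝[≠] u) (fun w => KBesselOff α u w) else KBesselOff α u v

/-- Orthonormal polynomials for the weight `x^α e^{-x}` on `(0,∞)`, at complex arguments. -/
def hkC (α : ℝ) (k : ℕ) (z : ℂ) : ℂ :=
  (Real.sqrt (Real.Gamma ((k : ℝ) + 1) / Real.Gamma ((k : ℝ) + α + 1)) : ℂ) *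
    ∑ j ∈ Finset.range (k + 1),
      (-1 : ℂ) ^ (k - j) *
        ((Real.Gamma ((k : ℝ) + α + 1) /
            (Real.Gamma ((j : ℝ) + α + 1) * ((k - j).factorial : ℝ) * (j.factorial : ℝ)) : ℝ) : ℂ) *
        z ^ j

/-- `φ_k(z) = z^{α/2} e^{-z/2} h_k(z)` (principal branch). -/
def phikC (α : ℝ) (k : ℕ) (z : ℂ) : ℂ :=
  z ^ ((α : ℂ) / 2) * Complex.exp (-z / 2) * hkC α k z

/-- Correlation kernel `K_N(z,w) = ∑_{k<N} φ_k(z) φ_k(w)`. -/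
def KNC (α : ℝ) (N : ℕ) (z w : ℂ) : ℂ := ∑ k ∈ Finset.range N, phikC α k z * phikC α k w

/-- Rescaled kernel `K̃_N(z,w,s) = s⁻¹ K_N(z/s, w/s)`. -/
def KNS (α : ℝ) (N : ℕ) (z w s : ℂ) : ℂ := s⁻¹ * KNC α N (z / s) (w / s)

/-- `Λ(H) = 1 + iH`. -/
def Lam (H : ℝ) : ℂ := 1 + Complex.I * (H : ℂ)

/-- Analytic continuation `ψ̂` of the Marchenko–Pastur density to the upper half plane,
with boundary values `ψ` on the reals. -/
def psihat (z : ℂ) : ℂ :=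
  if z.im = 0 then (psiMP z.re : ℂ)
  else (2 / (Complex.I * (π : ℂ))) * (z - 1) ^ ((1 : ℂ) / 2) / z ^ ((1 : ℂ) / 2)

/-- Characteristic function `φ_N(y) = e^{iy(N+α)} (1+iy/N)^{-N(N+α)}` (principal branch). -/
def phiN (α : ℝ) (N : ℕ) (y : ℝ) : ℂ :=
  Complex.exp (Complex.I * (y : ℂ) * (((N : ℝ) + α : ℝ) : ℂ)) *
    (1 + Complex.I * (y : ℂ) / (N : ℂ)) ^ (-((((N : ℝ) * ((N : ℝ) + α) : ℝ) : ℂ)))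

end RMT

namespace RMT

/-- Monic Laguerre polynomials. -/
def lp (α : ℝ) : ℕ → Polynomial ℝ
  | 0 => 1
  | 1 => Polynomial.X - Polynomial.C (α + 1)
  | (k + 2) => (Polynomial.X - Polynomial.C (2 * ((k : ℝ) + 1) + α + 1)) * lp α (k + 1) -
      Polynomial.C (((k : ℝ) + 1) * ((k : ℝ) + 1 + α)) * lp α k

/-- Squared norms of the monic Laguerre polynomials. -/
def lgam (α : ℝ) : ℕ → ℝ
  | 0 => Real.Gamma (α + 1)
  | (k + 1) => ((k : ℝ) + 1) * ((k : ℝ) + 1 + α) * lgam α k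

lemma lgam_pos {α : ℝ} (hα : -1 < α) (k : ℕ) : 0 < lgam α k := by
  induction k with
  | zero => exact Real.Gamma_pos_of_pos (by linarith)
  | succ k ih =>
    have : (0 : ℝ) ≤ k := Nat.cast_nonneg k
    simp only [lgam]
    have h1 : 0 < (k : ℝ) + 1 + α := by linarith
    positivity

/-- value of monic Laguerre polynomial -/
def lv (α : ℝ) (k : ℕ) (x : ℝ) : ℝ := (lp α k).eval x

lemma lv_zero (α x : ℝ) : lv α 0 x = 1 := by simp [lv, lp]
lemma lv_one (α x : ℝ) : lv α 1 x = x - (α + 1) := by simp [lv, lp]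
lemma lv_succ_succ (α : ℝ) (k : ℕ) (x : ℝ) : lv α (k + 2) x =
    (x - (2 * ((k : ℝ) + 1) + α + 1)) * lv α (k + 1) x -
      (((k : ℝ) + 1) * ((k : ℝ) + 1 + α)) * lv α k x := by simp [lv, lp]

/-- recursion valid for all k, with junk at `k = 0` multiplied by zero -/
lemma lv_rec (α : ℝ) (k : ℕ) (x : ℝ) : x * lv α k x =
    lv α (k + 1) x + (2 * (k : ℝ) + α + 1) * lv α k x +
      ((k : ℝ) * ((k : ℝ) + α)) * lv α (k - 1) x := by
  cases k with
  | zero => simp [lv_zero, lv_one]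
  | succ k =>
    have := lv_succ_succ α k x
    push_cast
    rw [show k + 1 + 1 = k + 2 by ring, this]; ring

lemma lp_natDegree_monic (α : ℝ) (k : ℕ) : (lp α k).natDegree = k ∧ (lp α k).Monic := by
  have key : ∀ k, ((lp α k).natDegree = k ∧ (lp α k).Monic) ∧
      ((lp α (k+1)).natDegree = k+1 ∧ (lp α (k+1)).Monic) := by
    intro k
    induction k with
    | zero =>
      refine ⟨by simp [lp], ?_⟩
      simp only [lp]
      exact ⟨Polynomial.natDegree_X_sub_C _, Polynomial.monic_X_sub_C _⟩
    | succ k ih =>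
      refine ⟨ih.2, ?_⟩
      obtain ⟨⟨h1, h2⟩, h3, h4⟩ := ih
      have hm : ((Polynomial.X - Polynomial.C (2 * ((k : ℝ) + 1) + α + 1)) * lp α (k + 1)).Monic :=
        (Polynomial.monic_X_sub_C _).mul h4
      have hd : ((Polynomial.X - Polynomial.C (2 * ((k : ℝ) + 1) + α + 1)) *
          lp α (k + 1)).natDegree = k + 2 := by
        rw [(Polynomial.monic_X_sub_C _).natDegree_mul h4, h3, Polynomial.natDegree_X_sub_C]; ring
      have hlt : (Polynomial.C (((k : ℝ) + 1) * ((k : ℝ) + 1 + α)) * lp α k).degree <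
          ((Polynomial.X - Polynomial.C (2 * ((k : ℝ) + 1) + α + 1)) * lp α (k + 1)).degree := by
        rw [Polynomial.degree_eq_natDegree hm.ne_zero, hd]
        refine lt_of_le_of_lt (Polynomial.degree_mul_le _ _) ?_
        refine lt_of_le_of_lt (add_le_add_left Polynomial.degree_C_le _) ?_
        rw [zero_add]
        rw [Polynomial.degree_eq_natDegree h2.ne_zero, h1]
        exact_mod_cast (by omega : k < k + 2)
      constructor
      · show ((Polynomial.X - Polynomial.C (2 * ((k : ℝ) + 1) + α + 1)) * lp α (k + 1) -
          Polynomial.C (((k : ℝ) + 1) * ((k : ℝ) + 1 + α)) * lp α k).natDegree = _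
        rw [Polynomial.natDegree_eq_of_degree_eq (Polynomial.degree_sub_eq_left_of_degree_lt hlt), hd]
      · exact hm.sub_of_left hlt
  exact (key k).1

lemma lp_deriv (α : ℝ) (k : ℕ) (x : ℝ) :
    x * (Polynomial.derivative (lp α k)).eval x =
      k * lv α k x + ((k : ℝ) * ((k : ℝ) + α)) * lv α (k - 1) x := by
  have key : ∀ k : ℕ, (x * (Polynomial.derivative (lp α k)).eval x =
      k * lv α k x + ((k : ℝ) * ((k : ℝ) + α)) * lv α (k - 1) x) ∧
      (x * (Polynomial.derivative (lp α (k+1))).eval x =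
      ((k:ℝ)+1) * lv α (k+1) x + (((k:ℝ)+1) * ((k : ℝ)+1 + α)) * lv α k x) := by
    intro k
    induction k with
    | zero => simp [lv_zero, lv_one, lp]; ring
    | succ k ih =>
      refine ⟨by simpa using ih.2, ?_⟩
      obtain ⟨h1, h2⟩ := ih
      have h3 := lv_rec α k x
      have h4 := lv_succ_succ α k x
      have e : (Polynomial.derivative (lp α (k+1+1))).eval x = lv α (k+1) x +
          (x - (2 * ((k : ℝ) + 1) + α + 1)) * (Polynomial.derivative (lp α (k+1))).eval x
          - (((k : ℝ) + 1) * ((k : ℝ) + 1 + α)) * (Polynomial.derivative (lp α k)).eval x := by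
        simp [lp, lv]
      rw [e, show k+1+1 = k+2 by ring, h4]
      push_cast
      linear_combination (x - (2 * ((k : ℝ) + 1) + α + 1)) * h2 -
        (((k : ℝ) + 1) * ((k : ℝ) + 1 + α)) * h1 + (((k : ℝ) + 1) * ((k : ℝ) + 1 + α)) * h3
  exact (key k).1

lemma lv_hasDerivAt (α : ℝ) (k : ℕ) (x : ℝ) (hx : x ≠ 0) :
    HasDerivAt (lv α k) ((k * lv α k x + ((k : ℝ) * ((k : ℝ) + α)) * lv α (k - 1) x) / x) x := by
  rw [← lp_deriv]
  rw [mul_div_cancel_left₀ _ hx]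
  exact (lp α k).hasDerivAt x

lemma lv_continuous (α : ℝ) (k : ℕ) : Continuous (lv α k) := (lp α k).continuous

/-- unnormalised Christoffel sum -/
def lK (α : ℝ) (N : ℕ) (x y : ℝ) : ℝ := ∑ k ∈ range N, lv α k x * lv α k y / lgam α k

lemma lK_CD {α : ℝ} (hα : -1 < α) (N : ℕ) (x y : ℝ) :
    (x - y) * lK α (N+1) x y =
      (lv α (N+1) x * lv α N y - lv α N x * lv α (N+1) y) / lgam α N := by
  induction N with
  | zero => simp [lK, lv_zero, lv_one]; ring
  | succ N ih =>
    have g0 := (lgam_pos hα N).ne'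
    have g1 := (lgam_pos hα (N+1)).ne'
    have e : lgam α (N+1) = ((N : ℝ) + 1) * ((N : ℝ) + 1 + α) * lgam α N := rfl
    have h5 : ((N : ℝ) + 1) * ((N : ℝ) + 1 + α) ≠ 0 := by
      intro h; rw [e, h, zero_mul] at g1; exact g1 rfl
    rw [lK, sum_range_succ, ← lK, mul_add, ih, show N+1+1 = N+2 by ring, lv_succ_succ, lv_succ_succ, e]
    rw [show ∀ a b c d e : ℝ, a / b + c * (d / e) = a / b + c * d / e by intros; ring]
    rw [div_add_div _ _ g0 (mul_ne_zero h5 g0), div_eq_div_iff (by positivity) (by positivity)]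
    ring

lemma lK_diag {α : ℝ} (hα : -1 < α) (N : ℕ) (x : ℝ) :
    x * lK α (N+1) x x =
      (lv α (N+1) x ^ 2 + (2 * ((N:ℝ)+1) + α - x) * lv α (N+1) x * lv α N x
        + ((N:ℝ)+1) * ((N:ℝ)+1+α) * lv α N x ^ 2) / lgam α N := by
  induction N with
  | zero => simp [lK, lv_zero, lv_one]; ring
  | succ N ih =>
    have g0 := (lgam_pos hα N).ne'
    have g1 := (lgam_pos hα (N+1)).ne'
    have e : lgam α (N+1) = ((N : ℝ) + 1) * ((N : ℝ) + 1 + α) * lgam α N := rfl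
    have h5 : ((N : ℝ) + 1) * ((N : ℝ) + 1 + α) ≠ 0 := by
      intro h; rw [e, h, zero_mul] at g1; exact g1 rfl
    rw [lK, sum_range_succ, ← lK, mul_add, ih, show N+1+1 = N+2 by ring, lv_succ_succ, e]
    rw [show ∀ a b c d e : ℝ, a / b + c * (d / e) = a / b + c * d / e by intros; ring]
    rw [div_add_div _ _ g0 (mul_ne_zero h5 g0), div_eq_div_iff (by positivity) (by positivity)]
    push_cast
    ring

/-! The moment functional -/

lemma lw_integrable {α : ℝ} (hα : -1 < α) (p : Polynomial ℝ) :
    IntegrableOn (fun x => p.eval x * (x ^ α * Real.exp (-x))) (Set.Ioi 0) := by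
  induction p using Polynomial.induction_on' with
  | add p q hp hq =>
    simp only [Polynomial.eval_add, add_mul]
    exact hp.add hq
  | monomial j a =>
    have hj : (0:ℝ) ≤ j := Nat.cast_nonneg j
    have h : IntegrableOn (fun x => a * (Real.exp (-x) * x ^ (α + 1 + (j:ℝ) - 1))) (Set.Ioi 0) :=
      (Real.GammaIntegral_convergent (s := α + 1 + j) (by linarith)).const_mul a
    refine h.congr_fun ?_ measurableSet_Ioi
    intro x hx
    have hx : 0 < x := hx
    simp only [Polynomial.eval_monomial]
    rw [show α + 1 + (j:ℝ) - 1 = α + j by ring, Real.rpow_add hx, Real.rpow_natCast]; ring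

/-- The Laguerre moment functional. -/
def lL (α : ℝ) (p : Polynomial ℝ) : ℝ :=
  ∫ x in Set.Ioi (0:ℝ), p.eval x * (x ^ α * Real.exp (-x))

lemma lL_add {α : ℝ} (hα : -1 < α) (p q : Polynomial ℝ) : lL α (p + q) = lL α p + lL α q := by
  simp only [lL, Polynomial.eval_add, add_mul]
  exact integral_add (lw_integrable hα p) (lw_integrable hα q)

lemma lL_sub {α : ℝ} (hα : -1 < α) (p q : Polynomial ℝ) : lL α (p - q) = lL α p - lL α q := by
  simp only [lL, Polynomial.eval_sub, sub_mul]
  exact integral_sub (lw_integrable hα p) (lw_integrable hα q)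

lemma lL_C {α : ℝ} (c : ℝ) (p : Polynomial ℝ) : lL α (Polynomial.C c * p) = c * lL α p := by
  simp only [lL, Polynomial.eval_mul, Polynomial.eval_C, mul_assoc]
  exact integral_const_mul _ _

lemma lL_monomial {α : ℝ} (hα : -1 < α) (j : ℕ) (a : ℝ) :
    lL α (Polynomial.monomial j a) = a * Real.Gamma (α + 1 + j) := by
  unfold lL
  have hj : (0:ℝ) ≤ j := Nat.cast_nonneg j
  rw [Real.Gamma_eq_integral (by linarith), ← integral_const_mul]
  refine setIntegral_congr_fun measurableSet_Ioi ?_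
  intro x hx
  have hx : 0 < x := hx
  simp only [Polynomial.eval_monomial]
  rw [show α + 1 + (j:ℝ) - 1 = α + j by ring, Real.rpow_add hx, Real.rpow_natCast]; ring

lemma lL_parts {α : ℝ} (hα : -1 < α) (p : Polynomial ℝ) :
    lL α (Polynomial.X * Polynomial.derivative p + Polynomial.C (α + 1) * p - Polynomial.X * p) = 0 := by
  induction p using Polynomial.induction_on' with
  | add p q hp hq =>
    have : Polynomial.X * Polynomial.derivative (p + q) + Polynomial.C (α + 1) * (p + q)
        - Polynomial.X * (p + q) =
      (Polynomial.X * Polynomial.derivative p + Polynomial.C (α + 1) * p - Polynomial.X * p) +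
      (Polynomial.X * Polynomial.derivative q + Polynomial.C (α + 1) * q - Polynomial.X * q) := by
      rw [Polynomial.derivative_add]; ring
    rw [this, lL_add hα, hp, hq, add_zero]
  | monomial j a =>
    have hj : (0:ℝ) ≤ j := Nat.cast_nonneg j
    have e1 : Polynomial.X * Polynomial.derivative (Polynomial.monomial j a) =
        Polynomial.C (j:ℝ) * Polynomial.monomial j a := by
      rw [Polynomial.derivative_monomial]
      cases j with
      | zero => simp
      | succ j =>
        rw [Polynomial.X_mul_monomial, Polynomial.C_mul_monomial, mul_comm a]; rfl
    rw [e1, lL_sub hα, lL_add hα, lL_C, lL_C, Polynomial.X_mul_monomial, lL_monomial hα, lL_monomial hα]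
    push_cast
    rw [show α + 1 + ((j:ℝ) + 1) = (α + 1 + j) + 1 by ring,
      Real.Gamma_add_one (by linarith)]
    ring

lemma lp_rec (α : ℝ) (k : ℕ) : Polynomial.X * lp α k =
    lp α (k + 1) + Polynomial.C (2 * (k : ℝ) + α + 1) * lp α k +
      Polynomial.C ((k : ℝ) * ((k : ℝ) + α)) * lp α (k - 1) := by
  apply Polynomial.funext
  intro x
  simpa [lv] using lv_rec α k x

lemma lp_deriv' (α : ℝ) (k : ℕ) : Polynomial.X * Polynomial.derivative (lp α k) =
    Polynomial.C (k:ℝ) * lp α k + Polynomial.C ((k : ℝ) * ((k : ℝ) + α)) * lp α (k - 1) := by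
  apply Polynomial.funext
  intro x
  simpa [lv] using lp_deriv α k x

lemma lL_lp_succ {α : ℝ} (hα : -1 < α) (k : ℕ) : lL α (lp α (k+1)) = 0 := by
  have step : ∀ k : ℕ, lL α (lp α (k+1)) = - k * lL α (lp α k) := by
    intro k
    have h := lL_parts hα (lp α k)
    rw [lp_rec, lp_deriv'] at h
    simp only [lL_add hα, lL_sub hα, lL_C] at h
    linarith
  induction k with
  | zero => simpa using step 0
  | succ k ih => rw [step (k+1), ih, mul_zero]

lemma lL_one {α : ℝ} (hα : -1 < α) : lL α (lp α 0) = lgam α 0 := by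
  have := lL_monomial hα 0 1
  simpa [lp, lgam] using this

lemma lL_orth {α : ℝ} (hα : -1 < α) (j k : ℕ) :
    lL α (lp α j * lp α k) = if j = k then lgam α k else 0 := by
  have key : ∀ j : ℕ, (∀ k, lL α (lp α j * lp α k) = if j = k then lgam α k else 0) ∧
     (∀ k, lL α (lp α (j+1) * lp α k) = if j+1 = k then lgam α k else 0) := by
    have base : ∀ k, lL α (lp α 0 * lp α k) = if 0 = k then lgam α k else 0 := by
      intro k
      rw [show lp α 0 = 1 from rfl, one_mul]
      cases k with
      | zero => simpa using lL_one hα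
      | succ k => simpa using lL_lp_succ hα k
    have step : ∀ j : ℕ, (∀ k, lL α (lp α j * lp α k) = if j = k then lgam α k else 0) →
       (j = 0 ∨ ∀ k, lL α (lp α (j-1) * lp α k) = if j-1 = k then lgam α k else 0) →
       (∀ k, lL α (lp α (j+1) * lp α k) = if j+1 = k then lgam α k else 0) := by
      intro j h1 h2 k
      have e : lp α (j+1) * lp α k = lp α j * lp α (k+1) +
          Polynomial.C (2 * (k : ℝ) + α + 1) * (lp α j * lp α k) +
          Polynomial.C ((k : ℝ) * ((k : ℝ) + α)) * (lp α j * lp α (k-1)) -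
          Polynomial.C (2 * (j : ℝ) + α + 1) * (lp α j * lp α k) -
          Polynomial.C ((j : ℝ) * ((j : ℝ) + α)) * (lp α (j-1) * lp α k) := by
        linear_combination (lp α j) * lp_rec α k - lp α k * lp_rec α j
      rw [e]
      simp only [lL_add hα, lL_sub hα, lL_C, h1]
      have h2' : ((j : ℝ) * ((j : ℝ) + α)) * lL α (lp α (j-1) * lp α k) =
          ((j : ℝ) * ((j : ℝ) + α)) * if j-1 = k then lgam α k else 0 := by
        rcases h2 with rfl | h2
        · simp
        · rw [h2]
      rw [h2']
      have gs : ∀ i : ℕ, lgam α (i+1) = ((i : ℝ) + 1) * ((i : ℝ) + 1 + α) * lgam α i := fun i => rfl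
      rcases Nat.lt_trichotomy j k with h | h | h
      · rcases Nat.eq_or_lt_of_le (Nat.succ_le_of_lt h) with h' | h'
        · subst h'
          have a1 : j ≠ j + 1 + 1 := by omega
          have a3 : j - 1 ≠ j + 1 := by omega
          simp [a3, gs]
          intro h; exact absurd h a1
        · have a1 : j ≠ k + 1 := by omega
          have a2 : j ≠ k := by omega
          have a3 : j ≠ k - 1 := by omega
          have a4 : j - 1 ≠ k := by omega
          have a5 : j + 1 ≠ k := by omega
          simp [a1, a2, a3, a4, a5]
      · subst h
        rcases Nat.eq_zero_or_pos j with rfl | hj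
        · simp
        · have a3 : j ≠ j - 1 := by omega
          have a4 : j - 1 ≠ j := by omega
          simp [a3, a4]
      · rcases Nat.eq_or_lt_of_le (Nat.succ_le_of_lt h) with h' | h'
        · subst h'
          have a2 : k + 1 ≠ k - 1 := by omega
          have a3 : k + 1 + 1 ≠ k := by omega
          simp [a2, a3, gs]
        · have a1 : j ≠ k + 1 := by omega
          have a2 : j ≠ k := by omega
          have a3 : j ≠ k - 1 := by omega
          have a4 : j - 1 ≠ k := by omega
          have a5 : j + 1 ≠ k := by omega
          simp [a1, a2, a3, a4, a5]
    intro j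
    induction j with
    | zero => exact ⟨base, step 0 base (Or.inl rfl)⟩
    | succ j ih => exact ⟨ih.2, step (j+1) ih.2 (Or.inr (by simpa using ih.1))⟩
  exact (key j).1 k

lemma lL_mom1 {α : ℝ} (hα : -1 < α) (k : ℕ) :
    lL α (Polynomial.X * (lp α k * lp α k)) = (2 * (k : ℝ) + α + 1) * lgam α k := by
  have e : Polynomial.X * (lp α k * lp α k) = lp α (k+1) * lp α k +
      Polynomial.C (2 * (k : ℝ) + α + 1) * (lp α k * lp α k) +
      Polynomial.C ((k : ℝ) * ((k : ℝ) + α)) * (lp α (k-1) * lp α k) := by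
    linear_combination (lp α k) * lp_rec α k
  rw [e]
  simp only [lL_add hα, lL_C, lL_orth hα]
  cases k with
  | zero => simp
  | succ k => simp

lemma lL_mom2 {α : ℝ} (hα : -1 < α) (k : ℕ) :
    lL α (Polynomial.X ^ 2 * (lp α k * lp α k)) = ((2 * (k : ℝ) + α + 1) ^ 2 +
      ((k : ℝ) * ((k : ℝ) + α)) + ((k : ℝ) + 1) * ((k : ℝ) + 1 + α)) * lgam α k := by
  have e : Polynomial.X ^ 2 * (lp α k * lp α k) = lp α (k+1) * lp α (k+1) +
      Polynomial.C ((2 * (k : ℝ) + α + 1) ^ 2) * (lp α k * lp α k) +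
      Polynomial.C (((k : ℝ) * ((k : ℝ) + α)) ^ 2) * (lp α (k-1) * lp α (k-1)) +
      Polynomial.C (2 * (2 * (k : ℝ) + α + 1)) * (lp α (k+1) * lp α k) +
      Polynomial.C (2 * ((k : ℝ) * ((k : ℝ) + α))) * (lp α (k+1) * lp α (k-1)) +
      Polynomial.C (2 * (2 * (k : ℝ) + α + 1) * ((k : ℝ) * ((k : ℝ) + α))) * (lp α k * lp α (k-1)) := by
    have h := lp_rec α k
    simp only [map_mul, map_pow, Polynomial.C_ofNat] at h ⊢
    calc Polynomial.X ^ 2 * (lp α k * lp α k) = (Polynomial.X * lp α k) ^ 2 := by ring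
      _ = _ := by rw [h]; ring
  rw [e]
  have gs : ∀ i : ℕ, lgam α (i+1) = ((i : ℝ) + 1) * ((i : ℝ) + 1 + α) * lgam α i := fun i => rfl
  simp only [lL_add hα, lL_C, lL_orth hα]
  cases k with
  | zero => simp [gs]; ring
  | succ k =>
    have a1 : k + 1 + 1 ≠ k := by omega
    simp [gs, a1]; ring

end RMT

namespace RMT

/-- scaled off-diagonal recurrence coefficient -/
def aB (α : ℝ) (N : ℕ) : ℝ := Real.sqrt (1 + α / N)
/-- scaled diagonal coefficient -/
def aC (α : ℝ) (N : ℕ) (y : ℝ) : ℝ := 1 - 2 * y + α / (2 * N)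
/-- local frequency -/
def aW (α : ℝ) (N : ℕ) (y : ℝ) : ℝ := Real.sqrt ((aB α N) ^ 2 - (aC α N y) ^ 2)
/-- quadratic energy -/
def aE (α : ℝ) (N : ℕ) (P X : ℝ → ℝ) (y : ℝ) : ℝ :=
  aB α N * P y ^ 2 + 2 * aC α N y * P y * X y + aB α N * X y ^ 2
/-- adiabatic invariant -/
def aH (α : ℝ) (N : ℕ) (P X : ℝ → ℝ) (y : ℝ) : ℝ := aE α N P X y / aW α N y

lemma growth_aux (κ a b : ℝ) (hκ : 0 ≤ κ) (hab : b - a ≤ 1) (G G' : ℝ → ℝ)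
    (hG : ∀ y ∈ Set.Icc a b, HasDerivAt G (G' y) y)
    (hG' : ∀ y ∈ Set.Icc a b, |G' y| ≤ κ * G y) (hpos : ∀ y ∈ Set.Icc a b, 0 ≤ G y) :
    ∀ y₁ ∈ Set.Icc a b, ∀ y₂ ∈ Set.Icc a b, G y₁ ≤ Real.exp κ * G y₂ := by
  have gen : ∀ s : ℝ, ∀ y ∈ Set.Icc a b, HasDerivAt (fun y => G y * Real.exp (s * y))
      ((G' y + s * G y) * Real.exp (s * y)) y := by
    intro s y hy
    have h1 : HasDerivAt (fun y => Real.exp (s * y)) (Real.exp (s * y) * s) y := by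
      have := ((hasDerivAt_id y).const_mul s).exp
      simpa using this
    have := (hG y hy).mul h1
    refine this.congr_deriv ?_
    ring
  have m1 : MonotoneOn (fun y => G y * Real.exp (κ * y)) (Set.Icc a b) := by
    apply monotoneOn_of_deriv_nonneg (convex_Icc a b)
    · exact fun y hy => (gen κ y hy).continuousAt.continuousWithinAt
    · exact fun y hy => (gen κ y (interior_subset hy)).differentiableAt.differentiableWithinAt
    · intro y hy
      rw [(gen κ y (interior_subset hy)).deriv]
      have := (abs_le.1 (hG' y (interior_subset hy))).1
      exact mul_nonneg (by linarith) (Real.exp_pos _).le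
  have m2 : AntitoneOn (fun y => G y * Real.exp (-κ * y)) (Set.Icc a b) := by
    apply antitoneOn_of_deriv_nonpos (convex_Icc a b)
    · exact fun y hy => (gen (-κ) y hy).continuousAt.continuousWithinAt
    · exact fun y hy => (gen (-κ) y (interior_subset hy)).differentiableAt.differentiableWithinAt
    · intro y hy
      rw [(gen (-κ) y (interior_subset hy)).deriv]
      have := (abs_le.1 (hG' y (interior_subset hy))).2
      exact mul_nonpos_of_nonpos_of_nonneg (by linarith) (Real.exp_pos _).le
  intro y₁ h₁ y₂ h₂
  rcases le_total y₁ y₂ with h | h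
  · have := m1 h₁ h₂ h
    simp only at this
    have e : G y₁ = (G y₁ * Real.exp (κ * y₁)) * Real.exp (-(κ * y₁)) := by
      rw [mul_assoc, ← Real.exp_add]; simp
    rw [e]
    calc _ ≤ G y₂ * Real.exp (κ * y₂) * Real.exp (-(κ * y₁)) := by gcongr
      _ = Real.exp (κ * (y₂ - y₁)) * G y₂ := by
        rw [mul_assoc, ← Real.exp_add, mul_comm]; congr 2; ring
      _ ≤ _ := by
        gcongr
        · exact hpos _ h₂
        · have := h₁.1; have := h₂.2; nlinarith
  · have := m2 h₂ h₁ h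
    simp only at this
    have e : G y₁ = (G y₁ * Real.exp (-κ * y₁)) * Real.exp (κ * y₁) := by
      rw [mul_assoc, ← Real.exp_add]; simp
    rw [e]
    calc _ ≤ G y₂ * Real.exp (-κ * y₂) * Real.exp (κ * y₁) := by gcongr
      _ = Real.exp (κ * (y₁ - y₂)) * G y₂ := by
        rw [mul_assoc, ← Real.exp_add, mul_comm]; congr 2; ring
      _ ≤ _ := by
        gcongr
        · exact hpos _ h₂
        · have := h₂.1; have := h₁.2; nlinarith

/-- Algebraic bounds on the coefficients in the bulk for large N. -/
lemma coeff_bounds (α : ℝ) (δ : ℝ) (hδ : 0 < δ) (hδ2 : δ < 1/2) : ∀ᶠ N : ℕ in atTop,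
    0 < (N:ℝ) ∧ aB α N ^ 2 = 1 + α / N ∧ 0 < aB α N ∧ aB α N ≤ 2 ∧
    ∀ y ∈ Set.Icc δ (1 - δ), |aC α N y| ≤ 2 ∧ δ ≤ aB α N ^ 2 - aC α N y ^ 2 ∧
      δ / 4 ≤ aB α N - |aC α N y| := by
  have h1 : Tendsto (fun N : ℕ => α / (N:ℝ)) atTop (𝓝 0) := tendsto_const_div_atTop_nhds_zero_nat α
  have h2 : ∀ᶠ N : ℕ in atTop, |α / (N:ℝ)| < δ / 4 := by
    have := (h1.abs).eventually (gt_mem_nhds (show |(0:ℝ)| < δ/4 by simp; linarith))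
    exact this
  filter_upwards [h2, eventually_gt_atTop 0] with N hN hN0
  have hN0 : (0:ℝ) < N := by exact_mod_cast hN0
  obtain ⟨l, u⟩ := abs_lt.1 hN
  set a := α / (N:ℝ) with ha
  have hsq : aB α N ^ 2 = 1 + a := Real.sq_sqrt (by linarith)
  have hc : ∀ y, aC α N y = 1 - 2 * y + a / 2 := by
    intro y; rw [aC, ha]; congr 1; field_simp
  have hBpos : 0 < aB α N := Real.sqrt_pos.2 (by linarith)
  have hB2 : aB α N ≤ 2 := by nlinarith
  refine ⟨hN0, hsq, hBpos, hB2, ?_⟩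
  intro y hy
  have hc2 : |aC α N y| ≤ 2 := by
    rw [hc, abs_le]; constructor <;> linarith [hy.1, hy.2]
  have hw : δ ≤ aB α N ^ 2 - aC α N y ^ 2 := by
    rw [hsq, hc]
    nlinarith [hy.1, hy.2, mul_nonneg (sub_nonneg.2 hy.1) (sub_nonneg.2 hy.2)]
  refine ⟨hc2, hw, ?_⟩
  have h3 : aB α N ^ 2 - aC α N y ^ 2 = (aB α N - |aC α N y|) * (aB α N + |aC α N y|) := by
    rw [← sq_abs (aC α N y)]; ring
  rw [h3] at hw
  have h4 : 0 ≤ |aC α N y| := abs_nonneg _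
  by_contra hcon
  push Not at hcon
  rcases le_or_gt (aB α N - |aC α N y|) 0 with h | h
  · have := mul_nonpos_of_nonpos_of_nonneg h (by linarith : 0 ≤ aB α N + |aC α N y|)
    linarith
  · nlinarith

lemma form_lower (b c p q : ℝ) : (b - |c|) * (p^2 + q^2) ≤ b * p^2 + 2 * c * p * q + b * q^2 := by
  rcases abs_cases c with ⟨h, h'⟩ | ⟨h, h'⟩ <;> rw [h]
  · nlinarith [mul_nonneg h' (sq_nonneg (p + q))]
  · nlinarith [mul_nonneg (neg_nonneg.2 h'.le) (sq_nonneg (p - q))]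

lemma aW_bounds {α : ℝ} {N : ℕ} {y δ : ℝ} (hδ : 0 < δ) (hδ2 : δ < 1/2) (hb : 0 < aB α N) (hb2 : aB α N ≤ 2)
    (h : δ ≤ aB α N ^ 2 - aC α N y ^ 2) :
    aW α N y ^ 2 = aB α N ^ 2 - aC α N y ^ 2 ∧ δ ≤ aW α N y ∧ aW α N y ≤ 2 := by
  have h1 : aW α N y ^ 2 = aB α N ^ 2 - aC α N y ^ 2 := Real.sq_sqrt (by linarith)
  have h0 : 0 ≤ aW α N y := Real.sqrt_nonneg _
  refine ⟨h1, ?_, ?_⟩ <;> nlinarith [sq_nonneg (aC α N y)]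

lemma adiabatic (α : ℝ) (δ : ℝ) (hδ : 0 < δ) (hδ2 : δ < 1/2) :
    ∃ ε : ℕ → ℝ, Tendsto ε atTop (𝓝 1) ∧ ∀ᶠ N : ℕ in atTop, ∀ P X : ℝ → ℝ,
      (∀ y, 0 < y → HasDerivAt P ((N / y) * (aC α N y * P y + aB α N * X y)) y) →
      (∀ y, 0 < y → HasDerivAt X (-(N / y) * (aC α N y * X y + aB α N * P y)) y) →
      ∀ y₁ ∈ Set.Icc δ (1 - δ), ∀ y₂ ∈ Set.Icc δ (1 - δ),
        aH α N P X y₁ ≤ ε N * aH α N P X y₂ := by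
  obtain ⟨C1, hC1, hC1def⟩ : ∃ C1 : ℝ, 0 < C1 ∧ C1 = (2 / δ ^ 3) * (8 / δ) :=
    ⟨_, by positivity, rfl⟩
  obtain ⟨C2, hC2, hC2def⟩ : ∃ C2 : ℝ, 0 < C2 ∧ C2 = 2 * ((2 / δ ^ 3 + 24 / δ ^ 5) * (8 / δ)) :=
    ⟨_, by positivity, rfl⟩
  have hl : ∀ C : ℝ, Tendsto (fun N : ℕ => C / (N:ℝ)) atTop (𝓝 0) :=
    fun C => tendsto_const_div_atTop_nhds_zero_nat C
  refine ⟨fun N => (1 + C1 / N) / (1 - C1 / N) * Real.exp (C2 / N), ?_, ?_⟩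
  · have h := (((hl C1).const_add 1).div ((hl C1).const_sub 1) (by norm_num)).mul
      (Real.continuous_exp.continuousAt.tendsto.comp (hl C2))
    simpa using h
  have h3 : ∀ᶠ N : ℕ in atTop, C1 / (N:ℝ) < 1 / 2 :=
    (hl C1).eventually (gt_mem_nhds (by norm_num))
  filter_upwards [coeff_bounds α δ hδ hδ2, h3] with N hN hN3
  obtain ⟨hN0, hBsq, hB, hB2, hy⟩ := hN
  intro P X hP hX
  set b := aB α N with hb
  set I := Set.Icc δ (1 - δ) with hI
  set k : ℝ → ℝ := fun y => b * y / aW α N y ^ 3 with hk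
  set G : ℝ → ℝ := fun y => aH α N P X y + k y / N * (P y ^ 2 - X y ^ 2) with hG
  set k' : ℝ → ℝ := fun y => b / aW α N y ^ 3 - 6 * b * y * aC α N y / aW α N y ^ 5 with hk'
  have hypos : ∀ y ∈ I, 0 < y := fun y h => lt_of_lt_of_le hδ h.1
  have hyle : ∀ y ∈ I, y ≤ 1 := fun y h => h.2.trans (by linarith)
  have hWb : ∀ y ∈ I, aW α N y ^ 2 = b ^ 2 - aC α N y ^ 2 ∧ δ ≤ aW α N y ∧ aW α N y ≤ 2 :=
    fun y h => aW_bounds hδ hδ2 hB hB2 (hy y h).2.1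
  have hWpos : ∀ y ∈ I, 0 < aW α N y := fun y h => lt_of_lt_of_le hδ (hWb y h).2.1
  have hinv : ∀ y ∈ I, ∀ n : ℕ, (1 / aW α N y) ^ n ≤ (1 / δ) ^ n := fun y h n => by
    have := (hWb y h).2.1
    have := hWpos y h
    gcongr
  -- derivative of C and W
  have hCd : ∀ y, HasDerivAt (aC α N) (-2) y := by
    intro y
    have := (((hasDerivAt_id y).const_mul 2).const_sub 1).add_const (α / (2 * N))
    exact this.congr_deriv (by ring)
  have hWd : ∀ y ∈ I, HasDerivAt (aW α N) (2 * aC α N y / aW α N y) y := by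
    intro y h
    have h1 : HasDerivAt (fun y => b ^ 2 - aC α N y ^ 2) (4 * aC α N y) y := by
      have := ((hCd y).pow 2).const_sub (b^2)
      refine this.congr_deriv ?_
      push_cast; ring
    have h2 := h1.sqrt (by have := (hy y h).2.1; linarith)
    refine HasDerivAt.congr_deriv (f := aW α N) h2 ?_
    have := (hWpos y h).ne'
    change 4 * aC α N y / (2 * aW α N y) = _
    field_simp; ring
  have hkd : ∀ y ∈ I, HasDerivAt k (k' y) y := by
    intro y h
    have w0 := (hWpos y h).ne'
    have := ((hasDerivAt_id y).const_mul b).div ((hWd y h).pow 3) (pow_ne_zero 3 w0)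
    refine HasDerivAt.congr_deriv (f := k) this ?_
    simp only [hk', id, Pi.pow_apply]
    field_simp
    push_cast
    ring
  -- H nonneg, S bound
  have hS : ∀ y ∈ I, P y ^ 2 + X y ^ 2 ≤ (8 / δ) * aH α N P X y := by
    intro y h
    have h1 := form_lower b (aC α N y) (P y) (X y)
    have h2 := (hy y h).2.2
    have h4 : (δ / 4) * (P y ^ 2 + X y ^ 2) ≤ aE α N P X y :=
      le_trans (mul_le_mul_of_nonneg_right h2 (by positivity)) h1
    have hE0 : 0 ≤ aE α N P X y := le_trans (by positivity) h4
    have h5 : aE α N P X y ≤ 2 * aH α N P X y := by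
      rw [aH, ← mul_div_assoc, le_div_iff₀ (hWpos y h)]
      nlinarith [(hWb y h).2.2]
    have h6 : (δ / 4) * (P y ^ 2 + X y ^ 2) ≤ 2 * aH α N P X y := h4.trans h5
    rw [div_mul_eq_mul_div, le_div_iff₀ hδ]
    linarith
  have hH0 : ∀ y ∈ I, 0 ≤ aH α N P X y := by
    intro y h
    have := hS y h
    have h1 : 0 ≤ (8 / δ) * aH α N P X y := le_trans (by positivity) this
    exact nonneg_of_mul_nonneg_right h1 (by positivity)
  have hdiff : ∀ y, |P y ^ 2 - X y ^ 2| ≤ P y ^ 2 + X y ^ 2 := by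
    intro y
    rw [abs_le]; constructor <;> nlinarith [sq_nonneg (P y), sq_nonneg (X y)]
  have hkb : ∀ y ∈ I, |k y| ≤ 2 / δ ^ 3 := by
    intro y h
    have h0 := hypos y h
    have := hinv y h 3
    have e : k y = b * y * (1 / aW α N y) ^ 3 := by simp only [hk]; rw [one_div, inv_pow]; rfl
    rw [e, abs_of_nonneg (by have := hWpos y h; positivity)]
    calc b * y * (1 / aW α N y) ^ 3 ≤ 2 * 1 * (1 / δ) ^ 3 := by
          have := hWpos y h
          have := hyle y h
          gcongr
      _ = _ := by rw [one_div, inv_pow]; ring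
  have hk'b : ∀ y ∈ I, |k' y| ≤ 2 / δ ^ 3 + 24 / δ ^ 5 := by
    intro y h
    have h0 := hypos y h
    have e : k' y = b * (1 / aW α N y) ^ 3 - 6 * b * y * aC α N y * (1 / aW α N y) ^ 5 := by
      simp only [hk']; rw [one_div, inv_pow, inv_pow]; rfl
    rw [e]
    have w := hWpos y h
    have i3 := hinv y h 3
    have i5 := hinv y h 5
    calc _ ≤ |b * (1 / aW α N y) ^ 3| + |6 * b * y * aC α N y * (1 / aW α N y) ^ 5| := abs_sub _ _
      _ = b * (1 / aW α N y) ^ 3 + 6 * b * y * |aC α N y| * (1 / aW α N y) ^ 5 := by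
        rw [abs_of_nonneg (by positivity), abs_mul, abs_mul, abs_of_nonneg (by positivity : 0 ≤ 6 * b * y),
          abs_of_nonneg (by positivity : 0 ≤ (1 / aW α N y) ^ 5)]
      _ ≤ 2 * (1/δ)^3 + 6 * 2 * 1 * 2 * (1/δ)^5 := by
        have a1 := hyle y h
        have a2 := (hy y h).1
        gcongr ?_ * ?_ + 6 * ?_ * ?_ * ?_ * ?_
      _ = _ := by rw [one_div, inv_pow, inv_pow]; ring
  have hGH : ∀ y ∈ I, |G y - aH α N P X y| ≤ C1 / N * aH α N P X y := by
    intro y h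
    simp only [hG, add_sub_cancel_left]
    rw [abs_mul, abs_div, abs_of_pos hN0]
    calc |k y| / N * |P y ^ 2 - X y ^ 2| ≤ (2 / δ ^ 3) / N * ((8 / δ) * aH α N P X y) := by
          gcongr
          · exact hkb y h
          · exact (hdiff y).trans (hS y h)
      _ = _ := by rw [hC1def]; ring
  have hGl : ∀ y ∈ I, (1 - C1 / N) * aH α N P X y ≤ G y := by
    intro y h
    have := (abs_le.1 (hGH y h)).1
    linarith
  have hGu : ∀ y ∈ I, G y ≤ (1 + C1 / N) * aH α N P X y := by
    intro y h
    have := (abs_le.1 (hGH y h)).2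
    linarith
  have hHG : ∀ y ∈ I, aH α N P X y ≤ 2 * G y := by
    intro y h
    have := hGl y h
    have := hH0 y h
    nlinarith
  -- derivative of G
  have hGd : ∀ y ∈ I, HasDerivAt G (k' y / N * (P y ^ 2 - X y ^ 2)) y := by
    intro y h
    have y0 := hypos y h
    have w0 := (hWpos y h).ne'
    have dP := hP y y0
    have dX := hX y y0
    have dE : HasDerivAt (aE α N P X) (-4 * P y * X y) y := by
      have := (((dP.pow 2).const_mul b).add ((((hCd y).const_mul 2).mul dP).mul dX)).add
        ((dX.pow 2).const_mul b)
      refine HasDerivAt.congr_deriv (f := aE α N P X) this ?_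
      simp only [Pi.mul_apply]
      field_simp
      push_cast
      ring
    have dH := dE.div (hWd y h) w0
    have dS := ((hkd y h).div_const (N:ℝ)).mul ((dP.pow 2).sub (dX.pow 2))
    have := dH.add dS
    refine HasDerivAt.congr_deriv (f := G) this ?_
    have hw := (hWb y h).1
    simp only [aE, hk, hk', Pi.sub_apply, Pi.pow_apply]
    have e4 : aW α N y ^ 4 = (b ^ 2 - aC α N y ^ 2) * aW α N y ^ 2 := by rw [← hw]; ring
    field_simp
    push_cast
    rw [hw]
    ring
  have main := growth_aux (C2 / N) δ (1 - δ) (by positivity) (by linarith) G _ hGd (by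
    intro y h
    rw [abs_mul, abs_div, abs_of_pos hN0]
    calc |k' y| / N * |P y ^ 2 - X y ^ 2| ≤ (2 / δ ^ 3 + 24 / δ ^ 5) / N * ((8 / δ) * (2 * G y)) := by
          gcongr
          · exact hk'b y h
          · exact (hdiff y).trans ((hS y h).trans (by gcongr; exact hHG y h))
      _ = _ := by rw [hC2def]; ring) (fun y h => by have := hHG y h; have := hH0 y h; linarith)
  intro y₁ h₁ y₂ h₂
  have m := main y₁ h₁ y₂ h₂
  have p : 0 < 1 - C1 / (N:ℝ) := by linarith
  have : aH α N P X y₁ ≤ G y₁ / (1 - C1 / N) := by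
    rw [le_div_iff₀ p]; have := hGl y₁ h₁; linarith
  calc _ ≤ G y₁ / (1 - C1 / N) := this
    _ ≤ (Real.exp (C2 / N) * ((1 + C1 / N) * aH α N P X y₂)) / (1 - C1 / N) := by
      gcongr
      exact m.trans (by gcongr; exact hGu y₂ h₂)
    _ = _ := by ring

end RMT

namespace RMT

/-- Laguerre functions (orthonormal on the half line, extended by zero). -/
def lphi (α : ℝ) (k : ℕ) (x : ℝ) : ℝ :=
  if 0 < x then x ^ (α / 2) * Real.exp (-x / 2) * lv α k x / Real.sqrt (lgam α k) else 0

/-- Laguerre kernel -/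
def lker (α : ℝ) (N : ℕ) (x y : ℝ) : ℝ := ∑ k ∈ range N, lphi α k x * lphi α k y

def sP (α : ℝ) (N : ℕ) (y : ℝ) : ℝ := lphi α N (4 * N * y)
def sX (α : ℝ) (N : ℕ) (y : ℝ) : ℝ := lphi α (N - 1) (4 * N * y)

lemma lphi_mul {α : ℝ} (hα : -1 < α) (j k : ℕ) {x : ℝ} (hx : 0 < x) : lphi α j x * lphi α k x =
    (lv α j x * lv α k x) * (x ^ α * Real.exp (-x)) / (Real.sqrt (lgam α j) * Real.sqrt (lgam α k)) := by
  simp only [lphi, if_pos hx]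
  have e1 : x ^ α = x ^ (α/2) * x ^ (α/2) := by rw [← Real.rpow_add hx]; ring_nf
  have e2 : Real.exp (-x) = Real.exp (-x/2) * Real.exp (-x/2) := by rw [← Real.exp_add]; ring_nf
  rw [e1, e2, div_mul_div_comm]
  ring

lemma lker_eq {α : ℝ} (hα : -1 < α) (N : ℕ) {x y : ℝ} (hx : 0 < x) (hy : 0 < y) :
    lker α N x y = (x ^ (α / 2) * Real.exp (-x / 2)) * (y ^ (α / 2) * Real.exp (-y / 2)) * lK α N x y := by
  simp only [lker, lK, mul_sum, lphi, if_pos hx, if_pos hy]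
  refine sum_congr rfl fun k _ => ?_
  have := Real.mul_self_sqrt (lgam_pos hα k).le
  rw [div_mul_div_comm, this]
  ring

lemma lphi_hasDerivAt {α : ℝ} (hα : -1 < α) (k : ℕ) {x : ℝ} (hx : 0 < x) :
    HasDerivAt (lphi α k) (((α/2 - x/2) * lphi α k x + x ^ (α / 2) * Real.exp (-x / 2) *
      (k * lv α k x + ((k : ℝ) * ((k : ℝ) + α)) * lv α (k - 1) x) / Real.sqrt (lgam α k)) / x) x := by
  have h1 : HasDerivAt (fun x : ℝ => x ^ (α/2)) (α / 2 * x ^ (α/2 - 1)) x :=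
    Real.hasDerivAt_rpow_const (Or.inl hx.ne')
  have h2 : HasDerivAt (fun x : ℝ => Real.exp (-x/2)) (Real.exp (-x/2) * (-1/2)) x :=
    (((hasDerivAt_id x).neg).div_const 2).exp
  have h3 := ((h1.mul h2).mul (lv_hasDerivAt α k x hx.ne')).div_const (Real.sqrt (lgam α k))
  have h4 : (fun x => (((fun x : ℝ => x ^ (α/2)) * fun x : ℝ => Real.exp (-x/2)) * lv α k) x /
      Real.sqrt (lgam α k)) =ᶠ[𝓝 x] lphi α k := by
    filter_upwards [lt_mem_nhds hx] with z hz
    simp [lphi, hz]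
  refine (h3.congr_of_eventuallyEq h4.symm).congr_deriv ?_
  simp only [lphi, if_pos hx, Pi.mul_apply]
  rw [Real.rpow_sub_one hx.ne']
  have := (Real.sqrt_pos.2 (lgam_pos hα k)).ne'
  field_simp
  ring

lemma sqrt_lgam_succ {α : ℝ} (hα : -1 < α) (k : ℕ) :
    Real.sqrt (lgam α (k+1)) = ((k+1 : ℕ) : ℝ) * aB α (k+1) * Real.sqrt (lgam α k) ∧
    (((k+1 : ℕ) : ℝ) * aB α (k+1)) ^ 2 = ((k:ℝ)+1) * ((k:ℝ)+1+α) ∧ 0 < aB α (k+1) := by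
  have hk : (0:ℝ) ≤ k := Nat.cast_nonneg k
  have h1 : 0 < 1 + α / ((k+1 : ℕ) : ℝ) := by
    push_cast
    have : -1 < α / ((k:ℝ)+1) := by
      rw [lt_div_iff₀ (by positivity)]; linarith
    linarith
  have h2 : (((k+1 : ℕ) : ℝ) * aB α (k+1)) ^ 2 = ((k:ℝ)+1) * ((k:ℝ)+1+α) := by
    rw [mul_pow, aB, Real.sq_sqrt h1.le]; push_cast; field_simp
  refine ⟨?_, h2, Real.sqrt_pos.2 h1⟩
  rw [show lgam α (k+1) = ((k : ℝ) + 1) * ((k : ℝ) + 1 + α) * lgam α k from rfl, ← h2,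
    Real.sqrt_mul (sq_nonneg _), Real.sqrt_sq]
  have := Real.sqrt_nonneg (1 + α / ((k+1 : ℕ) : ℝ))
  rw [aB]; positivity

lemma sP_deriv {α : ℝ} (hα : -1 < α) {N : ℕ} (hN : 1 ≤ N) {y : ℝ} (hy : 0 < y) :
    HasDerivAt (sP α N) ((N / y) * (aC α N y * sP α N y + aB α N * sX α N y)) y := by
  obtain ⟨k, rfl⟩ : ∃ k, N = k + 1 := ⟨N - 1, by omega⟩
  obtain ⟨s1, s2, s3⟩ := sqrt_lgam_succ hα k
  have hM : (0:ℝ) < ((k+1 : ℕ) : ℝ) := by positivity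
  set M : ℝ := ((k+1 : ℕ) : ℝ) with hMdef
  have hx : 0 < 4 * M * y := by positivity
  have h := (lphi_hasDerivAt hα (k+1) hx)
  have h0 : HasDerivAt (fun y : ℝ => 4 * M * y) (4 * M) y := by
    simpa using (hasDerivAt_id y).const_mul (4 * M)
  have h1 := h.comp y h0
  refine HasDerivAt.congr_deriv (f := sP α (k+1)) h1 ?_
  simp only [sP, sX, aC, ← hMdef, lphi, if_pos hx, Nat.add_sub_cancel]
  have g := (Real.sqrt_pos.2 (lgam_pos hα k)).ne'
  have hkM : (k:ℝ) + 1 = M := by rw [hMdef]; push_cast; rfl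
  rw [hkM] at s2
  rw [← s2, s1]
  have := hM.ne'
  have := s3.ne'
  field_simp
  ring

lemma sX_deriv {α : ℝ} (hα : -1 < α) {N : ℕ} (hN : 1 ≤ N) {y : ℝ} (hy : 0 < y) :
    HasDerivAt (sX α N) (-(N / y) * (aC α N y * sX α N y + aB α N * sP α N y)) y := by
  obtain ⟨k, rfl⟩ : ∃ k, N = k + 1 := ⟨N - 1, by omega⟩
  obtain ⟨s1, s2, s3⟩ := sqrt_lgam_succ hα k
  have hM : (0:ℝ) < ((k+1 : ℕ) : ℝ) := by positivity
  set M : ℝ := ((k+1 : ℕ) : ℝ) with hMdef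
  have hx : 0 < 4 * M * y := by positivity
  have h := (lphi_hasDerivAt hα k hx)
  have h0 : HasDerivAt (fun y : ℝ => 4 * M * y) (4 * M) y := by
    simpa using (hasDerivAt_id y).const_mul (4 * M)
  have h1 := h.comp y h0
  refine HasDerivAt.congr_deriv (f := sX α (k+1)) h1 ?_
  have hr := lv_rec α k (4 * M * y)
  have hr' : ((k : ℝ) * ((k : ℝ) + α)) * lv α (k - 1) (4 * M * y) = 4 * M * y * lv α k (4 * M * y)
     - lv α (k + 1) (4 * M * y) - (2 * (k : ℝ) + α + 1) * lv α k (4 * M * y) := by linarith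
  rw [hr']
  simp only [sP, sX, aC, ← hMdef, lphi, if_pos hx, Nat.add_sub_cancel]
  have g := (Real.sqrt_pos.2 (lgam_pos hα k)).ne'
  have hkM : (k:ℝ) = M - 1 := by rw [hMdef]; push_cast; ring
  rw [s1, hkM]
  have := hM.ne'
  have := s3.ne'
  field_simp
  ring

lemma lker_diag {α : ℝ} (hα : -1 < α) {N : ℕ} (hN : 1 ≤ N) {y : ℝ} (hy : 0 < y) :
    4 * y * lker α N (4 * N * y) (4 * N * y) = N * aB α N * aE α N (sP α N) (sX α N) y := by
  obtain ⟨k, rfl⟩ : ∃ k, N = k + 1 := ⟨N - 1, by omega⟩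
  obtain ⟨s1, s2, s3⟩ := sqrt_lgam_succ hα k
  have hM : (0:ℝ) < ((k+1 : ℕ) : ℝ) := by positivity
  set M : ℝ := ((k+1 : ℕ) : ℝ) with hMdef
  have hx : 0 < 4 * M * y := by positivity
  rw [lker_eq hα _ hx hx]
  have hd := lK_diag hα k (4 * M * y)
  have hkM : (k:ℝ) + 1 = M := by rw [hMdef]; push_cast; ring
  rw [hkM] at hd s2
  have hd' : lK α (k+1) (4 * M * y) (4 * M * y) = (lv α (k + 1) (4 * M * y) ^ 2 + (2 * M + α - 4 * M * y) * lv α (k + 1) (4 * M * y) * lv α k (4 * M * y) +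
        M * (M + α) * lv α k (4 * M * y) ^ 2) / lgam α k / (4 * M * y) := by
    rw [← hd]; field_simp
  rw [hd', aE]
  have g := (Real.sqrt_pos.2 (lgam_pos hα k)).ne'
  have gg := Real.mul_self_sqrt (lgam_pos hα k).le
  simp only [sP, sX, aC, ← hMdef, lphi, if_pos hx, Nat.add_sub_cancel]
  rw [s1, ← s2]
  generalize Real.sqrt (lgam α k) = G at *
  rw [← gg]
  have := hM.ne'
  have := s3.ne'
  field_simp
  ring

lemma lker_CD {α : ℝ} (hα : -1 < α) {N : ℕ} (hN : 1 ≤ N) {u v : ℝ} (hu : 0 < u) (hv : 0 < v) :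
    4 * (u - v) * lker α N (4 * N * u) (4 * N * v) =
      aB α N * (sP α N u * sX α N v - sX α N u * sP α N v) := by
  obtain ⟨k, rfl⟩ : ∃ k, N = k + 1 := ⟨N - 1, by omega⟩
  obtain ⟨s1, s2, s3⟩ := sqrt_lgam_succ hα k
  have hM : (0:ℝ) < ((k+1 : ℕ) : ℝ) := by positivity
  set M : ℝ := ((k+1 : ℕ) : ℝ) with hMdef
  have hx : 0 < 4 * M * u := by positivity
  have hx' : 0 < 4 * M * v := by positivity
  rw [lker_eq hα _ hx hx']
  have hd := lK_CD hα k (4 * M * u) (4 * M * v)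
  have e : 4 * (u - v) = (4 * M * u - 4 * M * v) / M := by field_simp
  have g := (Real.sqrt_pos.2 (lgam_pos hα k)).ne'
  have gg := Real.mul_self_sqrt (lgam_pos hα k).le
  have e2 : ∀ a b : ℝ, (4 * M * u - 4 * M * v) / M * (a * b * lK α (k+1) (4 * M * u) (4 * M * v)) =
      a * b / M * ((4 * M * u - 4 * M * v) * lK α (k+1) (4 * M * u) (4 * M * v)) := by
    intros; ring
  rw [e, e2, hd]
  simp only [sP, sX, ← hMdef, lphi, if_pos hx, if_pos hx', Nat.add_sub_cancel]
  rw [s1]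
  generalize Real.sqrt (lgam α k) = G at *
  rw [← gg]
  have := hM.ne'
  have := s3.ne'
  field_simp

lemma lphi_integral {α : ℝ} (hα : -1 < α) (j k : ℕ) (q : Polynomial ℝ) :
    IntegrableOn (fun x => q.eval x * (lphi α j x * lphi α k x)) (Set.Ioi 0) ∧
    ∫ x in Set.Ioi (0:ℝ), q.eval x * (lphi α j x * lphi α k x) =
      lL α (q * (lp α j * lp α k)) / (Real.sqrt (lgam α j) * Real.sqrt (lgam α k)) := by
  have e : Set.EqOn (fun x => q.eval x * (lphi α j x * lphi α k x))
    (fun x => ((q * (lp α j * lp α k)).eval x * (x ^ α * Real.exp (-x))) /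
      (Real.sqrt (lgam α j) * Real.sqrt (lgam α k))) (Set.Ioi 0) := by
    intro x hx
    simp only
    rw [lphi_mul hα _ _ hx]
    simp only [Polynomial.eval_mul, lv]; ring
  constructor
  · refine IntegrableOn.congr_fun ?_ e.symm measurableSet_Ioi
    exact (lw_integrable hα _).div_const _
  · rw [setIntegral_congr_fun measurableSet_Ioi e, lL, integral_div]

lemma lphi_measurable (α : ℝ) (k : ℕ) : Measurable (lphi α k) := by
  unfold lphi
  refine Measurable.ite measurableSet_Ioi ?_ measurable_const
  have := (lv_continuous α k).measurable
  fun_prop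

/-- orthonormality over the real line -/
lemma lphi_orth {α : ℝ} (hα : -1 < α) (j k : ℕ) :
    Integrable (fun x => lphi α j x * lphi α k x) ∧
    ∫ x, lphi α j x * lphi α k x = if j = k then 1 else 0 := by
  obtain ⟨h1, h2⟩ := lphi_integral hα j k 1
  simp only [Polynomial.eval_one, one_mul] at h1 h2
  have hz : ∀ x, x ∉ Set.Ioi (0:ℝ) → lphi α j x * lphi α k x = 0 := by
    intro x hx
    have : ¬ 0 < x := hx
    simp [lphi, this]
  constructor
  · exact (integrableOn_iff_integrable_of_support_subset (by
      intro x hx; by_contra h; exact hx (hz x h))).1 h1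
  · rw [← setIntegral_eq_integral_of_forall_compl_eq_zero hz, h2, lL_orth hα]
    split_ifs with h
    · subst h
      rw [Real.mul_self_sqrt (lgam_pos hα j).le, div_self (lgam_pos hα j).ne']
    · simp

lemma lker_nonneg (α : ℝ) (N : ℕ) (x : ℝ) : 0 ≤ lker α N x x :=
  sum_nonneg fun k _ => mul_self_nonneg _

lemma lker_integral {α : ℝ} (hα : -1 < α) (N : ℕ) (q : Polynomial ℝ) :
    IntegrableOn (fun x => q.eval x * lker α N x x) (Set.Ioi 0) ∧
    ∫ x in Set.Ioi (0:ℝ), q.eval x * lker α N x x =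
      ∑ k ∈ range N, lL α (q * (lp α k * lp α k)) / lgam α k := by
  simp only [lker, mul_sum]
  constructor
  · exact integrable_finsetSum _ fun k _ => (lphi_integral hα k k q).1
  · rw [integral_finsetSum _ fun k _ => (lphi_integral hα k k q).1]
    refine sum_congr rfl fun k _ => ?_
    rw [(lphi_integral hα k k q).2, Real.mul_self_sqrt (lgam_pos hα k).le]

/-- scaled one-point density -/
def rho (α : ℝ) (N : ℕ) (y : ℝ) : ℝ := 4 * lker α N (4 * N * y) (4 * N * y)

lemma rho_nonneg (α : ℝ) (N : ℕ) (y : ℝ) : 0 ≤ rho α N y :=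
  mul_nonneg (by norm_num) (lker_nonneg _ _ _)

lemma rho_scale {N : ℕ} (hN : 1 ≤ N) (g : ℝ → ℝ) (α : ℝ) :
    ∫ y in Set.Ioi (0:ℝ), g (4 * N * y) * rho α N y = (1/N) * ∫ x in Set.Ioi (0:ℝ), g x * lker α N x x := by
  have hN' : (0:ℝ) < N := by exact_mod_cast hN
  have := integral_comp_mul_left_Ioi (fun x => g x * lker α N x x) 0 (show (0:ℝ) < 4 * N by positivity)
  rw [mul_zero, smul_eq_mul] at this
  have e : ∀ y, g (4 * N * y) * rho α N y = 4 * (g (4*N*y) * lker α N (4*N*y) (4*N*y)) := by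
    intro y; rw [rho]; ring
  simp_rw [e]
  rw [integral_const_mul, this]
  field_simp

lemma rho_mass {α : ℝ} (hα : -1 < α) {N : ℕ} (hN : 1 ≤ N) :
    IntegrableOn (rho α N) (Set.Ioi 0) ∧ ∫ y in Set.Ioi (0:ℝ), rho α N y = 1 := by
  have hN' : (0:ℝ) < N := by exact_mod_cast hN
  obtain ⟨h1, h2⟩ := lker_integral hα N 1
  simp only [Polynomial.eval_one, one_mul] at h1 h2
  constructor
  · have := (integrableOn_Ioi_comp_mul_left_iff (fun x => lker α N x x) 0
      (show (0:ℝ) < 4 * N by positivity)).2 (by simpa using h1)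
    exact this.const_mul 4
  · have := rho_scale hN (fun _ => 1) α
    simp only [one_mul] at this
    rw [this, h2]
    have : ∀ k ∈ range N, lL α (lp α k * lp α k) / lgam α k = 1 := by
      intro k _
      rw [lL_orth hα, if_pos rfl, div_self (lgam_pos hα k).ne']
    rw [sum_congr rfl this]
    simp
    field_simp

lemma rho_second {α : ℝ} (hα : -1 < α) {N : ℕ} (hN : 1 ≤ N) :
    IntegrableOn (fun y => y * (1 - y) * rho α N y) (Set.Ioi 0) ∧
    ∫ y in Set.Ioi (0:ℝ), y * (1 - y) * rho α N y =
      (1 / (16 * (N:ℝ)^3)) * ∑ k ∈ range N, (4 * N * (2 * (k : ℝ) + α + 1) - ((2 * (k : ℝ) + α + 1) ^ 2 +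
      ((k : ℝ) * ((k : ℝ) + α)) + ((k : ℝ) + 1) * ((k : ℝ) + 1 + α))) := by
  have hN' : (0:ℝ) < N := by exact_mod_cast hN
  set q : Polynomial ℝ := Polynomial.C (4 * (N:ℝ)) * Polynomial.X - Polynomial.X ^ 2 with hq
  have hqe : ∀ x, q.eval x = 4 * N * x - x^2 := by intro x; simp [hq]
  obtain ⟨h1, h2⟩ := lker_integral hα N q
  constructor
  · have := (integrableOn_Ioi_comp_mul_left_iff (fun x => q.eval x * lker α N x x) 0
      (show (0:ℝ) < 4 * N by positivity)).2 (by simpa using h1)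
    refine IntegrableOn.congr_fun (this.const_mul (4 / (4 * (N:ℝ))^2)) ?_ measurableSet_Ioi
    intro y _
    simp only [hqe, rho]
    field_simp
  · have := rho_scale hN (fun x => q.eval x / (16 * (N:ℝ)^2)) α
    have e : ∀ y, y * (1 - y) * rho α N y = q.eval (4 * N * y) / (16 * (N:ℝ)^2) * rho α N y := by
      intro y; rw [hqe]; field_simp; ring
    simp_rw [e]
    rw [this]
    have e2 : ∀ x, q.eval x / (16 * (N:ℝ)^2) * lker α N x x = (1 / (16 * (N:ℝ)^2)) * (q.eval x * lker α N x x) := by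
      intro x; ring
    simp_rw [e2]
    rw [integral_const_mul, h2, ← mul_assoc]
    congr 1
    · field_simp
    · refine sum_congr rfl fun k _ => ?_
      have g := (lgam_pos hα k).ne'
      rw [hq, sub_mul, lL_sub hα, mul_assoc, lL_C, lL_mom1 hα, lL_mom2 hα]
      field_simp

end RMT

namespace RMT

def gJ (y : ℝ) : ℝ := 2 * (Real.sqrt y * Real.sqrt (1 - y)) / y
def FJ (y : ℝ) : ℝ := 2 * (Real.sqrt y * Real.sqrt (1 - y)) + 2 * Real.arcsin (Real.sqrt y)
def FL (y : ℝ) : ℝ := (-2/3 * y^2 + 7/6 * y - 1/4) * (Real.sqrt y * Real.sqrt (1 - y)) + 1/4 * Real.arcsin (Real.sqrt y)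

lemma FJL_deriv {y : ℝ} (h0 : 0 < y) (h1 : y < 1) :
    HasDerivAt FJ (gJ y) y ∧ HasDerivAt FL (y * (1 - y) * gJ y) y := by
  have hs : HasDerivAt (fun y : ℝ => Real.sqrt y) (1 / (2 * Real.sqrt y)) y :=
    Real.hasDerivAt_sqrt h0.ne'
  have hc : HasDerivAt (fun y : ℝ => Real.sqrt (1 - y)) (-1 / (2 * Real.sqrt (1 - y))) y := by
    have := ((hasDerivAt_id y).const_sub 1).sqrt (by simp; linarith)
    simpa using this
  have hs1 : Real.sqrt y < 1 := by rw [Real.sqrt_lt' one_pos]; simpa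
  have hs0 : 0 < Real.sqrt y := Real.sqrt_pos.2 h0
  have hc0 : 0 < Real.sqrt (1 - y) := Real.sqrt_pos.2 (by linarith)
  have ha : HasDerivAt (fun y : ℝ => Real.arcsin (Real.sqrt y)) (1 / Real.sqrt (1 - y) * (1 / (2 * Real.sqrt y))) y := by
    have := (Real.hasDerivAt_arcsin (by linarith) hs1.ne).comp y hs
    rw [Real.sq_sqrt h0.le] at this
    exact this
  have hsc := hs.mul hc
  have e1 := Real.sq_sqrt h0.le
  have e2 := Real.sq_sqrt (show 0 ≤ 1 - y by linarith)
  constructor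
  · refine HasDerivAt.congr_deriv (f := FJ) ((hsc.const_mul 2).add (ha.const_mul 2)) ?_
    simp only [gJ]
    generalize hS : Real.sqrt y = S at *
    generalize hC : Real.sqrt (1 - y) = C at *
    rw [← e1] at *
    field_simp
    nlinarith
  · have hp : HasDerivAt (fun y : ℝ => -2/3 * y^2 + 7/6 * y - 1/4) (-2/3 * (2 * y) + 7/6) y := by
      have := (((hasDerivAt_pow 2 y).const_mul (-2/3)).add ((hasDerivAt_id y).const_mul (7/6))).sub_const (1/4)
      simpa using this
    refine HasDerivAt.congr_deriv (f := FL) ((hp.mul hsc).add (ha.const_mul (1/4))) ?_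
    simp only [gJ, Pi.mul_apply]
    generalize hS : Real.sqrt y = S at *
    generalize hC : Real.sqrt (1 - y) = C at *
    rw [← e1] at *
    have e3 : C^2 = 1 - S^2 := e2
    have : C^4 = (1 - S^2)^2 := by rw [← e3]; ring
    field_simp
    ring_nf
    simp only [e3]
    ring

lemma gJ_cont {δ : ℝ} (hδ : 0 < δ) : ContinuousOn gJ (Set.Icc δ (1 - δ)) := by
  unfold gJ
  refine ContinuousOn.div (by fun_prop) continuousOn_id ?_
  intro y hy; exact (lt_of_lt_of_le hδ hy.1).ne'

lemma J_int {δ : ℝ} (hδ : 0 < δ) (hδ2 : δ < 1/2) :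
    (∫ y in δ..(1-δ), gJ y) = FJ (1 - δ) - FJ δ ∧
    (∫ y in δ..(1-δ), y * (1 - y) * gJ y) = FL (1 - δ) - FL δ := by
  have hle : δ ≤ 1 - δ := by linarith
  constructor
  · refine intervalIntegral.integral_eq_sub_of_hasDerivAt (fun y hy => ?_) ?_
    · rw [Set.uIcc_of_le hle] at hy
      exact (FJL_deriv (by linarith [hy.1]) (by linarith [hy.2])).1
    · refine ContinuousOn.intervalIntegrable ?_
      rw [Set.uIcc_of_le hle]; exact gJ_cont hδ
  · refine intervalIntegral.integral_eq_sub_of_hasDerivAt (fun y hy => ?_) ?_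
    · rw [Set.uIcc_of_le hle] at hy
      exact (FJL_deriv (by linarith [hy.1]) (by linarith [hy.2])).2
    · refine ContinuousOn.intervalIntegrable ?_
      rw [Set.uIcc_of_le hle]
      exact ContinuousOn.mul (by fun_prop) (gJ_cont hδ)

lemma FJL_lim : Tendsto (fun δ => FJ (1 - δ) - FJ δ) (𝓝 0) (𝓝 π) ∧
    Tendsto (fun δ => FL (1 - δ) - FL δ) (𝓝 0) (𝓝 (π / 8)) := by
  have c1 : Continuous (fun δ => FJ (1 - δ) - FJ δ) := by
    unfold FJ; fun_prop
  have c2 : Continuous (fun δ => FL (1 - δ) - FL δ) := by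
    unfold FL; fun_prop
  have := c1.tendsto 0
  have := c2.tendsto 0
  refine ⟨?_, ?_⟩
  · convert c1.tendsto 0 using 2
    simp [FJ]; ring
  · convert c2.tendsto 0 using 2
    simp [FL]; ring

/-- the weight relating the density to the adiabatic invariant -/
def wN (α : ℝ) (N : ℕ) (y : ℝ) : ℝ := aB α N * aW α N y / y

lemma aB_lim (α : ℝ) : Tendsto (aB α) atTop (𝓝 1) := by
  have h1 : Tendsto (fun N : ℕ => α / (N:ℝ)) atTop (𝓝 0) := tendsto_const_div_atTop_nhds_zero_nat α
  have := (h1.const_add 1).sqrt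
  simp only [add_zero, Real.sqrt_one] at this
  exact this

lemma aC_lim (α : ℝ) {y : ℝ} {u : ℕ → ℝ} (hu : Tendsto u atTop (𝓝 y)) :
    Tendsto (fun N => aC α N (u N)) atTop (𝓝 (1 - 2 * y)) := by
  have h1 : Tendsto (fun N : ℕ => (α/2) / (N:ℝ)) atTop (𝓝 0) := tendsto_const_div_atTop_nhds_zero_nat _
  have := (((hu.const_mul 2).const_sub 1).add h1)
  simp only [add_zero] at this
  refine this.congr fun N => ?_
  rw [aC, div_div]

lemma aW_lim (α : ℝ) {y : ℝ} {u : ℕ → ℝ} (hu : Tendsto u atTop (𝓝 y)) (h0 : 0 < y) :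
    Tendsto (fun N => aW α N (u N)) atTop (𝓝 (2 * (Real.sqrt y * Real.sqrt (1 - y)))) := by
  have := (((aB_lim α).pow 2).sub ((aC_lim α hu).pow 2)).sqrt
  rw [show (1:ℝ)^2 - (1 - 2*y)^2 = 2^2 * (y * (1 - y)) by ring, Real.sqrt_mul (by norm_num),
    Real.sqrt_sq (by norm_num), Real.sqrt_mul h0.le] at this
  exact this

lemma wN_lim (α : ℝ) {y : ℝ} {u : ℕ → ℝ} (hu : Tendsto u atTop (𝓝 y)) (h0 : 0 < y) :
    Tendsto (fun N => wN α N (u N)) atTop (𝓝 (gJ y)) := by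
  have := ((aB_lim α).mul (aW_lim α hu h0)).div hu h0.ne'
  rw [one_mul] at this
  exact this

lemma wN_cont (α : ℝ) (N : ℕ) {δ : ℝ} (hδ : 0 < δ) : ContinuousOn (wN α N) (Set.Icc δ (1 - δ)) := by
  unfold wN aW aC
  refine ContinuousOn.div (by fun_prop) continuousOn_id ?_
  intro y hy; exact (lt_of_lt_of_le hδ hy.1).ne'

lemma wN_bound (α : ℝ) {δ : ℝ} (hδ : 0 < δ) (hδ2 : δ < 1/2) :
    ∀ᶠ N : ℕ in atTop, ∀ y ∈ Set.Icc δ (1 - δ), 0 ≤ wN α N y ∧ wN α N y ≤ 4 / δ := by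
  filter_upwards [coeff_bounds α δ hδ hδ2] with N ⟨h1, h2, h3, h4, h5⟩ y hy
  obtain ⟨a1, a2, a3⟩ := h5 y hy
  obtain ⟨b1, b2, b3⟩ := aW_bounds hδ hδ2 h3 h4 a2
  have hy0 : 0 < y := lt_of_lt_of_le hδ hy.1
  have hw : 0 ≤ aW α N y := by linarith
  refine ⟨by unfold wN; positivity, ?_⟩
  unfold wN
  have : aB α N * aW α N y ≤ 4 := by nlinarith
  gcongr
  exact hy.1

lemma wN_int_lim (α : ℝ) {δ : ℝ} (hδ : 0 < δ) (hδ2 : δ < 1/2) (q : ℝ → ℝ) (hq : Continuous q)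
    (hqb : ∀ y ∈ Set.Icc δ (1 - δ), |q y| ≤ 1) :
    Tendsto (fun N => ∫ y in δ..(1-δ), q y * wN α N y) atTop (𝓝 (∫ y in δ..(1-δ), q y * gJ y)) := by
  have hle : δ ≤ 1 - δ := by linarith
  refine intervalIntegral.tendsto_integral_filter_of_dominated_convergence (fun _ => 4/δ) ?_ ?_ ?_ ?_
  · refine Eventually.of_forall fun N => ?_
    rw [Set.uIoc_of_le hle]
    exact ((hq.continuousOn.mul (wN_cont α N hδ)).mono Set.Ioc_subset_Icc_self).aestronglyMeasurable
      measurableSet_Ioc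
  · filter_upwards [wN_bound α hδ hδ2] with N hN
    refine Eventually.of_forall fun y hy => ?_
    rw [Set.uIoc_of_le hle] at hy
    have hy' := Set.Ioc_subset_Icc_self hy
    obtain ⟨a, b⟩ := hN y hy'
    rw [Real.norm_eq_abs, abs_mul, abs_of_nonneg a]
    calc _ ≤ 1 * wN α N y := by gcongr; exact hqb y hy'
      _ ≤ _ := by linarith
  · exact intervalIntegrable_const
  · refine Eventually.of_forall fun y hy => ?_
    rw [Set.uIoc_of_le hle] at hy
    exact (wN_lim α tendsto_const_nhds (lt_trans hδ hy.1)).const_mul _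

/-- adiabatic invariant of the Laguerre system -/
def hN (α : ℝ) (N : ℕ) (y : ℝ) : ℝ := N * aH α N (sP α N) (sX α N) y

lemma rho_eq {α : ℝ} (hα : -1 < α) {δ : ℝ} (hδ : 0 < δ) (hδ2 : δ < 1/2) :
    ∀ᶠ N : ℕ in atTop, ∀ y ∈ Set.Icc δ (1 - δ), rho α N y = wN α N y * hN α N y ∧ 0 ≤ hN α N y := by
  filter_upwards [coeff_bounds α δ hδ hδ2, eventually_ge_atTop 1] with N ⟨h1, h2, h3, h4, h5⟩ hN1 y hy
  obtain ⟨a1, a2, a3⟩ := h5 y hy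
  obtain ⟨b1, b2, b3⟩ := aW_bounds hδ hδ2 h3 h4 a2
  have hy0 : 0 < y := lt_of_lt_of_le hδ hy.1
  have hw : 0 < aW α N y := by linarith
  have := lker_diag hα hN1 hy0
  constructor
  · rw [wN, hN, aH, rho]
    have e : lker α N (4 * N * y) (4 * N * y) = N * aB α N * aE α N (sP α N) (sX α N) y / (4 * y) := by
      rw [← this]; field_simp
    rw [e]
    field_simp
  · rw [hN, aH, aE]
    have := form_lower (aB α N) (aC α N y) (sP α N y) (sX α N y)
    have h7 : 0 ≤ (aB α N - |aC α N y|) * (sP α N y ^ 2 + sX α N y ^ 2) :=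
      mul_nonneg (by linarith) (by positivity)
    have : 0 ≤ aB α N * sP α N y ^ 2 + 2 * aC α N y * sP α N y * sX α N y + aB α N * sX α N y ^ 2 := by linarith
    positivity

lemma hN_adiab {α : ℝ} (hα : -1 < α) {δ : ℝ} (hδ : 0 < δ) (hδ2 : δ < 1/2) :
    ∃ ε : ℕ → ℝ, Tendsto ε atTop (𝓝 1) ∧ ∀ᶠ N : ℕ in atTop,
      ∀ y₁ ∈ Set.Icc δ (1 - δ), ∀ y₂ ∈ Set.Icc δ (1 - δ), hN α N y₁ ≤ ε N * hN α N y₂ := by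
  obtain ⟨ε, h1, h2⟩ := adiabatic α δ hδ hδ2
  refine ⟨ε, h1, ?_⟩
  filter_upwards [h2, eventually_ge_atTop 1] with N h3 hN1 y₁ hy₁ y₂ hy₂
  have := h3 (sP α N) (sX α N) (fun y hy => sP_deriv hα hN1 hy) (fun y hy => sX_deriv hα hN1 hy) y₁ hy₁ y₂ hy₂
  rw [hN, hN, mul_left_comm]
  exact mul_le_mul_of_nonneg_left this (Nat.cast_nonneg N)

lemma rho_upper {α : ℝ} (hα : -1 < α) {δ : ℝ} (hδ : 0 < δ) (hδ2 : δ < 1/2) :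
    ∃ ε : ℕ → ℝ, Tendsto ε atTop (𝓝 1) ∧ ∀ᶠ N : ℕ in atTop,
      hN α N (1/2) * (∫ y in δ..(1-δ), wN α N y) ≤ ε N := by
  obtain ⟨ε, h1, h2⟩ := hN_adiab hα hδ hδ2
  refine ⟨ε, h1, ?_⟩
  have hle : δ ≤ 1 - δ := by linarith
  filter_upwards [h2, rho_eq hα hδ hδ2, wN_bound α hδ hδ2, eventually_ge_atTop 1,
    h1.eventually (lt_mem_nhds one_pos)] with N k1 k2 k3 k4 k5
  obtain ⟨r1, r2⟩ := rho_mass hα k4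
  rw [← intervalIntegral.integral_const_mul, intervalIntegral.integral_of_le hle]
  calc ∫ y in Set.Ioc δ (1-δ), hN α N (1/2) * wN α N y
      ≤ ∫ y in Set.Ioc δ (1-δ), ε N * rho α N y := by
        refine setIntegral_mono_on ?_ ?_ measurableSet_Ioc ?_
        · exact (((wN_cont α N hδ).const_mul _).integrableOn_Icc).mono_set Set.Ioc_subset_Icc_self
        · refine (r1.mono_set ?_).const_mul _
          intro y hy; exact lt_trans hδ hy.1
        · intro y hy
          have hy' := Set.Ioc_subset_Icc_self hy
          rw [(k2 y hy').1]
          have := k1 (1/2) ⟨by linarith, by linarith⟩ y hy'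
          nlinarith [(k3 y hy').1]
    _ = ε N * ∫ y in Set.Ioc δ (1-δ), rho α N y := by rw [integral_const_mul]
    _ ≤ ε N * ∫ y in Set.Ioi 0, rho α N y := by
        refine mul_le_mul_of_nonneg_left ?_ k5.le
        refine setIntegral_mono_set r1 ?_ ?_
        · exact Eventually.of_forall fun y => rho_nonneg α N y
        · refine HasSubset.Subset.eventuallyLE ?_
          intro y hy; exact lt_trans hδ hy.1
    _ = ε N := by rw [r2, mul_one]

lemma rho_lower {α : ℝ} (hα : -1 < α) {δ : ℝ} (hδ : 0 < δ) (hδ2 : δ < 1/2) :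
    ∃ ε : ℕ → ℝ, Tendsto ε atTop (𝓝 1) ∧ ∀ᶠ N : ℕ in atTop,
      (∫ y in Set.Ioi (0:ℝ), y * (1 - y) * rho α N y) ≤
      ε N * hN α N (1/2) * (∫ y in δ..(1-δ), y * (1 - y) * wN α N y) + δ := by
  obtain ⟨ε, h1, h2⟩ := hN_adiab hα hδ hδ2
  refine ⟨ε, h1, ?_⟩
  have hle : δ ≤ 1 - δ := by linarith
  filter_upwards [h2, rho_eq hα hδ hδ2, wN_bound α hδ hδ2, eventually_ge_atTop 1] with N k1 k2 k3 k4
  obtain ⟨r1, r2⟩ := rho_mass hα k4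
  obtain ⟨s1, -⟩ := rho_second hα k4
  have hsub : Set.Ioc δ (1-δ) ⊆ Set.Ioi 0 := fun y hy => lt_trans hδ hy.1
  rw [← intervalIntegral.integral_const_mul, intervalIntegral.integral_of_le hle]
  have i1 : IntegrableOn (fun y => ε N * hN α N (1/2) * (y * (1 - y) * wN α N y)) (Set.Ioc δ (1-δ)) := by
    refine (ContinuousOn.integrableOn_Icc ?_).mono_set Set.Ioc_subset_Icc_self
    exact (ContinuousOn.mul (by fun_prop) (wN_cont α N hδ)).const_mul _
  have i1' : Integrable (Set.indicator (Set.Ioc δ (1-δ)) (fun y => ε N * hN α N (1/2) * (y * (1 - y) * wN α N y))) (volume.restrict (Set.Ioi 0)) :=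
    (i1.integrable_indicator measurableSet_Ioc).integrableOn
  calc _ ≤ ∫ y in Set.Ioi (0:ℝ), ((Set.indicator (Set.Ioc δ (1-δ)) (fun y => ε N * hN α N (1/2) * (y * (1 - y) * wN α N y)) y) + δ * rho α N y) := by
        refine setIntegral_mono_on s1 (i1'.add (r1.const_mul δ)) measurableSet_Ioi ?_
        intro y hy
        have hy : 0 < y := hy
        have r := rho_nonneg α N y
        by_cases hm : y ∈ Set.Ioc δ (1-δ)
        · rw [Set.indicator_of_mem hm]
          have hy' := Set.Ioc_subset_Icc_self hm
          have := k1 y hy' (1/2) ⟨by linarith, by linarith⟩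
          have e := (k2 y hy').1
          have q : 0 ≤ y * (1 - y) := mul_nonneg hy.le (by linarith [hy'.2])
          have : y * (1 - y) * rho α N y ≤ ε N * hN α N (1/2) * (y * (1 - y) * wN α N y) := by
            rw [e]
            have := mul_le_mul_of_nonneg_left this (mul_nonneg q (k3 y hy').1)
            nlinarith
          have := mul_nonneg hδ.le r
          linarith
        · rw [Set.indicator_of_notMem hm, zero_add]
          refine mul_le_mul_of_nonneg_right ?_ r
          by_contra hc
          push Not at hc
          apply hm
          constructor <;> nlinarith
    _ = _ := by
        rw [integral_add i1' (r1.const_mul δ), integral_const_mul, r2, mul_one]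
        congr 1
        rw [setIntegral_indicator measurableSet_Ioc, Set.inter_eq_self_of_subset_right hsub]

lemma sum_aux (N : ℕ) (α : ℝ) (M : ℝ) : ∑ k ∈ range N, (4 * M * (2 * (k : ℝ) + α + 1) - ((2 * (k : ℝ) + α + 1) ^ 2 +
      ((k : ℝ) * ((k : ℝ) + α)) + ((k : ℝ) + 1) * ((k : ℝ) + 1 + α))) =
      4 * M * N * (N + α) - N * (2 * N ^2 + 3 * N * α + α^2) := by
  induction N with
  | zero => simp
  | succ n ih => rw [sum_range_succ, ih]; push_cast; ring

lemma second_lim {α : ℝ} (hα : -1 < α) :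
    Tendsto (fun N : ℕ => ∫ y in Set.Ioi (0:ℝ), y * (1 - y) * rho α N y) atTop (𝓝 (1/8)) := by
  have h0 : Tendsto (fun N : ℕ => ((N:ℝ))⁻¹) atTop (𝓝 0) := tendsto_inv_atTop_nhds_zero_nat
  have : Tendsto (fun N : ℕ => (1/16) * (4 * (1 + α * ((N:ℝ))⁻¹) - (2 + 3 * α * ((N:ℝ))⁻¹ + α^2 * ((N:ℝ)⁻¹ * (N:ℝ)⁻¹)))) atTop
      (𝓝 ((1/16) * (4 * (1 + α * 0) - (2 + 3 * α * 0 + α^2 * (0 * 0))))) := by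
    exact ((((h0.const_mul α).const_add 1).const_mul 4).sub
      (((h0.const_mul (3*α)).const_add 2).add ((h0.mul h0).const_mul _))).const_mul _
  have e : (1/16:ℝ) * (4 * (1 + α * 0) - (2 + 3 * α * 0 + α^2 * (0 * 0))) = 1/8 := by ring
  rw [e] at this
  refine this.congr' ?_
  filter_upwards [eventually_ge_atTop 1] with N hN1
  have hN' : (0:ℝ) < N := by exact_mod_cast hN1
  rw [(rho_second hα hN1).2, sum_aux]
  field_simp

theorem hN_half_lim {α : ℝ} (hα : -1 < α) : Tendsto (fun N => hN α N (1/2)) atTop (𝓝 (1/π)) := by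
  have hpos : ∀ᶠ δ : ℝ in 𝓝[>] 0, 0 < δ ∧ δ < 1/2 := by
    filter_upwards [self_mem_nhdsWithin, mem_nhdsWithin_of_mem_nhds (gt_mem_nhds (show (0:ℝ) < 1/2 by norm_num))] with δ h1 h2
    exact ⟨h1, h2⟩
  have hJ := FJL_lim.1.mono_left (nhdsWithin_le_nhds (s := Set.Ioi 0))
  have hL := FJL_lim.2.mono_left (nhdsWithin_le_nhds (s := Set.Ioi 0))
  have pp := Real.pi_pos
  rw [tendsto_order]
  constructor
  · intro c hc
    have t : Tendsto (fun δ : ℝ => (1/8 - δ) / (FL (1-δ) - FL δ)) (𝓝[>] 0) (𝓝 ((1/8 - 0) / (π/8))) := by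
      refine Tendsto.div ?_ hL (by positivity)
      exact (tendsto_id.mono_left nhdsWithin_le_nhds).const_sub _
    have e : (1/8 - 0) / (π/8) = 1/π := by field_simp; norm_num
    rw [e] at t
    obtain ⟨δ, ⟨k1, k2⟩, k3, k4⟩ := (hpos.and ((t.eventually (lt_mem_nhds hc)).and
      (hL.eventually (lt_mem_nhds (show 0 < π/8 by positivity))))).exists
    obtain ⟨ε, e1, e2⟩ := rho_lower hα k1 k2
    have hI := wN_int_lim α k1 k2 (fun y => y * (1 - y)) (by fun_prop) (by
      intro y hy; rw [abs_le]; constructor <;> nlinarith [hy.1, hy.2])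
    rw [(J_int k1 k2).2] at hI
    have t2 := ((second_lim hα).sub_const δ).div (e1.mul hI) (by simpa using k4.ne')
    rw [one_mul] at t2
    filter_upwards [e2, t2.eventually (lt_mem_nhds k3), (e1.mul hI).eventually (lt_mem_nhds (show 0 < 1 * (FL (1-δ) - FL δ) by linarith))] with N a1 a2 a3
    refine lt_of_lt_of_le a2 ?_
    simp only [Pi.div_apply]
    rw [div_le_iff₀ a3]
    linarith
  · intro c hc
    have t : Tendsto (fun δ : ℝ => 1 / (FJ (1-δ) - FJ δ)) (𝓝[>] 0) (𝓝 (1 / π)) := 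
      Tendsto.div tendsto_const_nhds hJ pp.ne'
    obtain ⟨δ, ⟨k1, k2⟩, k3, k4⟩ := (hpos.and ((t.eventually (gt_mem_nhds hc)).and
      (hJ.eventually (lt_mem_nhds pp)))).exists
    obtain ⟨ε, e1, e2⟩ := rho_upper hα k1 k2
    have hI := wN_int_lim α k1 k2 (fun y => 1) (by fun_prop) (by simp)
    simp only [one_mul] at hI
    rw [(J_int k1 k2).1] at hI
    have t2 := e1.div hI k4.ne'
    filter_upwards [e2, t2.eventually (gt_mem_nhds k3), hI.eventually (lt_mem_nhds k4)] with N a1 a2 a3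
    refine lt_of_le_of_lt ?_ a2
    simp only [Pi.div_apply]
    rw [le_div_iff₀ a3]
    exact a1

theorem hN_lim {α : ℝ} (hα : -1 < α) {y : ℝ} (h0 : 0 < y) (h1 : y < 1) {u : ℕ → ℝ}
    (hu : Tendsto u atTop (𝓝 y)) : Tendsto (fun N => hN α N (u N)) atTop (𝓝 (1/π)) := by
  obtain ⟨δ, d1, d2, d3, d4⟩ : ∃ δ : ℝ, 0 < δ ∧ δ < 1/2 ∧ δ < y ∧ y < 1 - δ := by
    refine ⟨min y (1 - y) / 3, ?_, ?_, ?_, ?_⟩ <;> rcases min_cases y (1 - y) with ⟨a, b⟩ | ⟨a, b⟩ <;> rw [a] <;> linarith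
  obtain ⟨ε, e1, e2⟩ := hN_adiab hα d1 d2
  have hh : (1/2:ℝ) ∈ Set.Icc δ (1 - δ) := ⟨by linarith, by linarith⟩
  have t := hN_half_lim hα
  have t1 := t.div e1 one_ne_zero
  have t2 := e1.mul t
  rw [div_one] at t1
  rw [one_mul] at t2
  refine tendsto_of_tendsto_of_tendsto_of_le_of_le' t1 t2 ?_ ?_
  · filter_upwards [e2, hu.eventually (lt_mem_nhds d3), hu.eventually (gt_mem_nhds d4), e1.eventually (lt_mem_nhds one_pos)] with N k1 k2 k3 k4
    simp only [Pi.div_apply]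
    rw [div_le_iff₀ k4, mul_comm]
    exact k1 _ hh _ ⟨k2.le, k3.le⟩
  · filter_upwards [e2, hu.eventually (lt_mem_nhds d3), hu.eventually (gt_mem_nhds d4)] with N k1 k2 k3
    exact k1 _ ⟨k2.le, k3.le⟩ _ hh

lemma bulk_bounds {α : ℝ} (hα : -1 < α) {δ : ℝ} (hδ : 0 < δ) (hδ2 : δ < 1/2) :
    ∃ C : ℝ, 0 < C ∧ ∀ᶠ N : ℕ in atTop, ∀ y ∈ Set.Icc δ (1 - δ), rho α N y ≤ C ∧
      N * (sP α N y ^ 2 + sX α N y ^ 2) ≤ C := by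
  obtain ⟨ε, e1, e2⟩ := hN_adiab hα hδ hδ2
  have t2 := e1.mul (hN_half_lim hα)
  rw [one_mul] at t2
  have pp := Real.pi_gt_three
  have p1 : 1/π < 1 := by rw [div_lt_one (by linarith)]; linarith
  refine ⟨4/δ + 8/δ, by positivity, ?_⟩
  filter_upwards [e2, t2.eventually (gt_mem_nhds p1), rho_eq hα hδ hδ2, wN_bound α hδ hδ2, coeff_bounds α δ hδ hδ2] with N k1 k2 k3 k4 ⟨h1, h2, h3, h4, h5⟩ y hy
  obtain ⟨a1, a2, a3⟩ := h5 y hy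
  obtain ⟨b1, b2, b3⟩ := aW_bounds hδ hδ2 h3 h4 a2
  have := k1 y hy (1/2) ⟨by linarith, by linarith⟩
  have hh1 : hN α N y ≤ 1 := by linarith
  obtain ⟨r1, r2⟩ := k3 y hy
  obtain ⟨w1, w2⟩ := k4 y hy
  have p8 : 0 < 8/δ := by positivity
  have p4 : 0 < 4/δ := by positivity
  constructor
  · rw [r1]; nlinarith
  · have f := form_lower (aB α N) (aC α N y) (sP α N y) (sX α N y)
    have e : N * aE α N (sP α N) (sX α N) y = hN α N y * aW α N y := by
      have hw : aW α N y ≠ 0 := by linarith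
      rw [hN, aH]; field_simp
    have e' : N * aE α N (sP α N) (sX α N) y ≤ 2 := by rw [e]; nlinarith
    rw [aE] at e'
    have q : 0 ≤ (N:ℝ) * (sP α N y ^ 2 + sX α N y ^ 2) := by positivity
    have : δ/4 * (N * (sP α N y ^ 2 + sX α N y ^ 2)) ≤ 2 := by
      have := mul_le_mul_of_nonneg_left f h1.le
      nlinarith
    have : N * (sP α N y ^ 2 + sX α N y ^ 2) ≤ 8/δ := by
      rw [le_div_iff₀ hδ]; linarith
    linarith

end RMT

namespace RMT

lemma rot_aux (β γ η B b σ τ : ℝ) (hβγ : β^2 - γ^2 = π^2) (p q a : ℝ → ℝ) (hη : 0 ≤ η) (hB : 0 ≤ B)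
    (hp : ∀ s, HasDerivAt p (a s * p s + b * q s) s)
    (hq : ∀ s, HasDerivAt q (-(a s * q s + b * p s)) s)
    (ha : ∀ s ∈ Set.uIcc τ σ, |a s - γ| ≤ η) (hb : |b - β| ≤ η)
    (hpB : ∀ s ∈ Set.uIcc τ σ, |p s| ≤ B) (hqB : ∀ s ∈ Set.uIcc τ σ, |q s| ≤ B) :
    |(p σ * q τ - q σ * p τ) - (β * p τ ^2 + 2 * γ * p τ * q τ + β * q τ ^2) * (Real.sin (π * (σ - τ)) / π)| ≤
      (4 * η * B^2 * (1 + |γ| + |β|)) * |σ - τ| := by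
  have pp := Real.pi_gt_three
  set D : ℝ → ℝ := fun s => p s * q τ - q s * p τ with hD
  set D2 : ℝ → ℝ := fun s => (γ * p s + β * q s) * q τ + (γ * q s + β * p s) * p τ with hD2
  set S : ℝ → ℝ := fun s => D s * Real.cos (π * (σ - s)) + D2 s * (Real.sin (π * (σ - s)) / π) with hS
  set e1 : ℝ → ℝ := fun s => ((a s - γ) * p s + (b - β) * q s) * q τ + ((a s - γ) * q s + (b - β) * p s) * p τ with he1
  set e2 : ℝ → ℝ := fun s => (γ * ((a s - γ) * p s + (b - β) * q s) - β * ((a s - γ) * q s + (b - β) * p s)) * q τ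
    + (β * ((a s - γ) * p s + (b - β) * q s) - γ * ((a s - γ) * q s + (b - β) * p s)) * p τ with he2
  have hdS : ∀ s, HasDerivAt S (e1 s * Real.cos (π * (σ - s)) + e2 s * (Real.sin (π * (σ - s)) / π)) s := by
    intro s
    have hl : HasDerivAt (fun s : ℝ => π * (σ - s)) (-π) s := by
      simpa using ((hasDerivAt_id s).const_sub σ).const_mul π
    have h1 : HasDerivAt D _ s := ((hp s).mul_const (q τ)).sub ((hq s).mul_const (p τ))
    have h2 : HasDerivAt D2 _ s := ((((hp s).const_mul γ).add ((hq s).const_mul β)).mul_const (q τ)).add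
      ((((hq s).const_mul γ).add ((hp s).const_mul β)).mul_const (p τ))
    have h3 := (h1.mul hl.cos).add (h2.mul (hl.sin.div_const π))
    refine HasDerivAt.congr_deriv (f := S) h3 ?_
    have hβ2 : β^2 = π^2 + γ^2 := by linarith
    simp only [hD, hD2, he1, he2]
    have : π ≠ 0 := by positivity
    field_simp
    ring_nf
    rw [hβ2]
    ring
  have hpτ := hpB τ Set.left_mem_uIcc
  have hqτ := hqB τ Set.left_mem_uIcc
  have two : ∀ A1 A2 B1 B2 : ℝ, |A1| ≤ η → |A2| ≤ η → |B1| ≤ B → |B2| ≤ B → |A1 * B1 + A2 * B2| ≤ 2 * η * B := by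
    intro A1 A2 B1 B2 k1 k2 k3 k4
    calc |A1 * B1 + A2 * B2| ≤ |A1 * B1| + |A2 * B2| := abs_add_le _ _
      _ = |A1| * |B1| + |A2| * |B2| := by rw [abs_mul, abs_mul]
      _ ≤ η * B + η * B := by gcongr
      _ = _ := by ring
  have hbound : ∀ s ∈ Set.uIcc τ σ, ‖e1 s * Real.cos (π * (σ - s)) + e2 s * (Real.sin (π * (σ - s)) / π)‖ ≤
      4 * η * B^2 * (1 + |γ| + |β|) := by
    intro s hs
    have t1 := two _ _ _ _ (ha s hs) hb (hpB s hs) (hqB s hs)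
    have t2 := two _ _ _ _ (ha s hs) hb (hqB s hs) (hpB s hs)
    set U := (a s - γ) * p s + (b - β) * q s
    set V := (a s - γ) * q s + (b - β) * p s
    have l1 : |e1 s| ≤ 4 * η * B^2 := by
      calc |e1 s| ≤ |U * q τ| + |V * p τ| := abs_add_le _ _
        _ = |U| * |q τ| + |V| * |p τ| := by rw [abs_mul, abs_mul]
        _ ≤ (2 * η * B) * B + (2 * η * B) * B := by gcongr
        _ = _ := by ring
    have lin : ∀ c d : ℝ, |c * U - d * V| ≤ (|c| + |d|) * (2 * η * B) := by
      intro c d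
      calc |c * U - d * V| ≤ |c * U| + |d * V| := abs_sub _ _
        _ = |c| * |U| + |d| * |V| := by rw [abs_mul, abs_mul]
        _ ≤ |c| * (2 * η * B) + |d| * (2 * η * B) := by gcongr
        _ = _ := by ring
    have l2 : |e2 s| ≤ 4 * η * B^2 * (|γ| + |β|) := by
      calc |e2 s| ≤ |(γ * U - β * V) * q τ| + |(β * U - γ * V) * p τ| := abs_add_le _ _
        _ = |γ * U - β * V| * |q τ| + |β * U - γ * V| * |p τ| := by rw [abs_mul, abs_mul]
        _ ≤ ((|γ| + |β|) * (2 * η * B)) * B + ((|β| + |γ|) * (2 * η * B)) * B := by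
          gcongr
          · exact lin _ _
          · exact lin _ _
        _ = _ := by ring
    have l3 : |Real.sin (π * (σ - s)) / π| ≤ 1 := by
      rw [abs_div, div_le_one (by positivity)]
      calc _ ≤ 1 := Real.abs_sin_le_one _
        _ ≤ |π| := by rw [abs_of_pos (by positivity)]; linarith
    calc _ ≤ |e1 s * Real.cos (π * (σ - s))| + |e2 s * (Real.sin (π * (σ - s)) / π)| := abs_add_le _ _
      _ = |e1 s| * |Real.cos (π * (σ - s))| + |e2 s| * |Real.sin (π * (σ - s)) / π| := by rw [abs_mul, abs_mul]
      _ ≤ 4 * η * B^2 * 1 + 4 * η * B^2 * (|γ| + |β|) * 1 := by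
        gcongr
        exact Real.abs_cos_le_one _
      _ = _ := by ring
  have := Convex.norm_image_sub_le_of_norm_hasDerivWithin_le
    (fun s _ => (hdS s).hasDerivWithinAt) hbound (convex_uIcc τ σ) Set.left_mem_uIcc Set.right_mem_uIcc
  have eS1 : S σ = p σ * q τ - q σ * p τ := by simp [hS, hD]
  have eS2 : S τ = (β * p τ ^2 + 2 * γ * p τ * q τ + β * q τ ^2) * (Real.sin (π * (σ - τ)) / π) := by
    simp only [hS, hD, hD2]; ring
  rw [eS1, eS2, Real.norm_eq_abs, Real.norm_eq_abs] at this
  exact this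

lemma u_bound {x m s R : ℝ} (h0 : 0 < x) (h1 : x < 1) (hm : 0 < m) (hs : |s| ≤ R) :
    |x * Real.exp (s / m) - x| ≤ Real.exp (R / m) - 1 := by
  have hs' := abs_le.1 hs
  have e1 : Real.exp (s/m) ≤ Real.exp (R/m) := by
    apply Real.exp_le_exp.2; gcongr; exact hs'.2
  have e2 : Real.exp (-(R/m)) ≤ Real.exp (s/m) := by
    apply Real.exp_le_exp.2; rw [← neg_div]; gcongr; exact hs'.1
  have hR : 0 ≤ R := (abs_nonneg s).trans hs
  have e3 : 1 ≤ Real.exp (R/m) := Real.one_le_exp (by positivity)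
  have e4 : 1 - (Real.exp (R/m) - 1) ≤ Real.exp (-(R/m)) := by
    rw [Real.exp_neg]
    have : 0 < Real.exp (R/m) := Real.exp_pos _
    rw [← one_div, le_div_iff₀ this]
    nlinarith [sq_nonneg (Real.exp (R/m) - 1)]
  rw [show x * Real.exp (s / m) - x = x * (Real.exp (s/m) - 1) by ring, abs_le]
  constructor <;> nlinarith

/-- log-coordinate kernel -/
def kN (α x : ℝ) (N : ℕ) (σ τ : ℝ) : ℝ :=
  (x * Real.exp ((σ + τ) / (2 * (N * (psiMP x * x)))) / (N * (psiMP x * x))) * (4 * N) *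
    lker α N (4 * N * (x * Real.exp (σ / (N * (psiMP x * x))))) (4 * N * (x * Real.exp (τ / (N * (psiMP x * x)))))

lemma psi_eq {x : ℝ} (h0 : 0 < x) (h1 : x < 1) :
    0 < psiMP x ∧ psiMP x * x = (2/π) * (Real.sqrt x * Real.sqrt (1 - x)) := by
  have pp := Real.pi_pos
  have s0 : 0 < Real.sqrt x := Real.sqrt_pos.2 h0
  have s1 : 0 < Real.sqrt (1 - x) := Real.sqrt_pos.2 (by linarith)
  rw [psiMP, if_pos ⟨h0, h1.le⟩, Real.sqrt_div (by linarith)]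
  refine ⟨by positivity, ?_⟩
  have := Real.mul_self_sqrt h0.le
  generalize Real.sqrt x = S at *
  generalize Real.sqrt (1 - x) = C at *
  rw [← this]
  field_simp

lemma exp_div_lim {c : ℝ} (hc : 0 < c) (s : ℝ) :
    Tendsto (fun N : ℕ => Real.exp (s / (N * c))) atTop (𝓝 1) := by
  have h1 : Tendsto (fun N : ℕ => (s/c) / (N:ℝ)) atTop (𝓝 0) := tendsto_const_div_atTop_nhds_zero_nat _
  have := (Real.continuous_exp.tendsto 0).comp h1
  rw [Real.exp_zero] at this
  refine this.congr fun N => ?_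
  simp only [Function.comp]
  congr 1
  rw [div_div, mul_comm c]

lemma kN_diag (α : ℝ) {x : ℝ} (h0 : 0 < x) (h1 : x < 1) {N : ℕ} (hN1 : 1 ≤ N) (τ : ℝ) :
    kN α x N τ τ = (x * Real.exp (τ / (N * (psiMP x * x)))) * rho α N (x * Real.exp (τ / (N * (psiMP x * x)))) / (psiMP x * x) := by
  have hN' : (0:ℝ) < N := by exact_mod_cast hN1
  have := (psi_eq h0 h1).1
  rw [kN, rho, show (τ + τ) / (2 * (N * (psiMP x * x))) = τ / (N * (psiMP x * x)) by field_simp; ring]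
  field_simp

lemma rho_lim {α : ℝ} (hα : -1 < α) {y : ℝ} (h0 : 0 < y) (h1 : y < 1) {u : ℕ → ℝ}
    (hu : Tendsto u atTop (𝓝 y)) : Tendsto (fun N => rho α N (u N)) atTop (𝓝 (gJ y * (1/π))) := by
  obtain ⟨δ, d1, d2, d3, d4⟩ : ∃ δ : ℝ, 0 < δ ∧ δ < 1/2 ∧ δ < y ∧ y < 1 - δ := by
    refine ⟨min y (1 - y) / 3, ?_, ?_, ?_, ?_⟩ <;> rcases min_cases y (1 - y) with ⟨a, b⟩ | ⟨a, b⟩ <;> rw [a] <;> linarith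
  refine ((wN_lim α hu h0).mul (hN_lim hα h0 h1 hu)).congr' ?_
  filter_upwards [rho_eq hα d1 d2, hu.eventually (lt_mem_nhds d3), hu.eventually (gt_mem_nhds d4)] with N k1 k2 k3
  exact (k1 _ ⟨k2.le, k3.le⟩).1.symm

theorem kN_lim_diag {α : ℝ} (hα : -1 < α) {x : ℝ} (h0 : 0 < x) (h1 : x < 1) (τ : ℝ) :
    Tendsto (fun N => kN α x N τ τ) atTop (𝓝 1) := by
  obtain ⟨p1, p2⟩ := psi_eq h0 h1
  have hc : 0 < psiMP x * x := by positivity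
  have hu : Tendsto (fun N : ℕ => x * Real.exp (τ / (N * (psiMP x * x)))) atTop (𝓝 x) := by
    simpa using (exp_div_lim hc τ).const_mul x
  have := (hu.mul (rho_lim hα h0 h1 hu)).div_const (psiMP x * x)
  have e : x * (gJ x * (1/π)) / (psiMP x * x) = 1 := by
    rw [div_eq_one_iff_eq hc.ne', p2, gJ]; field_simp
  rw [e] at this
  refine this.congr' ?_
  filter_upwards [eventually_ge_atTop 1] with N hN1
  rw [kN_diag α h0 h1 hN1]

set_option maxHeartbeats 2000000 in
theorem kN_lim_off {α : ℝ} (hα : -1 < α) {x : ℝ} (h0 : 0 < x) (h1 : x < 1) {σ τ : ℝ} (hne : σ ≠ τ) :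
    Tendsto (fun N => kN α x N σ τ) atTop (𝓝 (Real.sin (π * (σ - τ)) / (π * (σ - τ)))) := by
  obtain ⟨p1, p2⟩ := psi_eq h0 h1
  have hc : 0 < psiMP x * x := by positivity
  set c := psiMP x * x with hcdef
  have pp := Real.pi_pos
  have s0 : 0 < Real.sqrt x := Real.sqrt_pos.2 h0
  have s1 : 0 < Real.sqrt (1 - x) := Real.sqrt_pos.2 (by linarith)
  set β := 1/c with hβ
  set γ := (1 - 2*x)/c with hγ
  have hβγ : β^2 - γ^2 = π^2 := by
    rw [hβ, hγ, p2]
    have e1 := Real.sq_sqrt h0.le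
    have e2 := Real.sq_sqrt (show 0 ≤ 1 - x by linarith)
    field_simp
    rw [e1, e2]; ring
  set u : ℕ → ℝ → ℝ := fun N s => x * Real.exp (s / (N * c)) with hu
  set p : ℕ → ℝ → ℝ := fun N s => sP α N (u N s) with hp
  set q : ℕ → ℝ → ℝ := fun N s => sX α N (u N s) with hq
  set R := max |σ| |τ| with hR
  set d : ℕ → ℝ := fun N => Real.exp (R / (N * c)) - 1 with hd
  have hdl : Tendsto d atTop (𝓝 0) := by
    simpa using (exp_div_lim hc R).sub_const 1
  have hul : ∀ s, Tendsto (fun N => u N s) atTop (𝓝 x) := fun s => by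
    simpa using (exp_div_lim hc s).const_mul x
  obtain ⟨δ, d1, d2, d3, d4⟩ : ∃ δ : ℝ, 0 < δ ∧ δ < 1/2 ∧ δ < x ∧ x < 1 - δ := by
    refine ⟨min x (1 - x) / 3, ?_, ?_, ?_, ?_⟩ <;> rcases min_cases x (1 - x) with ⟨a, b⟩ | ⟨a, b⟩ <;> rw [a] <;> linarith
  obtain ⟨C, C1, C2⟩ := bulk_bounds hα d1 d2
  set η : ℕ → ℝ := fun N => (2 * d N + |α/(2*N)|)/c + |aB α N / c - β| with hη
  have hηl : Tendsto η atTop (𝓝 0) := by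
    have h1 : Tendsto (fun N : ℕ => |(α/2) / (N:ℝ)|) atTop (𝓝 |0|) := (tendsto_const_div_atTop_nhds_zero_nat _).abs
    have h2 := ((((hdl.const_mul 2).add h1).div_const c).add (((aB_lim α).div_const c).sub_const β).abs)
    simp only [hβ, mul_zero, abs_zero, add_zero, zero_div, sub_self] at h2
    refine h2.congr fun N => ?_
    simp only [hη, hβ, div_div]
  have hset : ∀ s ∈ Set.uIcc τ σ, |s| ≤ R := by
    intro s hs
    have h2 : τ ∈ Set.Icc (-R) R := abs_le.1 (le_max_right _ _)
    have h3 : σ ∈ Set.Icc (-R) R := abs_le.1 (le_max_left _ _)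
    exact abs_le.2 (Set.uIcc_subset_Icc h2 h3 hs)
  -- main estimate
  have main : ∀ᶠ N : ℕ in atTop, |N * (p N σ * q N τ - q N σ * p N τ) - N * (β * p N τ ^2 + 2 * γ * p N τ * q N τ + β * q N τ ^2) * (Real.sin (π * (σ - τ)) / π)| ≤ 4 * η N * C * (1 + |γ| + |β|) * |σ - τ| := by
    filter_upwards [eventually_ge_atTop 1, C2, hdl.eventually (gt_mem_nhds (show 0 < min (x - δ) (1 - δ - x) by rw [lt_min_iff]; constructor <;> linarith))] with N hN1 k1 k2
    have hN' : (0:ℝ) < N := by exact_mod_cast hN1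
    have hm : 0 < N * c := by positivity
    have hup : ∀ s, 0 < u N s := fun s => by simp only [hu]; positivity
    have hud : ∀ s, HasDerivAt (u N) (u N s / (N * c)) s := by
      intro s
      have := (((hasDerivAt_id s).div_const (N * c)).exp).const_mul x
      refine HasDerivAt.congr_deriv (f := u N) this ?_
      simp only [hu, id]; ring
    have hmem : ∀ s ∈ Set.uIcc τ σ, u N s ∈ Set.Icc δ (1 - δ) ∧ |u N s - x| ≤ d N := by
      intro s hs
      have := u_bound h0 h1 hm (hset s hs)
      refine ⟨?_, this⟩
      have t := abs_le.1 this
      have := lt_min_iff.1 k2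
      constructor <;> linarith [t.1, t.2]
    have hpd : ∀ s, HasDerivAt (p N) (aC α N (u N s) / c * p N s + aB α N / c * q N s) s := by
      intro s
      have := (sP_deriv hα hN1 (hup s)).comp s (hud s)
      refine HasDerivAt.congr_deriv (f := p N) this ?_
      have := (hup s).ne'
      simp only [hp, hq]
      field_simp
    have hqd : ∀ s, HasDerivAt (q N) (-(aC α N (u N s) / c * q N s + aB α N / c * p N s)) s := by
      intro s
      have := (sX_deriv hα hN1 (hup s)).comp s (hud s)
      refine HasDerivAt.congr_deriv (f := q N) this ?_
      have := (hup s).ne'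
      simp only [hp, hq]
      field_simp
    have hη0 : 0 ≤ η N := by
      have : 0 ≤ d N := by
        have := (hmem τ Set.left_mem_uIcc).2
        exact (abs_nonneg _).trans this
      simp only [hη]; positivity
    have hB : ∀ s ∈ Set.uIcc τ σ, |p N s| ≤ Real.sqrt (C/N) ∧ |q N s| ≤ Real.sqrt (C/N) := by
      intro s hs
      have := (k1 _ (hmem s hs).1).2
      have a1 := sq_nonneg (p N s)
      have a2 := sq_nonneg (q N s)
      have t : p N s ^2 + q N s ^2 ≤ C/N := by rw [le_div_iff₀ hN', mul_comm]; exact this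
      constructor <;> apply Real.abs_le_sqrt <;> linarith
    have r := rot_aux β γ (η N) (Real.sqrt (C/N)) (aB α N / c) σ τ hβγ (p N) (q N) (fun s => aC α N (u N s) / c)
      hη0 (Real.sqrt_nonneg _) hpd hqd (by
        intro s hs
        have t := (hmem s hs).2
        simp only [hγ, aC, hη]
        rw [← sub_div, abs_div, abs_of_pos hc]
        have : |1 - 2 * u N s + α / (2 * N) - (1 - 2 * x)| ≤ 2 * d N + |α/(2*N)| := by
          calc _ = |(-2) * (u N s - x) + α/(2*N)| := by congr 1; ring
            _ ≤ |(-2) * (u N s - x)| + |α/(2*N)| := abs_add_le _ _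
            _ = 2 * |u N s - x| + |α/(2*N)| := by rw [abs_mul]; norm_num
            _ ≤ _ := by gcongr
        have h5 : |1 - 2 * u N s + α / (2 * N) - (1 - 2 * x)| / c ≤ (2 * d N + |α/(2*N)|) / c := by gcongr
        have := abs_nonneg (aB α N / c - β)
        linarith) (by
        simp only [hη]
        have : 0 ≤ (2 * d N + |α/(2*N)|)/c := by
          have : 0 ≤ d N := (abs_nonneg _).trans (hmem τ Set.left_mem_uIcc).2
          positivity
        linarith) (fun s hs => (hB s hs).1) (fun s hs => (hB s hs).2)
    rw [Real.sq_sqrt (by positivity)] at r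
    have := mul_le_mul_of_nonneg_left r hN'.le
    rw [← abs_of_pos hN', ← abs_mul, abs_of_pos hN'] at this
    calc _ = _ := by congr 1; ring
      _ ≤ _ := this
      _ = _ := by field_simp
  -- limit of N D2
  have lim2 : Tendsto (fun N : ℕ => N * (β * p N τ ^2 + 2 * γ * p N τ * q N τ + β * q N τ ^2)) atTop (𝓝 1) := by
    have t1 := ((hN_lim hα h0 h1 (hul τ)).mul (aW_lim α (hul τ) h0)).div_const c
    have e : 1/π * (2 * (Real.sqrt x * Real.sqrt (1 - x))) / c = 1 := by
      rw [p2]; field_simp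
    rw [e] at t1
    have hbd : Tendsto (fun N : ℕ => 4 * C * ((|aB α N/c - β|) + |aC α N (u N τ)/c - γ|)) atTop (𝓝 0) := by
      have := (((((aB_lim α).div_const c).sub_const β).abs).add ((((aC_lim α (hul τ)).div_const c).sub_const γ).abs)).const_mul (4*C)
      simpa [hβ, hγ] using this
    refine tendsto_of_tendsto_of_dist t1 (squeeze_zero' (Eventually.of_forall fun _ => dist_nonneg) ?_ hbd)
    filter_upwards [C2, coeff_bounds α δ d1 d2, (hul τ).eventually (lt_mem_nhds d3), (hul τ).eventually (gt_mem_nhds d4)] with N k1 ⟨hN', h2, h3, h4, h5⟩ k3 k4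
    have hmem : u N τ ∈ Set.Icc δ (1 - δ) := ⟨k3.le, k4.le⟩
    obtain ⟨a1, a2, a3⟩ := h5 _ hmem
    obtain ⟨b1, b2, b3⟩ := aW_bounds d1 d2 h3 h4 a2
    have hw : aW α N (u N τ) ≠ 0 := by linarith
    have kk := (k1 _ hmem).2
    have eq : hN α N (u N τ) * aW α N (u N τ) / c = N * (aB α N/c * p N τ ^2 + 2 * (aC α N (u N τ)/c) * p N τ * q N τ + aB α N/c * q N τ ^2) := by
      rw [hN, aH, aE]; simp only [hp, hq]; field_simp
    rw [eq, Real.dist_eq]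
    set P := p N τ
    set Q := q N τ
    have kk' : N * (P^2 + Q^2) ≤ C := kk
    calc _ = |(aB α N/c - β) * (N * (P^2+Q^2)) + (aC α N (u N τ)/c - γ) * (N * (2 * P * Q))| := by congr 1; ring
      _ ≤ |(aB α N/c - β) * (N * (P^2+Q^2))| + |(aC α N (u N τ)/c - γ) * (N * (2 * P * Q))| := abs_add_le _ _
      _ = |aB α N/c - β| * |(N * (P^2+Q^2))| + |aC α N (u N τ)/c - γ| * |N * (2 * P * Q)| := by rw [abs_mul (aB α N/c - β), abs_mul (aC α N (u N τ)/c - γ)]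
      _ ≤ |aB α N/c - β| * (4 * C) + |aC α N (u N τ)/c - γ| * (4 * C) := by
        gcongr
        · rw [abs_of_nonneg (by positivity)]; linarith
        · rw [abs_le]; constructor
          · nlinarith [mul_nonneg hN'.le (sq_nonneg (P + Q))]
          · nlinarith [mul_nonneg hN'.le (sq_nonneg (P - Q))]
      _ = _ := by ring
  have lim3 : Tendsto (fun N : ℕ => N * (p N σ * q N τ - q N σ * p N τ)) atTop (𝓝 (1 * (Real.sin (π * (σ - τ)) / π))) := by
    refine tendsto_of_tendsto_of_dist (lim2.mul_const _) (squeeze_zero' (Eventually.of_forall fun _ => dist_nonneg) ?_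
      (show Tendsto (fun N => 4 * η N * C * (1 + |γ| + |β|) * |σ - τ|) atTop (𝓝 0) by
        simpa using ((((hηl.const_mul 4).mul_const C).mul_const (1 + |γ| + |β|)).mul_const |σ - τ|)))
    filter_upwards [main] with N k
    rw [dist_comm, Real.dist_eq]; exact k
  -- prefactor
  have hst : σ - τ ≠ 0 := sub_ne_zero.2 hne
  have lim4 : Tendsto (fun N : ℕ => (N * c) * (u N σ - u N τ)) atTop (𝓝 (x * (σ - τ))) := by
    have hm : Tendsto (fun N : ℕ => (N * c)) atTop atTop := tendsto_natCast_atTop_atTop.atTop_mul_const hc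
    have key : ∀ s : ℝ, Tendsto (fun N : ℕ => (N * c) * (Real.exp (s / (N * c)) - 1)) atTop (𝓝 s) := by
      intro s
      have hder : HasDerivAt (fun z : ℝ => Real.exp (s * z)) s 0 := by
        have := ((hasDerivAt_id (0:ℝ)).const_mul s).exp
        simpa using this
      have hsl := hasDerivAt_iff_tendsto_slope.1 hder
      have hz : Tendsto (fun N : ℕ => ((N:ℝ) * c)⁻¹) atTop (𝓝[≠] 0) := by
        refine tendsto_nhdsWithin_iff.2 ⟨tendsto_inv_atTop_zero.comp hm, ?_⟩
        filter_upwards [eventually_ge_atTop 1] with N hN1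
        have hN' : (0:ℝ) < N := by exact_mod_cast hN1
        have : ((N:ℝ) * c)⁻¹ ≠ 0 := by positivity
        exact this
      refine (hsl.comp hz).congr fun N => ?_
      simp [slope_def_field, div_eq_mul_inv, mul_comm]
    have := ((key σ).sub (key τ)).const_mul x
    refine this.congr fun N => ?_
    simp only [hu]; ring
  have lim5 : Tendsto (fun N : ℕ => x * Real.exp ((σ + τ) / (2 * (N * c)))) atTop (𝓝 x) := by
    have := (exp_div_lim hc ((σ + τ)/2)).const_mul x
    rw [mul_one] at this
    refine this.congr fun N => ?_
    rw [div_div]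
  have fin := ((lim5.div lim4 (mul_ne_zero h0.ne' hst)).mul ((aB_lim α).mul lim3))
  have e : x / (x * (σ - τ)) * (1 * (1 * (Real.sin (π * (σ - τ)) / π))) = Real.sin (π * (σ - τ)) / (π * (σ - τ)) := by
    field_simp
  rw [e] at fin
  refine fin.congr' ?_
  filter_upwards [eventually_ge_atTop 1] with N hN1
  have hN' : (0:ℝ) < N := by exact_mod_cast hN1
  have hup : ∀ s, 0 < u N s := fun s => by simp only [hu]; positivity
  have huv : u N σ - u N τ ≠ 0 := by
    intro h
    have : Real.exp (σ / (N * c)) = Real.exp (τ / (N * c)) := mul_left_cancel₀ h0.ne' (sub_eq_zero.1 h)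
    have := Real.exp_injective this
    have hm : (N * c) ≠ 0 := by positivity
    exact hne (by field_simp at this; exact this)
  have cd := lker_CD hα hN1 (hup σ) (hup τ)
  have e2 : lker α N (4 * N * (u N σ)) (4 * N * (u N τ)) = aB α N * (p N σ * q N τ - q N σ * p N τ) / (4 * (u N σ - u N τ)) := by
    rw [← cd]; field_simp
  rw [kN]
  simp only [Pi.div_apply]
  rw [← hcdef]
  change _ = _ * lker α N (4 * N * (u N σ)) (4 * N * (u N τ))
  rw [e2]
  field_simp

theorem kN_lim {α : ℝ} (hα : -1 < α) {x : ℝ} (h0 : 0 < x) (h1 : x < 1) (σ τ : ℝ) :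
    Tendsto (fun N => kN α x N σ τ) atTop (𝓝 (Ksin σ τ)) := by
  unfold Ksin
  split_ifs with h
  · subst h; exact kN_lim_diag hα h0 h1 σ
  · exact kN_lim_off hα h0 h1 h

lemma lker_cs (α : ℝ) (N : ℕ) (y z : ℝ) : lker α N y z ^2 ≤ lker α N y y * lker α N z z := by
  have := Finset.sum_mul_sq_le_sq_mul_sq (range N) (fun k => lphi α k y) (fun k => lphi α k z)
  simp only [pow_two] at this
  simp only [pow_two]
  exact this

lemma kN_cs (α : ℝ) {x : ℝ} (N : ℕ) (σ τ : ℝ) : kN α x N σ τ ^2 ≤ kN α x N σ σ * kN α x N τ τ := by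
  have := lker_cs α N (4 * N * (x * Real.exp (σ / (N * (psiMP x * x))))) (4 * N * (x * Real.exp (τ / (N * (psiMP x * x)))))
  simp only [kN]
  set L1 := lker α N (4 * N * (x * Real.exp (σ / (N * (psiMP x * x))))) (4 * N * (x * Real.exp (τ / (N * (psiMP x * x)))))
  have e : Real.exp ((σ + τ) / (2 * (N * (psiMP x * x)))) ^2 = Real.exp ((σ + σ) / (2 * (N * (psiMP x * x)))) * Real.exp ((τ + τ) / (2 * (N * (psiMP x * x)))) := by
    rw [pow_two, ← Real.exp_add, ← Real.exp_add]; congr 1; ring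
  calc _ = (x / (N * (psiMP x * x)) * (4 * N))^2 * Real.exp ((σ + τ) / (2 * (N * (psiMP x * x)))) ^2 * L1^2 := by ring
    _ ≤ (x / (N * (psiMP x * x)) * (4 * N))^2 * Real.exp ((σ + τ) / (2 * (N * (psiMP x * x)))) ^2 * _ := mul_le_mul_of_nonneg_left this (by positivity)
    _ = _ := by rw [e]; ring

theorem kN_bound {α : ℝ} (hα : -1 < α) {x : ℝ} (h0 : 0 < x) (h1 : x < 1) :
    ∃ δ B : ℝ, 0 < δ ∧ 0 < B ∧ ∀ᶠ N : ℕ in atTop, ∀ σ τ : ℝ, |σ| ≤ δ * (N * (psiMP x * x)) →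
      |τ| ≤ δ * (N * (psiMP x * x)) → |kN α x N σ τ| ≤ B := by
  obtain ⟨p1, p2⟩ := psi_eq h0 h1
  have hc : 0 < psiMP x * x := by positivity
  obtain ⟨δ, d1, d2, d3, d4⟩ : ∃ δ : ℝ, 0 < δ ∧ δ < 1/2 ∧ δ < x ∧ x < 1 - δ := by
    refine ⟨min x (1 - x) / 3, ?_, ?_, ?_, ?_⟩ <;> rcases min_cases x (1 - x) with ⟨a, b⟩ | ⟨a, b⟩ <;> rw [a] <;> linarith
  obtain ⟨C, C1, C2⟩ := bulk_bounds hα d1 d2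
  obtain ⟨κ, k0, k1⟩ : ∃ κ : ℝ, 0 < κ ∧ Real.exp κ - 1 ≤ min (x - δ) (1 - δ - x) := by
    have hm : 0 < min (x - δ) (1 - δ - x) := by rw [lt_min_iff]; constructor <;> linarith
    refine ⟨Real.log (1 + min (x - δ) (1 - δ - x)), Real.log_pos (by linarith), ?_⟩
    rw [Real.exp_log (by linarith)]; linarith
  refine ⟨κ, C / (psiMP x * x), k0, by positivity, ?_⟩
  filter_upwards [C2, eventually_ge_atTop 1] with N k2 hN1 σ τ hσ hτ
  have hN' : (0:ℝ) < N := by exact_mod_cast hN1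
  have hm : 0 < N * (psiMP x * x) := by positivity
  have key : ∀ s, |s| ≤ κ * (N * (psiMP x * x)) → 0 ≤ kN α x N s s ∧ kN α x N s s ≤ C / (psiMP x * x) := by
    intro s hs
    rw [kN_diag α h0 h1 hN1]
    have ub := u_bound h0 h1 hm hs
    rw [mul_div_cancel_right₀ _ hm.ne'] at ub
    have t := abs_le.1 (ub.trans k1)
    have m1 := min_le_left (x - δ) (1 - δ - x)
    have m2 := min_le_right (x - δ) (1 - δ - x)
    set u := x * Real.exp (s / (N * (psiMP x * x)))
    have hr := (k2 u ⟨by linarith, by linarith⟩).1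
    have hr0 := rho_nonneg α N u
    have hu0 : 0 ≤ u := by linarith
    constructor
    · positivity
    · gcongr
      have : u ≤ 1 := by linarith
      nlinarith
  have a1 := key σ hσ
  have a2 := key τ hτ
  have := kN_cs α (x := x) N σ τ
  apply abs_le_of_sq_le_sq _ (by positivity)
  calc _ ≤ _ := this
    _ ≤ C / (psiMP x * x) * (C / (psiMP x * x)) := by
      apply mul_le_mul a1.2 a2.2 a2.1 (by positivity)
    _ = _ := by ring

end RMT

namespace RMT

/-- determinant of the Laguerre kernel -/
def detK (α : ℝ) (N : ℕ) {ι : Type} [Fintype ι] [DecidableEq ι] (x : ι → ℝ) : ℝ :=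
  Matrix.det (Matrix.of fun i j : ι => lker α N (x i) (x j))

lemma kerMat_eq (α : ℝ) (N : ℕ) {ι : Type} [Fintype ι] [DecidableEq ι] (x : ι → ℝ) :
    (Matrix.of fun i j : ι => lker α N (x i) (x j)) =
    (Matrix.of fun (i : ι) (k : Fin N) => lphi α k (x i)) * (Matrix.of fun (i : ι) (k : Fin N) => lphi α k (x i)).conjTranspose := by
  ext i j
  simp only [Matrix.mul_apply, Matrix.of_apply, Matrix.conjTranspose_apply, star_trivial, lker]
  rw [← Fin.sum_univ_eq_sum_range (fun k => lphi α k (x i) * lphi α k (x j))]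

lemma kerMat_psd (α : ℝ) (N : ℕ) {ι : Type} [Fintype ι] [DecidableEq ι] (x : ι → ℝ) :
    (Matrix.of fun i j : ι => lker α N (x i) (x j)).PosSemidef := by
  rw [kerMat_eq]
  exact Matrix.posSemidef_self_mul_conjTranspose _

lemma detK_nonneg (α : ℝ) (N : ℕ) {ι : Type} [Fintype ι] [DecidableEq ι] (x : ι → ℝ) : 0 ≤ detK α N x :=
  (kerMat_psd α N x).det_nonneg

lemma detK_equiv (α : ℝ) (N : ℕ) {ι κ : Type} [Fintype ι] [Fintype κ] [DecidableEq ι] [DecidableEq κ] (e : κ ≃ ι) (x : ι → ℝ) :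
    detK α N (x ∘ e) = detK α N x := by
  unfold detK
  rw [← Matrix.det_submatrix_equiv_self e]
  rfl

lemma bordered_det {ι : Type} [Fintype ι] [DecidableEq ι] (A : Matrix ι ι ℝ) (hA : A.PosSemidef) (b c : ι → ℝ) (d : ℝ) :
    (Matrix.fromBlocks A (Matrix.of fun i (_ : Fin 1) => b i) (Matrix.of fun (_ : Fin 1) j => c j)
      (Matrix.of fun (_ _ : Fin 1) => d)).det = d * A.det - ∑ i, ∑ j, c i * A.adjugate i j * b j := by
  set F : ℝ → ℝ := fun t => (Matrix.fromBlocks (A + t • (1 : Matrix ι ι ℝ)) (Matrix.of fun i (_ : Fin 1) => b i) (Matrix.of fun (_ : Fin 1) j => c j)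
      (Matrix.of fun (_ _ : Fin 1) => d)).det with hF
  set G : ℝ → ℝ := fun t => d * (A + t • (1 : Matrix ι ι ℝ)).det - ∑ i, ∑ j, c i * (A + t • (1 : Matrix ι ι ℝ)).adjugate i j * b j with hG
  have hAc : Continuous (fun t : ℝ => A + t • (1 : Matrix ι ι ℝ)) := by fun_prop
  have cF : Continuous F := by
    refine Continuous.matrix_det ?_
    exact Continuous.matrix_fromBlocks hAc continuous_const continuous_const continuous_const
  have cG : Continuous G := by
    refine (continuous_const.mul hAc.matrix_det).sub ?_
    refine continuous_finsetSum _ fun i _ => continuous_finsetSum _ fun j _ => ?_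
    exact (continuous_const.mul (hAc.matrix_adjugate.matrix_elem i j)).mul continuous_const
  have key : ∀ t, 0 < t → F t = G t := by
    intro t ht
    have hpd : (A + t • (1 : Matrix ι ι ℝ)).PosDef := Matrix.PosDef.posSemidef_add hA (Matrix.PosDef.one.smul ht)
    have hu : IsUnit (A + t • (1 : Matrix ι ι ℝ)) := hpd.isUnit
    simp only [hF, hG]
    set A' := A + t • (1 : Matrix ι ι ℝ)
    have hdet : A'.det ≠ 0 := hpd.det_pos.ne'
    let := hu.invertible
    have h1d : ∀ M : Matrix (Fin 1) (Fin 1) ℝ, M.det = M 0 0 := fun M => Matrix.det_fin_one M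
    rw [Matrix.det_fromBlocks₁₁, h1d, Matrix.invOf_eq_nonsing_inv, Matrix.inv_def]
    simp only [Matrix.sub_apply, Matrix.mul_apply, Matrix.of_apply, Matrix.smul_apply, smul_eq_mul, Ring.inverse_eq_inv']
    rw [mul_sub, mul_comm]
    congr 1
    rw [mul_sum, sum_comm]
    refine sum_congr rfl fun j _ => ?_
    rw [sum_mul, mul_sum]
    refine sum_congr rfl fun i _ => ?_
    field_simp
  have h1 : Tendsto F (𝓝[>] 0) (𝓝 (F 0)) := (cF.tendsto 0).mono_left nhdsWithin_le_nhds
  have h2 : Tendsto G (𝓝[>] 0) (𝓝 (G 0)) := (cG.tendsto 0).mono_left nhdsWithin_le_nhds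
  have h3 : F 0 = G 0 := by
    refine tendsto_nhds_unique_of_eventuallyEq h1 h2 ?_
    filter_upwards [self_mem_nhdsWithin] with t ht using key t ht
  simpa [hF, hG] using h3

lemma detK_snoc (α : ℝ) (N k : ℕ) (t : Fin k → ℝ) (s : ℝ) :
    detK α N (Fin.snoc (α := fun _ => ℝ) t s) = lker α N s s * detK α N t -
      ∑ i, ∑ j, lker α N s (t i) * (Matrix.of fun i j => lker α N (t i) (t j)).adjugate i j * lker α N (t j) s := by
  have := bordered_det _ (kerMat_psd α N t) (fun i => lker α N (t i) s) (fun j => lker α N s (t j)) (lker α N s s)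
  refine Eq.trans ?_ this
  rw [← detK_equiv α N (finSumFinEquiv (m := k) (n := 1)), detK]
  congr 1
  have hl : ∀ i : Fin k, (Fin.snoc (α := fun _ => ℝ) t s) (finSumFinEquiv (m := k) (n := 1) (Sum.inl i)) = t i := by
    intro i
    have : finSumFinEquiv (m := k) (n := 1) (Sum.inl i) = i.castSucc := rfl
    rw [this, Fin.snoc_castSucc]
  have hr : ∀ i : Fin 1, (Fin.snoc (α := fun _ => ℝ) t s) (finSumFinEquiv (m := k) (n := 1) (Sum.inr i)) = s := by
    intro i
    have : finSumFinEquiv (m := k) (n := 1) (Sum.inr i) = Fin.last k := by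
      ext; simp
    rw [this, Fin.snoc_last]
  ext i j
  rcases i with i | i <;> rcases j with j | j <;> simp only [Matrix.of_apply, Function.comp, Matrix.fromBlocks_apply₁₁,
    Matrix.fromBlocks_apply₁₂, Matrix.fromBlocks_apply₂₁, Matrix.fromBlocks_apply₂₂, hl, hr]

lemma lker_symm (α : ℝ) (N : ℕ) (x y : ℝ) : lker α N x y = lker α N y x := by
  unfold lker; exact sum_congr rfl fun k _ => mul_comm _ _

lemma lker_repro {α : ℝ} (hα : -1 < α) (N : ℕ) (x y : ℝ) :
    Integrable (fun s => lker α N s x * lker α N y s) ∧ ∫ s, lker α N s x * lker α N y s = lker α N x y := by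
  have e : ∀ s, lker α N s x * lker α N y s = ∑ j ∈ range N, ∑ k ∈ range N, (lphi α j x * lphi α k y) * (lphi α j s * lphi α k s) := by
    intro s
    simp only [lker, sum_mul_sum]
    refine sum_congr rfl fun j _ => sum_congr rfl fun k _ => ?_
    ring
  simp_rw [e]
  have hi : ∀ j k, Integrable (fun s => (lphi α j x * lphi α k y) * (lphi α j s * lphi α k s)) :=
    fun j k => (lphi_orth hα j k).1.const_mul _
  refine ⟨integrable_finsetSum _ fun j _ => integrable_finsetSum _ fun k _ => hi j k, ?_⟩
  rw [integral_finsetSum _ fun j _ => integrable_finsetSum _ fun k _ => hi j k]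
  simp_rw [integral_finsetSum _ fun k _ => hi _ k, integral_const_mul, (lphi_orth hα _ _).2]
  simp only [lker]
  refine sum_congr rfl fun j hj => ?_
  simp only [mul_ite, mul_one, mul_zero]
  rw [Finset.sum_ite_eq, if_pos hj]

lemma lker_trace {α : ℝ} (hα : -1 < α) (N : ℕ) :
    Integrable (fun s => lker α N s s) ∧ ∫ s, lker α N s s = N := by
  simp only [lker]
  refine ⟨integrable_finsetSum _ fun j _ => (lphi_orth hα j j).1, ?_⟩
  rw [integral_finsetSum _ fun j _ => (lphi_orth hα j j).1]
  simp_rw [(lphi_orth hα _ _).2]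
  simp

lemma dyson {α : ℝ} (hα : -1 < α) (N k : ℕ) (t : Fin k → ℝ) :
    Integrable (fun s => detK α N (Fin.snoc (α := fun _ => ℝ) t s)) ∧
    ∫ s, detK α N (Fin.snoc (α := fun _ => ℝ) t s) = ((N:ℝ) - k) * detK α N t := by
  simp_rw [detK_snoc]
  set A := (Matrix.of fun i j => lker α N (t i) (t j)) with hA
  have e : ∀ s i j, lker α N s (t i) * A.adjugate i j * lker α N (t j) s = A.adjugate i j * (lker α N s (t i) * lker α N (t j) s) := by
    intros; ring
  simp_rw [e]
  have hi : ∀ i j, Integrable (fun s => A.adjugate i j * (lker α N s (t i) * lker α N (t j) s)) :=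
    fun i j => (lker_repro hα N _ _).1.const_mul _
  have hI := integrable_finsetSum univ fun i _ => integrable_finsetSum univ fun j _ => hi i j
  have hT := ((lker_trace hα N).1.mul_const (detK α N t))
  refine ⟨hT.sub hI, ?_⟩
  rw [integral_sub hT hI, integral_mul_const, (lker_trace hα N).2, integral_finsetSum _ fun i _ => integrable_finsetSum univ fun j _ => hi i j]
  simp_rw [integral_finsetSum _ fun j _ => hi _ j, integral_const_mul, (lker_repro hα N _ _).2]
  have : ∑ i, ∑ j, A.adjugate i j * lker α N (t i) (t j) = k * detK α N t := by
    have h1 : ∀ i j, lker α N (t i) (t j) = A j i := by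
      intro i j; rw [lker_symm]; rfl
    simp_rw [h1, ← Matrix.mul_apply]
    rw [Matrix.adjugate_mul]
    simp [detK, hA]
  rw [this]; ring

lemma lker_measurable (α : ℝ) (N : ℕ) : Measurable (fun p : ℝ × ℝ => lker α N p.1 p.2) := by
  unfold lker
  refine Finset.measurable_sum _ fun k _ => ?_
  exact ((lphi_measurable α k).comp measurable_fst).mul ((lphi_measurable α k).comp measurable_snd)

lemma measurable_det_of {X ι : Type} [MeasurableSpace X] [Fintype ι] [DecidableEq ι] (M : X → ι → ι → ℝ)
    (h : ∀ i j, Measurable fun x => M x i j) : Measurable fun x => Matrix.det (Matrix.of (M x)) := by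
  simp only [Matrix.det_apply]
  refine Finset.measurable_sum _ fun σ _ => ?_
  refine Measurable.const_smul ?_ _
  exact Finset.measurable_prod _ fun i _ => h _ _

lemma detK_measurable (α : ℝ) (N : ℕ) {ι : Type} [Fintype ι] [DecidableEq ι] : Measurable (fun x : ι → ℝ => detK α N x) := by
  unfold detK
  refine measurable_det_of _ fun i j => ?_
  have h : Measurable (fun x : ι → ℝ => (x i, x j)) := by fun_prop
  exact (lker_measurable α N).comp h

open scoped ENNReal in
lemma dyson_lint {α : ℝ} (hα : -1 < α) {N k : ℕ} (hk : k ≤ N) (t : Fin k → ℝ) :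
    ∫⁻ s, ENNReal.ofReal (detK α N (Fin.snoc (α := fun _ => ℝ) t s)) = ((N - k : ℕ) : ℝ≥0∞) * ENNReal.ofReal (detK α N t) := by
  obtain ⟨h1, h2⟩ := dyson hα N k t
  rw [← ofReal_integral_eq_lintegral_ofReal h1 (Eventually.of_forall fun s => detK_nonneg _ _ _), h2,
    ← Nat.cast_sub hk, ENNReal.ofReal_mul (Nat.cast_nonneg _), ENNReal.ofReal_natCast]

lemma lint_snoc {k : ℕ} (H : (Fin (k+1) → ℝ) → ENNReal) (hH : Measurable H) :
    ∫⁻ x, H x = ∫⁻ t : Fin k → ℝ, ∫⁻ s : ℝ, H (Fin.snoc (α := fun _ => ℝ) t s) := by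
  have mp := volume_preserving_piFinSuccAbove (fun _ : Fin (k+1) => ℝ) (Fin.last k)
  have := mp.symm.lintegral_comp hH
  have hm : Measurable fun a => H ((MeasurableEquiv.piFinSuccAbove (fun _ : Fin (k+1) => ℝ) (Fin.last k)).symm a) :=
    hH.comp (MeasurableEquiv.measurable _)
  rw [← this, Measure.volume_eq_prod]
  refine (lintegral_prod_symm' _ hm).trans ?_
  refine lintegral_congr fun t => lintegral_congr fun s => ?_
  congr 1
  simp [MeasurableEquiv.piFinSuccAbove]
  rfl

/-- first n coordinates -/
def firstN (n j : ℕ) (x : Fin (n + j) → ℝ) : Fin n → ℝ := fun i => x (Fin.castAdd j i)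

lemma firstN_measurable (n j : ℕ) : Measurable (firstN n j) := by
  unfold firstN; fun_prop

open scoped ENNReal in
lemma marg_aux {α : ℝ} (hα : -1 < α) (n : ℕ) (h : (Fin n → ℝ) → ℝ≥0∞) (hh : Measurable h) (N j : ℕ) (hj : n + j ≤ N) :
    ((N - n - j).factorial : ℝ≥0∞) * ∫⁻ x : Fin (n + j) → ℝ, h (firstN n j x) * ENNReal.ofReal (detK α N x) =
      ((N - n).factorial : ℝ≥0∞) * ∫⁻ t, h t * ENNReal.ofReal (detK α N t) := by
  induction j with
  | zero =>
    have h0 : ∀ x : Fin n → ℝ, firstN n 0 x = x := fun x => rfl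
    show ((N - n).factorial : ℝ≥0∞) * ∫⁻ x : Fin n → ℝ, h (firstN n 0 x) * ENNReal.ofReal (detK α N x) = _
    simp only [h0]
  | succ j ih =>
    rw [← ih (by omega)]
    have hm : ∀ j, Measurable fun x : Fin (n + j) → ℝ => h (firstN n j x) * ENNReal.ofReal (detK α N x) :=
      fun j => (hh.comp (firstN_measurable n j)).mul (detK_measurable α N).ennreal_ofReal
    have hs := lint_snoc (k := n + j) _ (hm (j+1))
    refine (congrArg _ hs).trans ?_
    have e : ∀ (t : Fin (n+j) → ℝ) (s : ℝ), firstN n (j+1) (Fin.snoc (α := fun _ => ℝ) t s) = firstN n j t := by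
      intro t s; ext i
      simp only [firstN]
      have : (Fin.castAdd (j+1) i : Fin (n + (j+1))) = (Fin.castAdd j i).castSucc := rfl
      rw [this]
      exact Fin.snoc_castSucc (α := fun _ => ℝ) _ _ _
    have e2 : ∀ t : Fin (n+j) → ℝ, ∫⁻ s : ℝ, h (firstN n (j+1) (Fin.snoc (α := fun _ => ℝ) t s)) * ENNReal.ofReal (detK α N (Fin.snoc (α := fun _ => ℝ) t s))
        = ((N - (n+j) : ℕ) : ℝ≥0∞) * (h (firstN n j t) * ENNReal.ofReal (detK α N t)) := by
      intro t
      simp_rw [e]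
      have hms : Measurable fun s : ℝ => (Fin.snoc (α := fun _ => ℝ) t s : Fin (n+j+1) → ℝ) := by
        refine measurable_pi_lambda _ fun i => ?_
        refine Fin.lastCases ?_ (fun i => ?_) i
        · simp only [Fin.snoc_last]; exact measurable_id
        · simp only [Fin.snoc_castSucc]; exact measurable_const
      refine (lintegral_const_mul _ ((detK_measurable α N).comp hms).ennreal_ofReal).trans ?_
      refine (congrArg _ (dyson_lint hα (by omega) t)).trans ?_; ring
    refine (congrArg _ (lintegral_congr e2)).trans ?_
    rw [lintegral_const_mul _ (hm j), ← mul_assoc]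
    congr 1
    have : N - n - j = (N - n - (j+1)) + 1 := by omega
    rw [this, Nat.factorial_succ, ← this]
    have h2 : N - (n + j) = N - n - j := by omega
    rw [h2]; push_cast; ring

/-- Vandermonde form of the full determinant -/
lemma detK_full {α : ℝ} (hα : -1 < α) (N : ℕ) (x : Fin N → ℝ) (hx : ∀ i, 0 < x i) :
    detK α N x = vdm2 x * lagWeight α x * Real.exp (-∑ i, x i) / ∏ k : Fin N, lgam α k := by
  unfold detK
  rw [kerMat_eq, Matrix.det_mul, Matrix.det_conjTranspose, star_trivial]
  have e : (Matrix.of fun (i : Fin N) (k : Fin N) => lphi α k (x i)) =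
      Matrix.diagonal (fun i => x i ^ (α/2) * Real.exp (-x i / 2)) * (Matrix.of fun i j : Fin N => (lp α j).eval (x i)) *
        Matrix.diagonal (fun k : Fin N => (Real.sqrt (lgam α k))⁻¹) := by
    ext i k
    rw [Matrix.mul_diagonal, Matrix.diagonal_mul]
    simp only [Matrix.of_apply, lphi, hx i, if_true, lv, div_eq_mul_inv]
  rw [e, Matrix.det_mul, Matrix.det_mul, Matrix.det_diagonal, Matrix.det_diagonal,
    ← Matrix.det_eval_matrixOfPolynomials_eq_det_vandermonde x (fun j : Fin N => lp α j) (fun j => (lp_natDegree_monic α j).1)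
    (fun j => (lp_natDegree_monic α j).2)]
  have hv : (Matrix.vandermonde x).det ^ 2 = vdm2 x := by
    rw [Matrix.det_vandermonde, vdm2, ← prod_pow]
    simp_rw [← prod_pow]
    rw [Finset.prod_filter, ← Finset.univ_product_univ, Finset.prod_product]
    refine prod_congr rfl fun i _ => ?_
    rw [← Finset.prod_filter]
    refine prod_congr ?_ fun j _ => rfl
    ext j; simp
  have hw : (∏ i, x i ^ (α/2) * Real.exp (-x i / 2))^2 = lagWeight α x * Real.exp (-∑ i, x i) := by
    rw [← sum_neg_distrib, Real.exp_sum, lagWeight, ← prod_mul_distrib, ← prod_pow]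
    refine prod_congr rfl fun i _ => ?_
    rw [mul_pow, ← Real.rpow_natCast, ← Real.rpow_mul (hx i).le, ← Real.exp_nat_mul]
    congr 2
    · push_cast; ring
    · push_cast; ring
  have hg : (∏ k : Fin N, (Real.sqrt (lgam α k))⁻¹)^2 = (∏ k : Fin N, lgam α k)⁻¹ := by
    rw [← prod_pow, ← prod_inv_distrib]
    refine prod_congr rfl fun k _ => ?_
    rw [inv_pow, Real.sq_sqrt (lgam_pos hα k).le]
  rw [mul_assoc (vdm2 x), ← hv, ← hw, div_eq_mul_inv (_ * _), ← hg]
  ring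

lemma detK_zero (α : ℝ) (N : ℕ) (x : Fin N → ℝ) (hx : ¬ ∀ i, 0 < x i) : detK α N x = 0 := by
  push Not at hx
  obtain ⟨i, hi⟩ := hx
  refine Matrix.det_eq_zero_of_row_eq_zero i fun j => ?_
  simp only [Matrix.of_apply, lker]
  refine sum_eq_zero fun k _ => ?_
  simp [lphi, not_lt.2 hi]

end RMT

namespace RMT
open scoped ENNReal

lemma vdm2_smul {N : ℕ} (c : ℝ) (x : Fin N → ℝ) : vdm2 (c • x) = c ^ (N * (N - 1)) * vdm2 x := by
  unfold vdm2
  have h : ∀ p : Fin N × Fin N, ((c • x) p.2 - (c • x) p.1)^2 = c^2 * (x p.2 - x p.1)^2 := by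
    intro p; simp only [Pi.smul_apply, smul_eq_mul]; ring
  simp_rw [h]
  rw [prod_mul_distrib, prod_const, ← pow_mul]
  congr 2
  have : (univ.filter (fun p : Fin N × Fin N => p.1 < p.2)).card = ∑ i : Fin N, (N - 1 - (i:ℕ)) := by
    rw [card_filter, ← Finset.univ_product_univ, sum_product]
    refine sum_congr rfl fun i _ => ?_
    rw [← card_filter]
    have : (univ.filter fun j : Fin N => i < j) = Finset.Ioi i := by ext; simp
    rw [this, Fin.card_Ioi]
  rw [this, Fin.sum_univ_eq_sum_range (fun i => N - 1 - i), Finset.sum_range_reflect (fun i => i), mul_comm, Finset.sum_range_id_mul_two]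

lemma lagWeight_smul {α : ℝ} {N : ℕ} {c : ℝ} (hc : 0 < c) (x : Fin N → ℝ) (hx : ∀ i, 0 < x i) :
    lagWeight α (c • x) = c ^ (N * α) * lagWeight α x := by
  unfold lagWeight
  simp only [Pi.smul_apply, smul_eq_mul]
  rw [prod_congr rfl fun i _ => Real.mul_rpow hc.le (hx i).le, prod_mul_distrib, prod_const, Finset.card_univ, Fintype.card_fin,
    ← Real.rpow_natCast, ← Real.rpow_mul hc.le, mul_comm α]

/-- positive weight -/
def wt (α : ℝ) {N : ℕ} (x : Fin N → ℝ) : ℝ≥0∞ :=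
  if ∀ i, 0 < x i then ENNReal.ofReal (vdm2 x * lagWeight α x) else 0

/-- bounded trace density -/
def thD (α : ℝ) {N : ℕ} (r : ℝ) (x : Fin N → ℝ) : ℝ≥0∞ :=
  if (∀ i, 0 < x i) ∧ ∑ i, x i ≤ r then ENNReal.ofReal (vdm2 x * lagWeight α x) else 0

lemma vdm2_nonneg {N : ℕ} (x : Fin N → ℝ) : 0 ≤ vdm2 x := prod_nonneg fun _ _ => sq_nonneg _

lemma vdm2_measurable (N : ℕ) : Measurable (vdm2 : (Fin N → ℝ) → ℝ) := by
  unfold vdm2; fun_prop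

lemma lagWeight_measurable (α : ℝ) (N : ℕ) : Measurable (lagWeight α : (Fin N → ℝ) → ℝ) := by
  unfold lagWeight
  refine Finset.measurable_prod _ fun i _ => (measurable_pi_apply i).pow_const α

lemma pos_measurableSet (N : ℕ) : MeasurableSet {x : Fin N → ℝ | ∀ i, 0 < x i} := by
  rw [Set.ofPred_forall]
  exact MeasurableSet.iInter fun i => measurableSet_lt measurable_const (measurable_pi_apply i)

lemma wt_measurable (α : ℝ) (N : ℕ) : Measurable (wt α : (Fin N → ℝ) → ℝ≥0∞) := by
  unfold wt
  exact Measurable.ite (pos_measurableSet N) ((vdm2_measurable N).mul (lagWeight_measurable α N)).ennreal_ofReal measurable_const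

lemma thD_measurable (α : ℝ) (N : ℕ) (r : ℝ) : Measurable (thD α r : (Fin N → ℝ) → ℝ≥0∞) := by
  unfold thD
  refine Measurable.ite ((pos_measurableSet N).inter ?_) ((vdm2_measurable N).mul (lagWeight_measurable α N)).ennreal_ofReal measurable_const
  exact measurableSet_le (f := fun x : Fin N → ℝ => ∑ i, x i) (by fun_prop) measurable_const

lemma wt_smul {α : ℝ} {N : ℕ} {c : ℝ} (hc : 0 < c) (x : Fin N → ℝ) :
    wt α (c • x) = ENNReal.ofReal (c ^ (N * (N - 1)) * c ^ (N * α)) * wt α x := by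
  unfold wt
  have e : (∀ i, 0 < (c • x) i) ↔ ∀ i, 0 < x i := by
    refine forall_congr' fun i => ?_
    simp [hc]
  by_cases h : ∀ i, 0 < x i
  · rw [if_pos h, if_pos (e.2 h), ← ENNReal.ofReal_mul (by positivity), vdm2_smul, lagWeight_smul hc x h]
    congr 1; ring
  · rw [if_neg h, if_neg (fun h' => h (e.1 h'))]; simp

lemma lint_smul {N : ℕ} {c : ℝ} (hc : 0 < c) (H : (Fin N → ℝ) → ℝ≥0∞) (hH : Measurable H) :
    ∫⁻ x, H x = ENNReal.ofReal (c ^ N) * ∫⁻ y, H (c • y) := by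
  have h1 : ∫⁻ y, H (c • y) = ∫⁻ x, H x ∂(Measure.map (fun y : Fin N → ℝ => c • y) volume) :=
    (lintegral_map hH (by fun_prop)).symm
  rw [h1, Measure.map_addHaar_smul volume hc.ne', lintegral_smul_measure, smul_eq_mul, ← mul_assoc, ← ENNReal.ofReal_mul (by positivity)]
  rw [Module.finrank_fintype_fun_eq_card, Fintype.card_fin, abs_of_pos (by positivity), mul_inv_cancel₀ (by positivity)]
  simp

/-- exponential tail as an integral in the log scale -/
lemma exp_tail {M m T : ℝ} (hM : 0 < M) (hm : 0 < m) (hT : 0 ≤ T) :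
    ENNReal.ofReal (Real.exp (-T)) = ∫⁻ g : ℝ, if T ≤ M * Real.exp (g / m) then
      ENNReal.ofReal ((M / m) * Real.exp (g / m) * Real.exp (-(M * Real.exp (g / m)))) else 0 := by
  have h1 : ENNReal.ofReal (Real.exp (-T)) = ∫⁻ r in Set.Ioi T, ENNReal.ofReal (Real.exp (-r)) := by
    rw [← integral_exp_neg_Ioi, ofReal_integral_eq_lintegral_ofReal]
    · exact integrableOn_exp_neg_Ioi T
    · exact Eventually.of_forall fun x => (Real.exp_pos _).le
  have h2 : ∫⁻ r in Set.Ioi T, ENNReal.ofReal (Real.exp (-r)) = ∫⁻ r in Set.Ioi (0:ℝ), (if T ≤ r then ENNReal.ofReal (Real.exp (-r)) else 0) := by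
    rw [setLIntegral_congr Ioi_ae_eq_Ici, setLIntegral_congr (Ioi_ae_eq_Ici (a := (0:ℝ))), ← lintegral_indicator measurableSet_Ici, ← lintegral_indicator measurableSet_Ici]
    refine lintegral_congr fun r => ?_
    simp only [Set.indicator, Set.mem_Ici]
    by_cases h : T ≤ r
    · simp [h, hT.trans h]
    · simp [h]
  have him : (fun g : ℝ => M * Real.exp (g / m)) '' Set.univ = Set.Ioi 0 := by
    ext r; simp only [Set.image_univ, Set.mem_range, Set.mem_Ioi]
    constructor
    · rintro ⟨g, rfl⟩; positivity
    · intro hr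
      refine ⟨m * Real.log (r / M), ?_⟩
      rw [mul_div_cancel_left₀ _ hm.ne', Real.exp_log (by positivity)]; field_simp
  rw [h1, h2, ← him, lintegral_image_eq_lintegral_abs_deriv_mul (f' := fun g => (M / m) * Real.exp (g / m)) MeasurableSet.univ]
  · rw [setLIntegral_univ]
    refine lintegral_congr fun g => ?_
    by_cases h : T ≤ M * Real.exp (g / m)
    · rw [if_pos h, if_pos h, ← ENNReal.ofReal_mul (abs_nonneg _), abs_of_pos (by positivity)]
    · rw [if_neg h, if_neg h, mul_zero]
  · intro g _
    refine HasDerivAt.hasDerivWithinAt (HasDerivAt.congr_deriv (f := fun g : ℝ => M * Real.exp (g / m)) (((hasDerivAt_id g).div_const m).exp.const_mul M) ?_)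
    simp only [id]; ring
  · intro a _ b _ hab
    simp only at hab
    have := Real.exp_injective (mul_left_cancel₀ hM.ne' hab)
    exact (div_left_inj' hm.ne').1 this

/-- the mixing density -/
def hmix (α : ℝ) (N : ℕ) (m g : ℝ) : ℝ :=
  Real.exp (g / m - (N * (N + α)) * (Real.exp (g / m) - 1 - g / m))

lemma hmix_continuous (α : ℝ) (N : ℕ) (m : ℝ) : Continuous (hmix α N m) := by
  unfold hmix; fun_prop

lemma mix_wt {α : ℝ} (hα : -1 < α) {N : ℕ} (hN : 1 ≤ N) {m : ℝ} (hm : 0 < m) :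
    ∃ C : ℝ, 0 < C ∧ ∀ H : (Fin N → ℝ) → ℝ≥0∞, Measurable H →
    ∫⁻ x, H x * (wt α x * ENNReal.ofReal (Real.exp (-∑ i, x i))) =
      ENNReal.ofReal C * ∫⁻ g : ℝ, ENNReal.ofReal (hmix α N m g) *
        ∫⁻ y : Fin N → ℝ, H ((4 * N * Real.exp (g / m)) • y) * thD α ((N + α) / 4) y := by
  have hNr : (1:ℝ) ≤ N := by exact_mod_cast hN
  have hM : (0:ℝ) < N * (N + α) := by nlinarith
  set M : ℝ := N * (N + α) with hMd
  refine ⟨(M / m) * (4 * N) ^ M * Real.exp (-M), by positivity, ?_⟩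
  intro H hH
  have m1 : Measurable fun x : Fin N → ℝ => ∑ i, x i := by fun_prop
  have hset : MeasurableSet {p : (Fin N → ℝ) × ℝ | ∑ i, p.1 i ≤ M * Real.exp (p.2 / m)} :=
    measurableSet_le (by fun_prop) (by fun_prop)
  have s1 : ∫⁻ x, H x * (wt α x * ENNReal.ofReal (Real.exp (-∑ i, x i))) =
      ∫⁻ x : Fin N → ℝ, ∫⁻ g : ℝ, H x * wt α x * (if ∑ i, x i ≤ M * Real.exp (g / m) then
      ENNReal.ofReal ((M / m) * Real.exp (g / m) * Real.exp (-(M * Real.exp (g / m)))) else 0) := by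
    refine lintegral_congr fun x => ?_
    rw [lintegral_const_mul, ← mul_assoc]
    · by_cases hx : ∀ i, 0 < x i
      · rw [exp_tail hM hm (sum_nonneg fun i _ => (hx i).le)]
      · simp [wt, hx]
    · exact Measurable.ite (measurableSet_le (by fun_prop) (by fun_prop)) (by fun_prop) measurable_const
  rw [s1, lintegral_lintegral_swap, ← lintegral_const_mul _ ]
  · refine lintegral_congr fun g => ?_
    set c : ℝ := 4 * N * Real.exp (g / m) with hc
    have hcpos : 0 < c := by positivity
    rw [lint_smul hcpos]
    · rw [← mul_assoc (ENNReal.ofReal _), ← ENNReal.ofReal_mul (by positivity), ← lintegral_const_mul, ← lintegral_const_mul]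
      · refine lintegral_congr fun y => ?_
        rw [wt_smul hcpos]
        have e1 : ∑ i, (c • y) i = c * ∑ i, y i := by simp [mul_sum]
        have e2 : c * ∑ i, y i ≤ M * Real.exp (g / m) ↔ ∑ i, y i ≤ (N + α) / 4 := by
          have : M * Real.exp (g / m) = c * ((N + α) / 4) := by rw [hc, hMd]; ring
          rw [this]; exact mul_le_mul_iff_right₀ hcpos
        rw [e1]; simp_rw [e2]
        by_cases h1 : ∀ i, 0 < y i
        · by_cases h2 : ∑ i, y i ≤ (N + α) / 4
          · rw [if_pos h2, wt, if_pos h1, thD, if_pos ⟨h1, h2⟩]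
            have hnum : c ^ N * (c ^ (N * (N-1)) * c ^ (N * α)) * (M / m * Real.exp (g / m) * Real.exp (-(M * Real.exp (g / m))))
              = M / m * (4 * N) ^ M * Real.exp (-M) * hmix α N m g := by
              have : c ^ N * (c ^ (N * (N-1)) * c ^ (N * α)) = c ^ M := by
                rw [← Real.rpow_natCast, ← Real.rpow_natCast, ← Real.rpow_add hcpos, ← Real.rpow_add hcpos, hMd]
                congr 1
                rw [Nat.cast_mul, Nat.cast_sub hN]; push_cast; ring
              rw [this, hc, Real.mul_rpow (by positivity) (Real.exp_pos _).le, ← Real.exp_mul, hmix, ← hMd]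
              have e3 : g / m - M * (Real.exp (g / m) - 1 - g / m) = M + (g / m * M) + g/m + -(M * Real.exp (g/m)) := by ring
              rw [e3, Real.exp_add, Real.exp_add, Real.exp_add]
              have : Real.exp (-M) * Real.exp M = 1 := by rw [← Real.exp_add]; simp
              linear_combination (-(M / m * (4 * ↑N) ^ M * (Real.exp (g / m * M) * Real.exp (g / m) * Real.exp (-(M * Real.exp (g / m)))))) * this
            have e4 : ∀ a b c d e : ℝ≥0∞, a * (b * (c * d) * e) = (a * c * e) * (b * d) := by intros; ring
            rw [e4, ← ENNReal.ofReal_mul (by positivity), ← ENNReal.ofReal_mul (by positivity), hnum]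
          · rw [if_neg h2, thD, if_neg (fun h => h2 h.2)]; simp
        · simp [wt, thD, h1]
      · exact (hH.comp (by fun_prop)).mul (thD_measurable α N _)
      · refine Measurable.mul ((hH.comp (by fun_prop)).mul ((wt_measurable α N).comp (by fun_prop))) ?_
        exact Measurable.ite (measurableSet_le (by fun_prop) (by fun_prop)) (by fun_prop) measurable_const
    · refine Measurable.mul (hH.mul (wt_measurable α N)) ?_
      exact Measurable.ite (measurableSet_le (by fun_prop) (by fun_prop)) (by fun_prop) measurable_const
  · refine (hmix_continuous α N m).measurable.ennreal_ofReal.mul ?_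
    have : Measurable fun p : ℝ × (Fin N → ℝ) => H ((4 * N * Real.exp (p.1 / m)) • p.2) * thD α ((N + α) / 4) p.2 :=
      (hH.comp (by fun_prop)).mul ((thD_measurable α N _).comp measurable_snd)
    exact this.lintegral_prod_right'
  · refine Measurable.aemeasurable ?_
    refine Measurable.mul ((hH.mul (wt_measurable α N)).comp measurable_fst) ?_
    exact Measurable.ite hset (by fun_prop) measurable_const

end RMT

namespace RMT
open scoped ENNReal

/-- first n coordinates, total version -/
def resN (N n : ℕ) (x : Fin N → ℝ) : Fin n → ℝ := fun i => if h : (i:ℕ) < N then x ⟨i, h⟩ else 0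

lemma resN_measurable (N n : ℕ) : Measurable (resN N n) := by
  refine measurable_pi_lambda _ fun i => ?_
  unfold resN
  by_cases h : (i:ℕ) < N
  · simp only [h, dif_pos]; exact measurable_pi_apply _
  · simp only [h, dif_neg, not_false_iff]; exact measurable_const

lemma resN_smul (N n : ℕ) (c : ℝ) (x : Fin N → ℝ) : resN N n (c • x) = c • resN N n x := by
  ext i
  simp only [resN, Pi.smul_apply, smul_eq_mul]
  split_ifs <;> simp

lemma marg {α : ℝ} (hα : -1 < α) {n N : ℕ} (hn : n ≤ N) (h : (Fin n → ℝ) → ℝ≥0∞) (hh : Measurable h) :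
    ∫⁻ x : Fin N → ℝ, h (resN N n x) * ENNReal.ofReal (detK α N x) =
      ((N - n).factorial : ℝ≥0∞) * ∫⁻ t, h t * ENNReal.ofReal (detK α N t) := by
  obtain ⟨j, rfl⟩ := Nat.exists_eq_add_of_le hn
  have := marg_aux hα n h hh (n + j) j le_rfl
  have e : n + j - n - j = 0 := by omega
  rw [e, Nat.factorial_zero, Nat.cast_one, one_mul] at this
  rw [← this]
  refine lintegral_congr fun x => ?_
  congr 2
  ext i
  have : (i:ℕ) < n + j := by omega
  simp only [resN, this, dif_pos, firstN]
  rfl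

lemma marg_total {α : ℝ} (hα : -1 < α) (N : ℕ) :
    ∫⁻ x : Fin N → ℝ, ENNReal.ofReal (detK α N x) = (N.factorial : ℝ≥0∞) := by
  have := marg hα (Nat.zero_le N) (fun _ => 1) measurable_const
  simp only [one_mul] at this
  rw [this]
  have hv : (volume : Measure (Fin 0 → ℝ)) Set.univ = 1 := by
    rw [volume_pi, Measure.pi_of_empty]; simp
  simp [detK, hv]

/-- bounded trace measure on full configurations -/
def ThM (α : ℝ) (N : ℕ) : Measure (Fin N → ℝ) := volume.withDensity (thD α ((N + α) / 4))

/-- n-point correlation measure of the bounded trace ensemble -/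
def muT (α : ℝ) (N n : ℕ) : Measure (Fin n → ℝ) :=
  (((N.factorial : ℝ≥0∞) / ((N - n).factorial : ℝ≥0∞)) / ThM α N Set.univ) • Measure.map (resN N n) (ThM α N)

/-- mixing mass -/
def Smix (α : ℝ) (N : ℕ) (m : ℝ) : ℝ≥0∞ := ∫⁻ g, ENNReal.ofReal (hmix α N m g)

lemma detK_zero' (α : ℝ) (N n : ℕ) (x : Fin n → ℝ) (hx : ¬ ∀ i, 0 < x i) : detK α N x = 0 := by
  push Not at hx
  obtain ⟨i, hi⟩ := hx
  refine Matrix.det_eq_zero_of_row_eq_zero i fun j => ?_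
  simp only [Matrix.of_apply, lker]
  refine sum_eq_zero fun k _ => ?_
  simp [lphi, not_lt.2 hi]

lemma wt_detK {α : ℝ} (hα : -1 < α) (N : ℕ) (x : Fin N → ℝ) :
    wt α x * ENNReal.ofReal (Real.exp (-∑ i, x i)) = ENNReal.ofReal (∏ k : Fin N, lgam α k) * ENNReal.ofReal (detK α N x) := by
  have hp : 0 < ∏ k : Fin N, lgam α k := prod_pos fun k _ => lgam_pos hα k
  by_cases hx : ∀ i, 0 < x i
  · have h0 : 0 ≤ vdm2 x * lagWeight α x := mul_nonneg (vdm2_nonneg x) (prod_nonneg fun i _ => Real.rpow_nonneg (hx i).le _)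
    rw [wt, if_pos hx, ← ENNReal.ofReal_mul h0, ← ENNReal.ofReal_mul hp.le, detK_full hα N x hx, mul_div_cancel₀ _ hp.ne']
  · rw [wt, if_neg hx, detK_zero' α N N x hx]; simp

lemma muT_lint (α : ℝ) (N n : ℕ) (h : (Fin n → ℝ) → ℝ≥0∞) (hh : Measurable h) :
    ∫⁻ t, h t ∂(muT α N n) = (((N.factorial : ℝ≥0∞) / ((N - n).factorial : ℝ≥0∞)) / ThM α N Set.univ) *
      ∫⁻ y : Fin N → ℝ, h (resN N n y) * thD α ((N + α) / 4) y := by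
  rw [muT, lintegral_smul_measure, smul_eq_mul, lintegral_map hh (resN_measurable N n), ThM]
  congr 1
  rw [lintegral_withDensity_eq_lintegral_mul (g := fun y => h (resN N n y)) _ (thD_measurable α N _) (hh.comp (resN_measurable N n))]
  refine lintegral_congr fun y => ?_
  simp [mul_comm]

theorem mix_detK {α : ℝ} (hα : -1 < α) {N : ℕ} (hN : 1 ≤ N) {m : ℝ} (hm : 0 < m) :
    (ThM α N Set.univ ≠ 0 ∧ ThM α N Set.univ ≠ ∞) ∧ (Smix α N m ≠ 0 ∧ Smix α N m ≠ ∞) ∧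
    ∀ n, n ≤ N → ∀ h : (Fin n → ℝ) → ℝ≥0∞, Measurable h →
      ∫⁻ t, h t * ENNReal.ofReal (detK α N t) =
        (Smix α N m)⁻¹ * ∫⁻ g : ℝ, ENNReal.ofReal (hmix α N m g) *
          ∫⁻ t, h ((4 * N * Real.exp (g / m)) • t) ∂(muT α N n) := by
  obtain ⟨C, hC, key⟩ := mix_wt hα hN hm
  have hp : 0 < ∏ k : Fin N, lgam α k := prod_pos fun k _ => lgam_pos hα k
  set a := ENNReal.ofReal (∏ k : Fin N, lgam α k) with ha
  have ha0 : a ≠ 0 := by simp [ha, hp]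
  have hat : a ≠ ∞ := ENNReal.ofReal_ne_top
  set b := ENNReal.ofReal C with hb
  have hb0 : b ≠ 0 := by simp [hb, hC]
  have hbt : b ≠ ∞ := ENNReal.ofReal_ne_top
  have key' : ∀ H : (Fin N → ℝ) → ℝ≥0∞, Measurable H → a * ∫⁻ x, H x * ENNReal.ofReal (detK α N x) =
      b * ∫⁻ g : ℝ, ENNReal.ofReal (hmix α N m g) *
        ∫⁻ y : Fin N → ℝ, H ((4 * N * Real.exp (g / m)) • y) * thD α ((N + α) / 4) y := by
    intro H hH
    have hmm : Measurable fun x => H x * ENNReal.ofReal (detK α N x) := hH.mul (detK_measurable α N).ennreal_ofReal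
    rw [← key H hH, ← lintegral_const_mul _ hmm]
    refine lintegral_congr fun x => ?_
    rw [wt_detK hα]; ring
  have hTh : ThM α N Set.univ = ∫⁻ y : Fin N → ℝ, thD α ((N + α) / 4) y := by
    rw [ThM, withDensity_apply _ MeasurableSet.univ, setLIntegral_univ]
  have tot : a * (N.factorial : ℝ≥0∞) = b * (Smix α N m * ThM α N Set.univ) := by
    have := key' (fun _ => 1) measurable_const
    simp only [one_mul] at this
    rw [marg_total hα, ← hTh, lintegral_mul_const _ (hmix_continuous α N m).measurable.ennreal_ofReal] at this
    exact this
  have hA0 : (N.factorial : ℝ≥0∞) ≠ 0 := by exact_mod_cast N.factorial_ne_zero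
  have hAt : (N.factorial : ℝ≥0∞) ≠ ∞ := ENNReal.natCast_ne_top _
  set S := Smix α N m with hS
  set Th := ThM α N Set.univ with hT
  have hne : S * Th ≠ 0 := by
    intro h0; rw [h0, mul_zero] at tot
    exact (mul_ne_zero ha0 hA0) tot
  have hnt : S * Th ≠ ∞ := by
    intro h0; rw [h0, ENNReal.mul_top hb0] at tot
    exact (ENNReal.mul_ne_top hat hAt) tot
  have hS0 : S ≠ 0 := left_ne_zero_of_mul hne
  have hT0 : Th ≠ 0 := right_ne_zero_of_mul hne
  have hSt : S ≠ ∞ := fun h => hnt (by rw [h, ENNReal.top_mul hT0])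
  have hTt : Th ≠ ∞ := fun h => hnt (by rw [h, ENNReal.mul_top hS0])
  refine ⟨⟨hT0, hTt⟩, ⟨hS0, hSt⟩, ?_⟩
  intro n hn h hh
  have k2 := key' (fun x => h (resN N n x)) (hh.comp (resN_measurable N n))
  rw [marg hα hn h hh] at k2
  simp only [resN_smul] at k2
  set L := ∫⁻ t, h t * ENNReal.ofReal (detK α N t) with hL
  set F : ℝ≥0∞ := ((N - n).factorial : ℝ≥0∞) with hF
  have hF0 : F ≠ 0 := by simp only [hF]; exact_mod_cast (N-n).factorial_ne_zero
  have hFt : F ≠ ∞ := ENNReal.natCast_ne_top _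
  have e : ∀ g : ℝ, ∫⁻ t, h ((4 * N * Real.exp (g / m)) • t) ∂(muT α N n) =
    ((N.factorial : ℝ≥0∞) / F / Th) * ∫⁻ y : Fin N → ℝ, h ((4 * N * Real.exp (g / m)) • resN N n y) * thD α ((N + α) / 4) y := by
    intro g
    exact muT_lint α N n (fun t => h ((4 * N * Real.exp (g / m)) • t)) (hh.comp (by fun_prop))
  simp_rw [e]
  have e2 : ∀ u v w : ℝ≥0∞, u * (v * w) = v * (u * w) := by intros; ring
  simp_rw [e2 _ ((N.factorial : ℝ≥0∞) / F / Th)]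
  rw [lintegral_const_mul]
  swap
  · refine (hmix_continuous α N m).measurable.ennreal_ofReal.mul ?_
    have : Measurable fun p : ℝ × (Fin N → ℝ) => h ((4 * N * Real.exp (p.1 / m)) • resN N n p.2) * thD α ((N + α) / 4) p.2 := by
      refine (hh.comp ?_).mul ((thD_measurable α N _).comp measurable_snd)
      have : Measurable fun p : ℝ × (Fin N → ℝ) => resN N n p.2 := (resN_measurable N n).comp measurable_snd
      fun_prop
    exact this.lintegral_prod_right'
  set I := ∫⁻ g : ℝ, ENNReal.ofReal (hmix α N m g) *
        ∫⁻ y : Fin N → ℝ, h ((4 * N * Real.exp (g / m)) • resN N n y) * thD α ((N + α) / 4) y with hI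
  have hI2 : I = b⁻¹ * (a * (F * L)) := by
    rw [k2, ← mul_assoc, ENNReal.inv_mul_cancel hb0 hbt, one_mul]
  rw [hI2, div_eq_mul_inv, div_eq_mul_inv]
  calc L = (b⁻¹ * b) * (S⁻¹ * S) * (Th⁻¹ * Th) * (F⁻¹ * F) * L := by
        rw [ENNReal.inv_mul_cancel hb0 hbt, ENNReal.inv_mul_cancel hS0 hSt, ENNReal.inv_mul_cancel hT0 hTt, ENNReal.inv_mul_cancel hF0 hFt]; simp
    _ = b⁻¹ * S⁻¹ * Th⁻¹ * (b * (S * Th)) * (F⁻¹ * F) * L := by ring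
    _ = b⁻¹ * S⁻¹ * Th⁻¹ * (a * (N.factorial : ℝ≥0∞)) * (F⁻¹ * F) * L := by rw [tot]
    _ = _ := by ring

lemma muT_pos (α : ℝ) {N n : ℕ} (hn : n ≤ N) : ∀ᵐ t ∂(muT α N n), ∀ i, 0 < t i := by
  rw [muT]
  refine Measure.ae_smul_measure ?_ _
  rw [ae_map_iff (resN_measurable N n).aemeasurable (pos_measurableSet n), ThM, ae_withDensity_iff (thD_measurable α N _)]
  refine Eventually.of_forall fun y hy i => ?_
  have : (i:ℕ) < N := by omega
  simp only [resN, this, dif_pos]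
  by_contra hc
  apply hy
  rw [thD, if_neg]
  intro h; exact hc (h.1 _)

lemma muT_mass {α : ℝ} (hα : -1 < α) {N : ℕ} (hN : 1 ≤ N) (n : ℕ) :
    muT α N n Set.univ = (N.factorial : ℝ≥0∞) / ((N - n).factorial : ℝ≥0∞) := by
  have h := (mix_detK hα hN one_pos).1
  rw [muT, Measure.smul_apply, Measure.map_apply (resN_measurable N n) MeasurableSet.univ, Set.preimage_univ, smul_eq_mul,
    ENNReal.div_mul_cancel h.1 h.2]

/-- exponential change of variables -/
lemma exp_cov {n : ℕ} {c m : ℝ} (hc : 0 < c) (hm : 0 < m) (G : (Fin n → ℝ) → ℝ≥0∞) :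
    ∫⁻ t in {t : Fin n → ℝ | ∀ i, 0 < t i}, G t =
      ∫⁻ τ : Fin n → ℝ, ENNReal.ofReal (∏ i, (c / m) * Real.exp (τ i / m)) * G (fun i => c * Real.exp (τ i / m)) := by
  have him : (fun τ : Fin n → ℝ => fun i => c * Real.exp (τ i / m)) '' Set.univ = {t | ∀ i, 0 < t i} := by
    ext t
    simp only [Set.image_univ, Set.mem_range, Set.mem_ofPred_eq]
    constructor
    · rintro ⟨τ, rfl⟩ i; positivity
    · intro ht
      refine ⟨fun i => m * Real.log (t i / c), ?_⟩
      ext i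
      have := ht i
      rw [mul_div_cancel_left₀ _ hm.ne', Real.exp_log (by positivity)]; field_simp
  rw [← him, lintegral_image_eq_lintegral_abs_det_fderiv_mul volume MeasurableSet.univ
    (f' := fun τ => ContinuousLinearMap.pi fun i => (((c / m) * Real.exp (τ i / m)) • ContinuousLinearMap.id ℝ ℝ).comp (ContinuousLinearMap.proj i))]
  · rw [setLIntegral_univ]
    refine lintegral_congr fun τ => ?_
    rw [ContinuousLinearMap.det_pi]
    have : ∀ i, (((c / m) * Real.exp (τ i / m)) • ContinuousLinearMap.id ℝ ℝ).det = (c / m) * Real.exp (τ i / m) := by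
      intro i
      simp [ContinuousLinearMap.det]
    simp_rw [this]
    rw [abs_of_pos (prod_pos fun i _ => by positivity)]
  · intro τ _
    refine HasFDerivAt.hasFDerivWithinAt ?_
    rw [hasFDerivAt_pi]
    intro i
    have h1 : HasDerivAt (fun s : ℝ => c * Real.exp (s / m)) ((c / m) * Real.exp (τ i / m)) (τ i) := by
      refine HasDerivAt.congr_deriv (f := fun g : ℝ => c * Real.exp (g / m)) (((hasDerivAt_id (τ i)).div_const m).exp.const_mul c) ?_
      simp only [id]; ring
    have h2 := h1.hasFDerivAt.comp τ (ContinuousLinearMap.proj (R := ℝ) (φ := fun _ : Fin n => ℝ) i).hasFDerivAt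
    refine h2.congr_fderiv ?_
    ext v
    simp [mul_comm]
  · intro a _ b _ hab
    ext i
    have := congrFun hab i
    simp only at this
    exact (div_left_inj' hm.ne').1 (Real.exp_injective (mul_left_cancel₀ hc.ne' this))

/-- log coordinates -/
def lgc {n : ℕ} (m x : ℝ) (t : Fin n → ℝ) : Fin n → ℝ := fun i => m * Real.log (t i / x)

lemma lgc_measurable {n : ℕ} (m x : ℝ) : Measurable (lgc m x : (Fin n → ℝ) → Fin n → ℝ) := by
  unfold lgc; fun_prop

/-- determinant of rescaled kernel -/
def dkN (α x : ℝ) (N : ℕ) {n : ℕ} (τ : Fin n → ℝ) : ℝ := Matrix.det (Matrix.of fun i j => kN α x N (τ i) (τ j))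

/-- correlation measure in log coordinates -/
def nuT (α x : ℝ) (N n : ℕ) : Measure (Fin n → ℝ) := Measure.map (lgc (N * (psiMP x * x)) x) (muT α N n)

lemma dkN_eq {α x : ℝ} (h0 : 0 < x) (h1 : x < 1) {N : ℕ} (hN : 1 ≤ N) {n : ℕ} (τ : Fin n → ℝ) :
    dkN α x N τ = (∏ i, ((4 * N * x) / (N * (psiMP x * x))) * Real.exp (τ i / (N * (psiMP x * x)))) *
      detK α N (fun i => (4 * N * x) * Real.exp (τ i / (N * (psiMP x * x)))) := by
  have hψ := (psi_eq h0 h1).1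
  have hNr : (0:ℝ) < N := by exact_mod_cast hN
  set m : ℝ := N * (psiMP x * x) with hm
  have hm0 : 0 < m := by positivity
  set d : Fin n → ℝ := fun i => Real.sqrt ((4 * N * x) / m * Real.exp (τ i / m)) with hd
  have e : (Matrix.of fun i j => kN α x N (τ i) (τ j)) = Matrix.diagonal d *
      (Matrix.of fun i j => lker α N ((4 * N * x) * Real.exp (τ i / m)) ((4 * N * x) * Real.exp (τ j / m))) * Matrix.diagonal d := by
    ext i j
    rw [Matrix.mul_diagonal, Matrix.diagonal_mul]
    simp only [Matrix.of_apply, kN, ← hm]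
    have : d i * d j = x * Real.exp ((τ i + τ j) / (2 * m)) / m * (4 * N) := by
      simp only [hd]
      rw [← Real.sqrt_mul (by positivity)]
      have : 4 * N * x / m * Real.exp (τ i / m) * (4 * N * x / m * Real.exp (τ j / m)) = (x * Real.exp ((τ i + τ j) / (2 * m)) / m * (4 * N))^2 := by
        have : Real.exp (τ i / m) * Real.exp (τ j / m) = Real.exp ((τ i + τ j) / (2 * m)) ^ 2 := by
          rw [← Real.exp_add, ← Real.exp_nat_mul]; congr 1; push_cast; field_simp
        linear_combination (4 * N * x / m)^2 * this
      rw [this, Real.sqrt_sq (by positivity)]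
    rw [← this]
    have e3 : ∀ s, 4 * (N:ℝ) * (x * Real.exp (s / m)) = 4 * N * x * Real.exp (s / m) := by intro s; ring
    rw [e3, e3]; ring
  rw [dkN, e, Matrix.det_mul, Matrix.det_mul, Matrix.det_diagonal, detK]
  have : (∏ i, d i) * (∏ i, d i) = ∏ i, (4 * N * x) / m * Real.exp (τ i / m) := by
    rw [← prod_mul_distrib]
    refine prod_congr rfl fun i _ => Real.mul_self_sqrt (by positivity)
  rw [← this]; ring

theorem mix_log {α : ℝ} (hα : -1 < α) {x : ℝ} (h0 : 0 < x) (h1 : x < 1) {N n : ℕ} (hN : 1 ≤ N) (hn : n ≤ N)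
    (h : (Fin n → ℝ) → ℝ≥0∞) (hh : Measurable h) :
    ∫⁻ τ, h τ * ENNReal.ofReal (dkN α x N τ) =
      (Smix α N (N * (psiMP x * x)))⁻¹ * ∫⁻ g : ℝ, ENNReal.ofReal (hmix α N (N * (psiMP x * x)) g) *
        ∫⁻ τ, h (fun i => τ i + g) ∂(nuT α x N n) := by
  have hψ := (psi_eq h0 h1).1
  have hNr : (0:ℝ) < N := by exact_mod_cast hN
  set m : ℝ := N * (psiMP x * x) with hm
  have hm0 : 0 < m := by positivity
  have hc : 0 < 4 * (N:ℝ) * x := by positivity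
  have h2 := (mix_detK hα hN hm0).2.2 n hn (fun t => h (lgc m (4 * N * x) t)) (hh.comp (lgc_measurable _ _))
  have hL : ∫⁻ t, h (lgc m (4 * N * x) t) * ENNReal.ofReal (detK α N t) = ∫⁻ τ, h τ * ENNReal.ofReal (dkN α x N τ) := by
    have : ∫⁻ t, h (lgc m (4 * N * x) t) * ENNReal.ofReal (detK α N t) = ∫⁻ t in {t : Fin n → ℝ | ∀ i, 0 < t i}, h (lgc m (4 * N * x) t) * ENNReal.ofReal (detK α N t) := by
      rw [← lintegral_indicator (pos_measurableSet n)]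
      refine lintegral_congr fun t => ?_
      by_cases ht : ∀ i, 0 < t i
      · rw [Set.indicator_of_mem (by exact ht)]
      · rw [Set.indicator_of_notMem (by exact ht), detK_zero' α N n t ht]; simp
    rw [this, exp_cov hc hm0]
    refine lintegral_congr fun τ => ?_
    rw [dkN_eq h0 h1 hN, ← hm, ENNReal.ofReal_mul (prod_nonneg fun i _ => by positivity)]
    have : lgc m (4 * N * x) (fun i => 4 * N * x * Real.exp (τ i / m)) = τ := by
      ext i
      simp only [lgc]
      rw [mul_div_cancel_left₀ _ hc.ne', Real.log_exp]; field_simp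
    rw [this]; ring
  rw [← hL, h2]
  congr 1
  refine lintegral_congr fun g => ?_
  congr 1
  rw [nuT, ← hm, lintegral_map (f := fun τ : Fin n → ℝ => h (fun i => τ i + g)) (hh.comp (by fun_prop)) (lgc_measurable _ _)]
  refine lintegral_congr_ae ?_
  filter_upwards [muT_pos α hn] with t ht
  congr 1
  ext i
  simp only [lgc, Pi.smul_apply, smul_eq_mul]
  have e1 : 4 * ↑N * Real.exp (g / m) * t i / (4 * ↑N * x) = Real.exp (g/m) * (t i / x) := by field_simp
  have := ht i
  rw [e1, Real.log_mul (Real.exp_ne_zero _) (by positivity), Real.log_exp]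
  field_simp
  ring

end RMT

namespace RMT
open scoped ENNReal

/-- normalized pushforward to Euclidean space -/
def nrm {n : ℕ} (μ : Measure (Fin n → ℝ)) : Measure (EuclideanSpace ℝ (Fin n)) :=
  (μ Set.univ)⁻¹ • Measure.map (MeasurableEquiv.toLp 2 (Fin n → ℝ)) μ

lemma nrm_prob {n : ℕ} (μ : Measure (Fin n → ℝ)) (h0 : μ Set.univ ≠ 0) (h1 : μ Set.univ ≠ ∞) : IsProbabilityMeasure (nrm μ) := by
  constructor
  rw [nrm, Measure.smul_apply, MeasurableEquiv.map_apply, Set.preimage_univ, smul_eq_mul, ENNReal.inv_mul_cancel h0 h1]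

lemma nrm_integral {n : ℕ} {G : Type} [NormedAddCommGroup G] [NormedSpace ℝ G] (μ : Measure (Fin n → ℝ)) (f : EuclideanSpace ℝ (Fin n) → G) :
    ∫ y, f y ∂(nrm μ) = ((μ Set.univ).toReal)⁻¹ • ∫ t, f (WithLp.toLp 2 t) ∂μ := by
  rw [nrm, integral_smul_measure, MeasurableEquiv.toLp, ENNReal.toReal_inv]
  congr 1
  exact integral_map_equiv (MeasurableEquiv.toLp 2 (Fin n → ℝ)) f

theorem levy_fin {n : ℕ} (σ : ℕ → Measure (Fin n → ℝ)) (σ₀ : Measure (Fin n → ℝ))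
    (hfin : ∀ᶠ N in atTop, σ N Set.univ ≠ ∞) (h0 : σ₀ Set.univ ≠ 0) (h1 : σ₀ Set.univ ≠ ∞)
    (hc : ∀ ξ : Fin n → ℝ, Tendsto (fun N => ∫ τ, Complex.exp (((∑ i, τ i * ξ i : ℝ) : ℂ) * Complex.I) ∂(σ N)) atTop
      (𝓝 (∫ τ, Complex.exp (((∑ i, τ i * ξ i : ℝ) : ℂ) * Complex.I) ∂σ₀)))
    (f : BoundedContinuousFunction (Fin n → ℝ) ℝ) :
    Tendsto (fun N => ∫ τ, f τ ∂(σ N)) atTop (𝓝 (∫ τ, f τ ∂σ₀)) := by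
  have hm : Tendsto (fun N => (σ N Set.univ).toReal) atTop (𝓝 (σ₀ Set.univ).toReal) := by
    have := (Complex.continuous_re.tendsto _).comp (hc 0)
    simpa [Function.comp_def, Measure.real] using this
  have hp : 0 < (σ₀ Set.univ).toReal := ENNReal.toReal_pos h0 h1
  have hgood : ∀ᶠ N in atTop, σ N Set.univ ≠ 0 ∧ σ N Set.univ ≠ ∞ := by
    filter_upwards [hfin, hm.eventually (lt_mem_nhds hp)] with N h2 h3
    refine ⟨fun h => ?_, h2⟩
    rw [h] at h3; simp at h3
  let σ' : ℕ → Measure (Fin n → ℝ) := fun N => if σ N Set.univ ≠ 0 ∧ σ N Set.univ ≠ ∞ then σ N else σ₀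
  have hσ' : ∀ N, σ' N Set.univ ≠ 0 ∧ σ' N Set.univ ≠ ∞ := by
    intro N
    simp only [σ']
    split_ifs with h
    · exact h
    · exact ⟨h0, h1⟩
  have he : ∀ᶠ N in atTop, σ' N = σ N := by
    filter_upwards [hgood] with N hN
    simp only [σ', if_pos hN]
  let P : ℕ → ProbabilityMeasure (EuclideanSpace ℝ (Fin n)) := fun N => ⟨nrm (σ' N), nrm_prob _ (hσ' N).1 (hσ' N).2⟩
  let P₀ : ProbabilityMeasure (EuclideanSpace ℝ (Fin n)) := ⟨nrm σ₀, nrm_prob _ h0 h1⟩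
  have hP : Tendsto P atTop (𝓝 P₀) := by
    refine ProbabilityMeasure.tendsto_iff_tendsto_charFun.2 fun t => ?_
    simp only [charFun_apply]
    have e : ∀ μ : Measure (Fin n → ℝ), ∫ y, Complex.exp ((inner ℝ y t : ℝ) * Complex.I) ∂(nrm μ) =
        ((μ Set.univ).toReal)⁻¹ • ∫ τ, Complex.exp (((∑ i, τ i * t i : ℝ) : ℂ) * Complex.I) ∂μ := by
      intro μ
      rw [nrm_integral]
      congr 1
      refine integral_congr_ae (Eventually.of_forall fun τ => ?_)
      simp only
      congr 3
      rw [PiLp.inner_apply]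
      simp [mul_comm]
    have h2 := (hm.inv₀ hp.ne').smul (hc t)
    show Tendsto (fun N => ∫ y, Complex.exp ((inner ℝ y t : ℝ) * Complex.I) ∂(nrm (σ' N))) atTop
      (𝓝 (∫ y, Complex.exp ((inner ℝ y t : ℝ) * Complex.I) ∂(nrm σ₀)))
    simp_rw [e]
    refine h2.congr' ?_
    filter_upwards [he] with N hN
    rw [hN]
  rw [ProbabilityMeasure.tendsto_iff_forall_integral_tendsto] at hP
  have hcomp : Continuous fun y : EuclideanSpace ℝ (Fin n) => (y : Fin n → ℝ) := by fun_prop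
  have h3 := hP (f.compContinuous ⟨fun y : EuclideanSpace ℝ (Fin n) => (y : Fin n → ℝ), hcomp⟩)
  have h4 : Tendsto (fun N => ∫ y : EuclideanSpace ℝ (Fin n), f (y : Fin n → ℝ) ∂(nrm (σ' N))) atTop
    (𝓝 (∫ y : EuclideanSpace ℝ (Fin n), f (y : Fin n → ℝ) ∂(nrm σ₀))) := h3
  simp_rw [nrm_integral] at h4
  have h5 := hm.smul h4
  rw [smul_smul, mul_inv_cancel₀ hp.ne', one_smul] at h5
  refine h5.congr' ?_
  filter_upwards [he, hgood] with N hN hg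
  rw [hN, smul_smul, mul_inv_cancel₀ (ENNReal.toReal_pos hg.1 hg.2).ne', one_smul]

/-- exponential weight -/
def ew {n : ℕ} (τ : Fin n → ℝ) : ℝ := Real.exp (-∑ i, |τ i|)

lemma ew_pos {n : ℕ} (τ : Fin n → ℝ) : 0 < ew τ := Real.exp_pos _
lemma ew_le_one {n : ℕ} (τ : Fin n → ℝ) : ew τ ≤ 1 := by
  unfold ew; rw [Real.exp_le_one_iff]; simp only [neg_nonpos]; exact sum_nonneg fun i _ => abs_nonneg _
lemma ew_continuous {n : ℕ} : Continuous (ew : (Fin n → ℝ) → ℝ) := by unfold ew; fun_prop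
lemma expabs_integrable : Integrable (fun s : ℝ => Real.exp (-|s|)) := by
  refine not_imp_comm.1 integral_undef ?_
  rw [integral_comp_abs (f := fun x => Real.exp (-x)), integral_exp_neg_Ioi_zero]; norm_num
lemma ew_integrable {n : ℕ} : Integrable (ew : (Fin n → ℝ) → ℝ) := by
  have h := expabs_integrable
  have := Integrable.fintype_prod (ι := Fin n) (f := fun _ => fun s : ℝ => Real.exp (-|s|)) (μ := fun _ => volume) (fun _ => h)
  have e : (ew : (Fin n → ℝ) → ℝ) = fun x => ∏ i, Real.exp (-|x i|) := by
    ext x; rw [ew, ← sum_neg_distrib, Real.exp_sum]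
  rw [e]; exact this

lemma ew_shift {n : ℕ} (τ : Fin n → ℝ) (g : ℝ) : ew (fun i => τ i + g) ≤ Real.exp (n * |g|) * ew τ := by
  unfold ew
  rw [← Real.exp_add, Real.exp_le_exp]
  have : ∑ i, |τ i| ≤ ∑ i, (|τ i + g| + |g|) := sum_le_sum fun i _ => by
    have := abs_add_le (τ i + g) (-g); simpa using this
  rw [sum_add_distrib] at this
  simp at this
  linarith

lemma ew_shift' {n : ℕ} (τ : Fin n → ℝ) (g : ℝ) : Real.exp (-(n * |g|)) * ew τ ≤ ew (fun i => τ i + g) := by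
  unfold ew
  rw [← Real.exp_add, Real.exp_le_exp]
  have : ∑ i, |τ i + g| ≤ ∑ i, (|τ i| + |g|) := sum_le_sum fun i _ => abs_add_le _ _
  rw [sum_add_distrib] at this
  simp at this
  linarith

end RMT

namespace RMT
open scoped ENNReal

lemma exp_quad_lower {s y : ℝ} (hs : -1 < s) : s * y - s ^ 2 ≤ Real.exp y - 1 - y := by
  have h1 : (1 + s) * (1 + y - s) ≤ Real.exp y := by
    have h2 := Real.add_one_le_exp (y - Real.log (1 + s))
    rw [Real.exp_sub, Real.exp_log (by linarith), le_div_iff₀ (by linarith)] at h2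
    have h3 := Real.log_le_sub_one_of_pos (show 0 < 1 + s by linarith)
    nlinarith
  nlinarith

lemma hmix_bound (α : ℝ) {c : ℝ} (hc : 0 < c) {A : ℝ} (hA : 0 ≤ A) :
    ∃ B : ℝ, 0 < B ∧ ∀ᶠ N : ℕ in atTop, ∀ g, hmix α N (N * c) g ≤ B * Real.exp (-(A * |g|)) := by
  refine ⟨Real.exp ((A + 1)^2 * (2 * c ^ 2)), Real.exp_pos _, ?_⟩
  filter_upwards [eventually_ge_atTop 1, eventually_ge_atTop (⌈2 * |α|⌉₊), eventually_ge_atTop (⌈1 / c⌉₊), eventually_gt_atTop (⌈2 * ((A + 1) * c)⌉₊)] with N h1 h2 h3 h4 g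
  have h1' : (1:ℝ) ≤ N := by exact_mod_cast h1
  have h2' : 2 * |α| ≤ N := Nat.ceil_le.1 h2
  have h3' : 1 / c ≤ N := Nat.ceil_le.1 h3
  have h4' : 2 * ((A + 1) * c) < N := Nat.lt_of_ceil_lt h4
  have h5 : (N:ℝ) / 2 ≤ N + α := by have := neg_abs_le α; linarith
  have hNα : 0 < (N:ℝ) + α := by linarith
  have hm1 : 1 ≤ N * c := by rw [div_le_iff₀ hc] at h3'; linarith
  have hm0 : 0 < N * c := by linarith
  set m := N * c with hm
  have hs : (A + 1) * c / (N + α) < 1 := by rw [div_lt_one hNα]; linarith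
  have hs0 : 0 ≤ (A + 1) * c / (N + α) := by positivity
  have key : (A + 1) * |g| - (A+1)^2 * (2 * c^2) ≤ N * (N + α) * (Real.exp (g / m) - 1 - g / m) := by
    set s0 := (A + 1) * c / (N + α) with hs0d
    have k0 : N * (N + α) * s0 ^ 2 ≤ (A+1)^2 * (2 * c^2) := by
      rw [hs0d, div_pow]
      have : N * (N + α) * (((A + 1) * c) ^ 2 / (N + α) ^ 2) = (A+1)^2 * c^2 * (N / (N + α)) := by field_simp
      rw [this]
      have h6 : N / (N + α) ≤ 2 := by rw [div_le_iff₀ hNα]; linarith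
      have : 0 ≤ (A+1)^2 * c^2 := by positivity
      nlinarith
    have k1 : N * (N + α) * (s0 * (g / m)) = (A + 1) * g := by rw [hs0d, hm]; field_simp
    have hMp : 0 ≤ N * (N + α) := by positivity
    rcases le_total 0 g with hg | hg
    · have := mul_le_mul_of_nonneg_left (exp_quad_lower (y := g / m) (show -1 < s0 by linarith)) hMp
      rw [mul_sub, k1] at this
      rw [abs_of_nonneg hg]; linarith
    · have := mul_le_mul_of_nonneg_left (exp_quad_lower (y := g / m) (show -1 < -s0 by linarith)) hMp
      rw [mul_sub, neg_mul, mul_neg, k1, neg_sq] at this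
      rw [abs_of_nonpos hg]; linarith
  have hg1 : g / m ≤ |g| := by
    calc g / m ≤ |g| / m := by gcongr; exact le_abs_self g
      _ ≤ |g| := div_le_self (abs_nonneg g) hm1
  unfold hmix
  rw [← Real.exp_add, Real.exp_le_exp]
  nlinarith

lemma hmix_lim (α : ℝ) {c : ℝ} (hc : 0 < c) (g : ℝ) :
    Tendsto (fun N : ℕ => hmix α N (N * c) g) atTop (𝓝 (Real.exp (-(g^2 / (2 * c^2))))) := by
  unfold hmix
  refine (Real.continuous_exp.tendsto _).comp ?_
  have t0 : Tendsto (fun N : ℕ => g / (N * c)) atTop (𝓝 0) := by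
    refine Tendsto.div_atTop tendsto_const_nhds ?_
    exact Tendsto.atTop_mul_const hc tendsto_natCast_atTop_atTop
  have t1 : Tendsto (fun N : ℕ => ((N:ℝ) + α) / N) atTop (𝓝 1) := by
    have : Tendsto (fun N : ℕ => 1 + α / (N:ℝ)) atTop (𝓝 (1 + 0)) := tendsto_const_nhds.add (tendsto_const_div_atTop_nhds_zero_nat α)
    rw [add_zero] at this
    refine this.congr' ?_
    filter_upwards [eventually_ge_atTop 1] with N hN
    have : (N:ℝ) ≠ 0 := by positivity
    field_simp
  -- M y^2 = (g/c)^2 (N+α)/N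
  have t2 : Tendsto (fun N : ℕ => (g / c)^2 * (((N:ℝ) + α) / N)) atTop (𝓝 ((g/c)^2 * 1)) := tendsto_const_nhds.mul t1
  have t3 : Tendsto (fun N : ℕ => N * (N + α) * (Real.exp (g / (N * c)) - 1 - g / (N * c))) atTop (𝓝 (g^2 / (2 * c^2))) := by
    have t4 : Tendsto (fun N : ℕ => N * (N + α) * (Real.exp (g / (N * c)) - 1 - g / (N * c)) - (g / c)^2 * (((N:ℝ) + α) / N) / 2) atTop (𝓝 0) := by
      have t5 : Tendsto (fun N : ℕ => |(g / c)^2 * (((N:ℝ) + α) / N)| * |g / (N * c)|) atTop (𝓝 (|(g/c)^2 * 1| * |0|)) := t2.abs.mul t0.abs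
      rw [abs_zero, mul_zero] at t5
      refine squeeze_zero_norm' ?_ t5
      filter_upwards [eventually_ge_atTop 1, (t0.abs).eventually (gt_mem_nhds (show |(0:ℝ)| < 1 by simp))] with N hN h1
      have hN0 : (N:ℝ) ≠ 0 := by positivity
      have hb := Real.exp_bound h1.le (n := 3) (by norm_num)
      set y := g / (N * c) with hy
      have e1 : (g / c)^2 * (((N:ℝ) + α) / N) = N * (N + α) * y^2 := by rw [hy]; field_simp
      have e2 : N * (N + α) * (Real.exp y - 1 - y) - N * (N + α) * y^2 / 2 = N * (N+α) * (Real.exp y - ∑ k ∈ range 3, y^k / (k.factorial : ℝ)) := by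
        simp [sum_range_succ, Nat.factorial]; ring
      rw [e1, e2, Real.norm_eq_abs, abs_mul (↑N * (↑N + α)), abs_mul (↑N * (↑N + α)), abs_pow, mul_assoc]
      refine mul_le_mul_of_nonneg_left (hb.trans ?_) (abs_nonneg _)
      have : |y|^2 * |y| = |y|^3 := by ring
      rw [this]
      have h3 : 0 ≤ |y|^3 := by positivity
      norm_num [Nat.factorial]
      nlinarith
    have := t4.add (t2.div_const 2)
    refine (this.congr fun N => ?_).trans (le_of_eq ?_)
    · ring
    · congr 1; field_simp; ring
  have := t0.sub t3
  rw [zero_sub] at this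
  exact this

/-- Gaussian -/
def gau (c g : ℝ) : ℝ := Real.exp (-(g^2 / (2 * c^2)))
/-- normalized mixing density -/
def pmix (α c : ℝ) (N : ℕ) (g : ℝ) : ℝ := hmix α N (N * c) g / ∫ s, hmix α N (N * c) s
/-- normalized Gaussian -/
def pgau (c g : ℝ) : ℝ := gau c g / ∫ s, gau c s

lemma hmix_pos (α : ℝ) (N : ℕ) (m g : ℝ) : 0 < hmix α N m g := Real.exp_pos _

lemma gau_bound {c : ℝ} (hc : 0 < c) {A : ℝ} (hA : 0 ≤ A) : ∃ B : ℝ, 0 < B ∧ ∀ g, gau c g ≤ B * Real.exp (-(A * |g|)) := by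
  obtain ⟨B, hB, h⟩ := hmix_bound 0 hc hA
  refine ⟨B, hB, fun g => ?_⟩
  refine le_of_tendsto (hmix_lim 0 hc g) ?_
  filter_upwards [h] with N hN using hN g

lemma gau_pos (c g : ℝ) : 0 < gau c g := Real.exp_pos _

lemma gau_continuous (c : ℝ) : Continuous (gau c) := by unfold gau; fun_prop

lemma exp_combine (n : ℕ) (g : ℝ) : Real.exp (-((n + 1 : ℝ) * |g|)) * Real.exp (n * |g|) = Real.exp (-|g|) := by
  rw [← Real.exp_add]; congr 1; ring

lemma hmix_exp_integrable (α : ℝ) {c : ℝ} (hc : 0 < c) (n : ℕ) :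
    ∀ᶠ N : ℕ in atTop, Integrable fun g => hmix α N (N * c) g * Real.exp (n * |g|) := by
  obtain ⟨B, hB, h⟩ := hmix_bound α hc (show (0:ℝ) ≤ n + 1 by positivity)
  filter_upwards [h] with N hN
  refine (expabs_integrable.const_mul B).mono' ?_ (Eventually.of_forall fun g => ?_)
  · exact Continuous.aestronglyMeasurable ((hmix_continuous α N _).mul (by fun_prop))
  · rw [Real.norm_of_nonneg (mul_nonneg (hmix_pos _ _ _ _).le (Real.exp_pos _).le), ← exp_combine n, ← mul_assoc]
    exact mul_le_mul_of_nonneg_right (hN g) (Real.exp_pos _).le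

lemma gau_exp_integrable {c : ℝ} (hc : 0 < c) (n : ℕ) : Integrable fun g => gau c g * Real.exp (n * |g|) := by
  obtain ⟨B, hB, h⟩ := gau_bound hc (show (0:ℝ) ≤ n + 1 by positivity)
  refine (expabs_integrable.const_mul B).mono' ?_ (Eventually.of_forall fun g => ?_)
  · exact Continuous.aestronglyMeasurable ((gau_continuous c).mul (by fun_prop))
  · rw [Real.norm_of_nonneg (mul_nonneg (gau_pos c g).le (Real.exp_pos _).le), ← exp_combine n, ← mul_assoc]
    exact mul_le_mul_of_nonneg_right (h g) (Real.exp_pos _).le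

lemma gau_integral_pos {c : ℝ} (hc : 0 < c) : 0 < ∫ s, gau c s := by
  have h := gau_exp_integrable hc 0
  simp only [Nat.cast_zero, zero_mul, Real.exp_zero, mul_one] at h
  exact integral_exp_pos h

lemma hmix_mass_lim (α : ℝ) {c : ℝ} (hc : 0 < c) :
    Tendsto (fun N : ℕ => ∫ s, hmix α N (N * c) s) atTop (𝓝 (∫ s, gau c s)) := by
  obtain ⟨B, hB, h⟩ := hmix_bound α hc (show (0:ℝ) ≤ 1 by positivity)
  refine tendsto_integral_filter_of_dominated_convergence (fun g => B * Real.exp (-|g|)) ?_ ?_ (expabs_integrable.const_mul B) ?_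
  · exact Eventually.of_forall fun N => (hmix_continuous α N _).aestronglyMeasurable
  · filter_upwards [h] with N hN
    refine Eventually.of_forall fun g => ?_
    rw [Real.norm_of_nonneg (hmix_pos _ _ _ _).le]
    simpa using hN g
  · exact Eventually.of_forall fun g => hmix_lim α hc g

lemma pmix_conv (α : ℝ) {c : ℝ} (hc : 0 < c) (n : ℕ) :
    Tendsto (fun N : ℕ => ∫ g, |pmix α c N g - pgau c g| * Real.exp (n * |g|)) atTop (𝓝 0) := by
  obtain ⟨B, hB, h⟩ := hmix_bound α hc (show (0:ℝ) ≤ n + 1 by positivity)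
  obtain ⟨B', hB', h'⟩ := gau_bound hc (show (0:ℝ) ≤ n + 1 by positivity)
  set Z := ∫ s, gau c s with hZ
  have hZ0 : 0 < Z := gau_integral_pos hc
  have hlim := hmix_mass_lim α hc
  have : Tendsto (fun N : ℕ => ∫ g, |pmix α c N g - pgau c g| * Real.exp (n * |g|)) atTop (𝓝 (∫ g : ℝ, (0:ℝ))) := by
    refine tendsto_integral_filter_of_dominated_convergence (fun g => (B / (Z/2) + B' / Z) * Real.exp (-|g|)) ?_ ?_ (expabs_integrable.const_mul _) ?_
    · refine Eventually.of_forall fun N => Continuous.aestronglyMeasurable ?_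
      have h1 : Continuous (pmix α c N) := (hmix_continuous α N _).div_const _
      have h2 : Continuous (pgau c) := (gau_continuous c).div_const _
      fun_prop
    · filter_upwards [h, hlim.eventually (lt_mem_nhds (half_lt_self hZ0))] with N hN hS
      refine Eventually.of_forall fun g => ?_
      rw [Real.norm_of_nonneg (by positivity), ← exp_combine n, ← mul_assoc]
      refine mul_le_mul_of_nonneg_right ?_ (Real.exp_pos _).le
      have hSp : 0 < ∫ s, hmix α N (N * c) s := lt_trans (by positivity) hS
      have e1 : |pmix α c N g| ≤ B / (Z/2) * Real.exp (-((n + 1 : ℝ) * |g|)) := by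
        rw [pmix, abs_of_nonneg (div_nonneg (hmix_pos _ _ _ _).le hSp.le), div_mul_eq_mul_div]
        exact div_le_div₀ (by positivity) (hN g) (by positivity) hS.le
      have e2 : |pgau c g| ≤ B' / Z * Real.exp (-((n + 1 : ℝ) * |g|)) := by
        rw [pgau, ← hZ, abs_of_nonneg (div_nonneg (gau_pos c g).le hZ0.le), div_mul_eq_mul_div]
        exact div_le_div_of_nonneg_right (h' g) hZ0.le
      calc _ ≤ |pmix α c N g| + |pgau c g| := abs_sub _ _
        _ ≤ _ := by rw [add_mul]; linarith
    · refine Eventually.of_forall fun g => ?_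
      have h1 : Tendsto (fun N : ℕ => pmix α c N g) atTop (𝓝 (pgau c g)) := (hmix_lim α hc g).div hlim hZ0.ne'
      have h2 := ((h1.sub_const (pgau c g)).abs).mul_const (Real.exp (n * |g|))
      simpa using h2
  simpa using this

/-- sine determinant -/
def dS {n : ℕ} (τ : Fin n → ℝ) : ℝ := Matrix.det (Matrix.of fun i j => Ksin (τ i) (τ j))

lemma dkN_lim {α : ℝ} (hα : -1 < α) {x : ℝ} (h0 : 0 < x) (h1 : x < 1) {n : ℕ} (τ : Fin n → ℝ) :
    Tendsto (fun N => dkN α x N τ) atTop (𝓝 (dS τ)) := by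
  unfold dkN dS
  simp only [Matrix.det_apply, Matrix.of_apply]
  refine tendsto_finsetSum _ fun σ _ => ?_
  refine Tendsto.const_smul ?_ _
  exact tendsto_finsetProd _ fun i _ => kN_lim hα h0 h1 _ _

lemma det_bound {n : ℕ} (M : Fin n → Fin n → ℝ) {B : ℝ} (h : ∀ i j, |M i j| ≤ B) :
    |Matrix.det (Matrix.of M)| ≤ n.factorial * B ^ n := by
  have := Matrix.det_le (A := Matrix.of M) (abv := AbsoluteValue.abs) (x := B) (fun i j => h i j)
  simpa using this

lemma kN_measurable (α x : ℝ) (N : ℕ) : Measurable (fun p : ℝ × ℝ => kN α x N p.1 p.2) := by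
  unfold kN
  refine Measurable.mul (by fun_prop) ?_
  have h : Measurable (fun p : ℝ × ℝ => (4*N*(x*Real.exp (p.1/(N*(psiMP x*x)))), 4*N*(x*Real.exp (p.2/(N*(psiMP x*x)))))) := by fun_prop
  exact (lker_measurable α N).comp h

lemma dkN_measurable (α x : ℝ) (N n : ℕ) : Measurable (fun τ : Fin n → ℝ => dkN α x N τ) := by
  unfold dkN
  refine measurable_det_of _ fun i j => ?_
  have h : Measurable (fun x : Fin n → ℝ => (x i, x j)) := by fun_prop
  exact (kN_measurable α x N).comp h

lemma dkN_nonneg (α : ℝ) {x : ℝ} (h0 : 0 < x) (h1 : x < 1) {N : ℕ} (hN : 1 ≤ N) {n : ℕ} (τ : Fin n → ℝ) : 0 ≤ dkN α x N τ := by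
  have hψ := (psi_eq h0 h1).1
  rw [dkN_eq h0 h1 hN]
  exact mul_nonneg (prod_nonneg fun i _ => by positivity) (detK_nonneg _ _ _)

lemma nuT_mass {α : ℝ} (hα : -1 < α) (x : ℝ) {N : ℕ} (hN : 1 ≤ N) (n : ℕ) :
    nuT α x N n Set.univ = (N.factorial : ℝ≥0∞) / ((N - n).factorial : ℝ≥0∞) := by
  rw [nuT, Measure.map_apply (lgc_measurable _ _) MeasurableSet.univ, Set.preimage_univ, muT_mass hα hN]

lemma nuT_mass_le {α : ℝ} (hα : -1 < α) (x : ℝ) {N : ℕ} (hN : 1 ≤ N) {n : ℕ} (hn : n ≤ N) :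
    nuT α x N n Set.univ ≤ (N : ℝ≥0∞) ^ n := by
  rw [nuT_mass hα x hN]
  refine ENNReal.div_le_of_le_mul ?_
  rw [mul_comm]
  have h : N.factorial ≤ (N - n).factorial * N ^ n := by
    rw [← Nat.factorial_mul_descFactorial hn]
    exact Nat.mul_le_mul_left _ (Nat.descFactorial_le_pow N n)
  exact_mod_cast h

lemma dkN_mass {α : ℝ} (hα : -1 < α) {x : ℝ} (h0 : 0 < x) (h1 : x < 1) {N n : ℕ} (hN : 1 ≤ N) (hn : n ≤ N) :
    ∫⁻ τ : Fin n → ℝ, ENNReal.ofReal (dkN α x N τ) ≤ (N : ℝ≥0∞)^n := by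
  have hψ := (psi_eq h0 h1).1
  have hNr : (0:ℝ) < N := by exact_mod_cast hN
  have := mix_log hα h0 h1 hN hn (fun _ => 1) measurable_const
  simp only [one_mul, lintegral_const] at this
  rw [lintegral_mul_const _ (hmix_continuous α N _).measurable.ennreal_ofReal] at this
  have hS := (mix_detK hα hN (show 0 < N * (psiMP x * x) by positivity)).2.1
  rw [this, ← Smix, ← mul_assoc, ENNReal.inv_mul_cancel hS.1 hS.2, one_mul]
  exact nuT_mass_le hα x hN hn

end RMT

namespace RMT
open scoped ENNReal

lemma dkN_integrable {α : ℝ} (hα : -1 < α) {x : ℝ} (h0 : 0 < x) (h1 : x < 1) {N n : ℕ} (hN : 1 ≤ N) (hn : n ≤ N) :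
    Integrable (fun τ : Fin n → ℝ => dkN α x N τ) := by
  refine ⟨(dkN_measurable α x N n).aestronglyMeasurable, ?_⟩
  rw [hasFiniteIntegral_iff_ofReal (Eventually.of_forall fun τ => dkN_nonneg α h0 h1 hN τ)]
  exact lt_of_le_of_lt (dkN_mass hα h0 h1 hN hn) (ENNReal.pow_lt_top (ENNReal.natCast_lt_top N))

lemma dkN_integral_le {α : ℝ} (hα : -1 < α) {x : ℝ} (h0 : 0 < x) (h1 : x < 1) {N n : ℕ} (hN : 1 ≤ N) (hn : n ≤ N) :
    ∫ τ : Fin n → ℝ, dkN α x N τ ≤ (N:ℝ)^n := by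
  rw [integral_eq_lintegral_of_nonneg_ae (Eventually.of_forall fun τ => dkN_nonneg α h0 h1 hN τ) (dkN_measurable α x N n).aestronglyMeasurable]
  refine ENNReal.toReal_le_of_le_ofReal (by positivity) ?_
  refine (dkN_mass hα h0 h1 hN hn).trans ?_
  rw [ENNReal.ofReal_pow (by positivity), ENNReal.ofReal_natCast]

lemma dkF_integrable {α : ℝ} (hα : -1 < α) {x : ℝ} (h0 : 0 < x) (h1 : x < 1) {N n : ℕ} (hN : 1 ≤ N) (hn : n ≤ N)
    (F : (Fin n → ℝ) → ℂ) (hF : Measurable F) {C : ℝ} (hC : 0 ≤ C) (hb : ∀ τ, ‖F τ‖ ≤ C * ew τ) :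
    Integrable (fun τ => F τ * (dkN α x N τ : ℂ)) := by
  refine ((dkN_integrable hα h0 h1 hN hn).const_mul C).mono' ?_ (Eventually.of_forall fun τ => ?_)
  · exact (hF.mul (Complex.measurable_ofReal.comp (dkN_measurable α x N n))).aestronglyMeasurable
  · have h2 := dkN_nonneg α h0 h1 hN τ
    rw [norm_mul, Complex.norm_real, Real.norm_of_nonneg h2]
    refine mul_le_mul_of_nonneg_right ((hb τ).trans ?_) h2
    exact mul_le_of_le_one_right hC (ew_le_one τ)

set_option maxHeartbeats 1000000 in
/-- convergence of correlation functionals of the Laguerre ensemble in log coordinates -/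
theorem conv_dk {α : ℝ} (hα : -1 < α) {x : ℝ} (h0 : 0 < x) (h1 : x < 1) {n : ℕ}
    (F : (Fin n → ℝ) → ℂ) (hF : Measurable F) {C : ℝ} (hC : 0 ≤ C) (hb : ∀ τ, ‖F τ‖ ≤ C * ew τ) :
    Tendsto (fun N => ∫ τ, F τ * (dkN α x N τ : ℂ)) atTop (𝓝 (∫ τ, F τ * (dS τ : ℂ))) := by
  obtain ⟨δ, B, hδ, hB, hbd⟩ := kN_bound hα h0 h1
  have hψ := (psi_eq h0 h1).1
  set c := psiMP x * x with hc
  have hc0 : 0 < c := mul_pos hψ h0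
  set A : ℕ → Set (Fin n → ℝ) := fun N => {τ | ∀ i, |τ i| ≤ δ * (N * c)} with hA
  have hAm : ∀ N, MeasurableSet (A N) := by
    intro N
    rw [hA]
    simp only [Set.ofPred_forall]
    exact MeasurableSet.iInter fun i => measurableSet_le (by fun_prop) measurable_const
  have p1 : Tendsto (fun N => ∫ τ, (A N).indicator (fun τ => F τ * (dkN α x N τ : ℂ)) τ) atTop (𝓝 (∫ τ, F τ * (dS τ : ℂ))) := by
    refine tendsto_integral_filter_of_dominated_convergence (fun τ => (C * (n.factorial * B ^ n)) * ew τ) ?_ ?_ (ew_integrable.const_mul _) ?_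
    · exact Eventually.of_forall fun N => ((hF.mul (Complex.measurable_ofReal.comp (dkN_measurable α x N n))).indicator (hAm N)).aestronglyMeasurable
    · filter_upwards [hbd] with N hN
      refine Eventually.of_forall fun τ => ?_
      by_cases hτ : τ ∈ A N
      · rw [Set.indicator_of_mem hτ, norm_mul, Complex.norm_real]
        have := det_bound (fun i j => kN α x N (τ i) (τ j)) (B := B) fun i j => hN _ _ (hτ i) (hτ j)
        calc _ ≤ (C * ew τ) * (n.factorial * B ^ n) := mul_le_mul (hb τ) this (abs_nonneg _) (mul_nonneg hC (ew_pos τ).le)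
          _ = _ := by ring
      · rw [Set.indicator_of_notMem hτ, norm_zero]
        have := ew_pos τ
        positivity
    · refine Eventually.of_forall fun τ => ?_
      have h2 : Tendsto (fun N => F τ * (dkN α x N τ : ℂ)) atTop (𝓝 (F τ * (dS τ : ℂ))) :=
        ((Complex.continuous_ofReal.tendsto _).comp (dkN_lim hα h0 h1 τ)).const_mul _
      refine h2.congr' ?_
      have h3 : ∀ i, ∀ᶠ N : ℕ in atTop, |τ i| ≤ δ * (N * c) := fun i => by
        have : Tendsto (fun N : ℕ => δ * (N * c)) atTop atTop :=
          (tendsto_natCast_atTop_atTop.atTop_mul_const hc0).const_mul_atTop hδ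
        exact this.eventually_ge_atTop _
      filter_upwards [eventually_all.2 h3] with N hN
      rw [Set.indicator_of_mem (show τ ∈ A N from hN)]
  have p2 : Tendsto (fun N => ∫ τ, (A N)ᶜ.indicator (fun τ => F τ * (dkN α x N τ : ℂ)) τ) atTop (𝓝 0) := by
    have hl : Tendsto (fun N : ℕ => C * ((N:ℝ)^n * Real.exp (-(δ * c) * N))) atTop (𝓝 0) := by
      have := (tendsto_rpow_mul_exp_neg_mul_atTop_nhds_zero n (δ * c) (by positivity)).comp (tendsto_natCast_atTop_atTop (R := ℝ))
      simpa using this.const_mul C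
    refine squeeze_zero_norm' ?_ hl
    filter_upwards [eventually_ge_atTop 1, eventually_ge_atTop n] with N hN hn
    have hdi := dkN_integrable hα h0 h1 hN hn
    calc _ ≤ ∫ τ, (C * Real.exp (-(δ * c) * N)) * dkN α x N τ := by
          refine norm_integral_le_of_norm_le (hdi.const_mul _) (Eventually.of_forall fun τ => ?_)
          have h2 := dkN_nonneg α h0 h1 hN τ
          by_cases hτ : τ ∈ (A N)ᶜ
          · rw [Set.indicator_of_mem hτ, norm_mul, Complex.norm_real, Real.norm_of_nonneg h2]
            refine mul_le_mul_of_nonneg_right ((hb τ).trans (mul_le_mul_of_nonneg_left ?_ hC)) h2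
            have : ¬ ∀ i, |τ i| ≤ δ * (N * c) := hτ
            push Not at this
            obtain ⟨i, hi⟩ := this
            unfold ew
            rw [Real.exp_le_exp]
            have := single_le_sum (f := fun i => |τ i|) (fun i _ => abs_nonneg _) (mem_univ i)
            nlinarith
          · rw [Set.indicator_of_notMem hτ, norm_zero]
            positivity
      _ ≤ _ := by
          rw [integral_const_mul]
          have := dkN_integral_le hα h0 h1 hN hn
          calc _ ≤ (C * Real.exp (-(δ * c) * N)) * (N:ℝ)^n := mul_le_mul_of_nonneg_left this (by positivity)
            _ = _ := by ring
  have := p1.add p2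
  rw [add_zero] at this
  refine this.congr' ?_
  filter_upwards [eventually_ge_atTop 1, eventually_ge_atTop n] with N hN hn
  have hI := dkF_integrable hα h0 h1 hN hn F hF hC hb
  rw [← integral_add (hI.indicator (hAm N)) (hI.indicator (hAm N).compl)]
  refine integral_congr_ae (Eventually.of_forall fun τ => ?_)
  have := congrFun (Set.indicator_self_add_compl (A N) (fun τ => F τ * (dkN α x N τ : ℂ))) τ
  simpa using this

lemma nuT_finite {α : ℝ} (hα : -1 < α) (x : ℝ) {N n : ℕ} (hN : 1 ≤ N) (hn : n ≤ N) : IsFiniteMeasure (nuT α x N n) :=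
  ⟨lt_of_le_of_lt (nuT_mass_le hα x hN hn) (ENNReal.pow_lt_top (ENNReal.natCast_lt_top N))⟩

/-- the mixing probability measure -/
def Pm (α c : ℝ) (N : ℕ) : Measure ℝ := (Smix α N (N * c))⁻¹ • volume.withDensity fun g => ENNReal.ofReal (hmix α N (N * c) g)

lemma Pm_prob {α : ℝ} (hα : -1 < α) {c : ℝ} (hc : 0 < c) {N : ℕ} (hN : 1 ≤ N) : IsProbabilityMeasure (Pm α c N) := by
  have hNr : (0:ℝ) < N := by exact_mod_cast hN
  have hS := (mix_detK hα hN (show 0 < N * c by positivity)).2.1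
  constructor
  rw [Pm, Measure.smul_apply, withDensity_apply _ MeasurableSet.univ, setLIntegral_univ, ← Smix, smul_eq_mul, ENNReal.inv_mul_cancel hS.1 hS.2]

lemma Pm_lint (α c : ℝ) (N : ℕ) (h : ℝ → ℝ≥0∞) (hh : Measurable h) :
    ∫⁻ g, h g ∂(Pm α c N) = (Smix α N (N * c))⁻¹ * ∫⁻ g, ENNReal.ofReal (hmix α N (N * c) g) * h g := by
  rw [Pm, lintegral_smul_measure, smul_eq_mul, lintegral_withDensity_eq_lintegral_mul _ (hmix_continuous α N _).measurable.ennreal_ofReal hh]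
  rfl

lemma Pm_integral (α c : ℝ) (N : ℕ) (h : ℝ → ℂ) :
    ∫ g, h g ∂(Pm α c N) = ∫ g, (pmix α c N g : ℂ) * h g := by
  have hZ : (Smix α N (N * c))⁻¹.toReal = (∫ s, hmix α N (N * c) s)⁻¹ := by
    rw [Smix, ENNReal.toReal_inv, integral_eq_lintegral_of_nonneg_ae (Eventually.of_forall fun g => (hmix_pos _ _ _ _).le) (hmix_continuous α N _).aestronglyMeasurable]
  rw [Pm, integral_smul_measure, hZ,
    integral_withDensity_eq_integral_toReal_smul (hmix_continuous α N _).measurable.ennreal_ofReal (Eventually.of_forall fun _ => ENNReal.ofReal_lt_top), ← integral_smul]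
  refine integral_congr_ae (Eventually.of_forall fun g => ?_)
  simp only [ENNReal.toReal_ofReal (hmix_pos α N _ g).le, Complex.real_smul, pmix]
  push_cast
  ring

lemma dk_measure {α : ℝ} (hα : -1 < α) {x : ℝ} (h0 : 0 < x) (h1 : x < 1) {N n : ℕ} (hN : 1 ≤ N) (hn : n ≤ N) :
    volume.withDensity (fun τ : Fin n → ℝ => ENNReal.ofReal (dkN α x N τ)) =
      Measure.map (fun p : ℝ × (Fin n → ℝ) => fun i => p.2 i + p.1) ((Pm α (psiMP x * x) N).prod (nuT α x N n)) := by
  have := nuT_finite hα x hN hn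
  have := Pm_prob hα (mul_pos (psi_eq h0 h1).1 h0) hN
  have hm : Measurable (fun p : ℝ × (Fin n → ℝ) => fun i => p.2 i + p.1) := by fun_prop
  refine Measure.ext_of_lintegral _ fun h hh => ?_
  have e1 := mix_log hα h0 h1 hN hn h hh
  have hm2 : Measurable fun p : ℝ × (Fin n → ℝ) => h (fun i => p.2 i + p.1) := hh.comp hm
  rw [lintegral_map hh hm, lintegral_prod _ hm2.aemeasurable, Pm_lint _ _ _ _ hm2.lintegral_prod_right', ← e1,
    lintegral_withDensity_eq_lintegral_mul _ (dkN_measurable α x N n).ennreal_ofReal hh]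
  refine lintegral_congr fun τ => ?_
  simp [mul_comm]

/-- deconvolution identity -/
lemma dk_conv {α : ℝ} (hα : -1 < α) {x : ℝ} (h0 : 0 < x) (h1 : x < 1) {N n : ℕ} (hN : 1 ≤ N) (hn : n ≤ N)
    (F : (Fin n → ℝ) → ℂ) (hF : Measurable F) {C : ℝ} (hC : 0 ≤ C) (hb : ∀ τ, ‖F τ‖ ≤ C * ew τ) :
    ∫ τ, F τ * (dkN α x N τ : ℂ) = ∫ τ, (∫ g, (pmix α (psiMP x * x) N g : ℂ) * F (fun i => τ i + g)) ∂(nuT α x N n) := by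
  have := nuT_finite hα x hN hn
  have := Pm_prob hα (mul_pos (psi_eq h0 h1).1 h0) hN
  have hm : Measurable (fun p : ℝ × (Fin n → ℝ) => fun i => p.2 i + p.1) := by fun_prop
  have e1 : ∫ τ, F τ * (dkN α x N τ : ℂ) = ∫ τ, F τ ∂(volume.withDensity (fun τ : Fin n → ℝ => ENNReal.ofReal (dkN α x N τ))) := by
    rw [integral_withDensity_eq_integral_toReal_smul (dkN_measurable α x N n).ennreal_ofReal (Eventually.of_forall fun _ => ENNReal.ofReal_lt_top)]
    refine integral_congr_ae (Eventually.of_forall fun τ => ?_)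
    simp only [ENNReal.toReal_ofReal (dkN_nonneg α h0 h1 hN τ), Complex.real_smul, mul_comm]
  have hI : Integrable (fun p : ℝ × (Fin n → ℝ) => F (fun i => p.2 i + p.1)) ((Pm α (psiMP x * x) N).prod (nuT α x N n)) := by
    refine Integrable.of_bound (hF.comp hm).aestronglyMeasurable C (Eventually.of_forall fun p => (hb _).trans (mul_le_of_le_one_right hC (ew_le_one _)))
  rw [e1, dk_measure hα h0 h1 hN hn, integral_map hm.aemeasurable hF.aestronglyMeasurable, integral_prod_symm _ hI]
  refine integral_congr_ae (Eventually.of_forall fun τ => ?_)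
  exact Pm_integral _ _ _ _

end RMT

namespace RMT
open scoped ENNReal

lemma Ksin_sinc (u v : ℝ) : Ksin u v = Real.sinc (π * (u - v)) := by
  unfold Ksin Real.sinc
  have : π * (u - v) = 0 ↔ u = v := by simp [Real.pi_ne_zero, sub_eq_zero]
  simp only [this]

lemma dS_continuous {n : ℕ} : Continuous (dS : (Fin n → ℝ) → ℝ) := by
  unfold dS
  refine Continuous.matrix_det ?_
  refine continuous_matrix fun i j => ?_
  simp only [Matrix.of_apply, Ksin_sinc]
  exact Real.continuous_sinc.comp (by fun_prop)

lemma dS_bound {n : ℕ} (τ : Fin n → ℝ) : |dS τ| ≤ n.factorial := by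
  have := det_bound (fun i j => Ksin (τ i) (τ j)) (B := 1) fun i j => by
    rw [Ksin_sinc]; exact Real.abs_sinc_le_one _
  simpa [dS] using this

lemma dS_nonneg {n : ℕ} (τ : Fin n → ℝ) : 0 ≤ dS τ := by
  have h := dkN_lim (α := 0) (by norm_num) (show (0:ℝ) < 1/2 by norm_num) (by norm_num) τ
  refine ge_of_tendsto h ?_
  filter_upwards [eventually_ge_atTop 1] with N hN
  exact dkN_nonneg 0 (by norm_num) (by norm_num) hN τ

lemma dS_shift {n : ℕ} (τ : Fin n → ℝ) (g : ℝ) : dS (fun i => τ i + g) = dS τ := by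
  unfold dS; simp [Ksin_sinc]

lemma pmix_continuous (α c : ℝ) (N : ℕ) : Continuous (pmix α c N) := (hmix_continuous α N _).div_const _
lemma pgau_continuous (c : ℝ) : Continuous (pgau c) := (gau_continuous c).div_const _

lemma pgau_pos {c : ℝ} (hc : 0 < c) (g : ℝ) : 0 < pgau c g := div_pos (gau_pos c g) (gau_integral_pos hc)

lemma pmix_nonneg (α c : ℝ) (N : ℕ) (g : ℝ) : 0 ≤ pmix α c N g :=
  div_nonneg (hmix_pos _ _ _ _).le (integral_nonneg fun g => (hmix_pos _ _ _ _).le)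

lemma pgau_exp_integrable {c : ℝ} (hc : 0 < c) (n : ℕ) : Integrable fun g => pgau c g * Real.exp (n * |g|) := by
  refine ((gau_exp_integrable hc n).div_const (∫ s, gau c s)).congr (Eventually.of_forall fun g => ?_)
  simp only [pgau]; ring

lemma pmix_exp_integrable (α : ℝ) {c : ℝ} (hc : 0 < c) (n : ℕ) :
    ∀ᶠ N : ℕ in atTop, Integrable fun g => pmix α c N g * Real.exp (n * |g|) := by
  filter_upwards [hmix_exp_integrable α hc n] with N h
  refine (h.div_const (∫ s, hmix α N (N * c) s)).congr (Eventually.of_forall fun g => ?_)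
  simp only [pmix]; ring

lemma pgau_integrable {c : ℝ} (hc : 0 < c) : Integrable (pgau c) := by
  simpa using pgau_exp_integrable hc 0

lemma pgau_integral {c : ℝ} (hc : 0 < c) : ∫ g, pgau c g = 1 := by
  unfold pgau
  rw [integral_div, div_self (gau_integral_pos hc).ne']

/-- a weight times a shifted test function is integrable -/
lemma wF_integrable {n : ℕ} {p : ℝ → ℝ} (hp : Continuous p) (hp0 : ∀ g, 0 ≤ p g) (hi : Integrable fun g => p g * Real.exp (n * |g|))
    (F : (Fin n → ℝ) → ℂ) (hF : Measurable F) {C : ℝ} (hC : 0 ≤ C) (hb : ∀ τ, ‖F τ‖ ≤ C * ew τ) (τ : Fin n → ℝ) :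
    Integrable fun g => (p g : ℂ) * F (fun i => τ i + g) := by
  have hm : Measurable (fun g : ℝ => fun i => τ i + g) := by fun_prop
  refine ((hi.const_mul (C * ew τ))).mono' ?_ (Eventually.of_forall fun g => ?_)
  · exact ((Complex.measurable_ofReal.comp hp.measurable).mul (hF.comp hm)).aestronglyMeasurable
  · rw [norm_mul, Complex.norm_real, Real.norm_of_nonneg (hp0 g)]
    calc _ ≤ p g * (C * (Real.exp (n * |g|) * ew τ)) :=
          mul_le_mul_of_nonneg_left ((hb _).trans (mul_le_mul_of_nonneg_left (ew_shift τ g) hC)) (hp0 g)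
      _ = _ := by ring

lemma wF_measurable {n : ℕ} {p : ℝ → ℝ} (hp : Continuous p) (F : (Fin n → ℝ) → ℂ) (hF : Measurable F) :
    StronglyMeasurable fun τ : Fin n → ℝ => ∫ g, (p g : ℂ) * F (fun i => τ i + g) := by
  refine StronglyMeasurable.integral_prod_right (f := fun τ : Fin n → ℝ => fun g => (p g : ℂ) * F (fun i => τ i + g)) ?_
  refine Measurable.stronglyMeasurable ?_
  have hm : Measurable (fun q : (Fin n → ℝ) × ℝ => fun i => q.1 i + q.2) := by fun_prop
  exact (Complex.measurable_ofReal.comp (hp.measurable.comp measurable_snd)).mul (hF.comp hm)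

lemma wF_bound {n : ℕ} {p : ℝ → ℝ} (hi : Integrable fun g => |p g| * Real.exp (n * |g|))
    (F : (Fin n → ℝ) → ℂ) {C : ℝ} (hC : 0 ≤ C) (hb : ∀ τ, ‖F τ‖ ≤ C * ew τ) (τ : Fin n → ℝ) :
    ‖∫ g, (p g : ℂ) * F (fun i => τ i + g)‖ ≤ (C * ∫ g, |p g| * Real.exp (n * |g|)) * ew τ := by
  have : (C * ∫ g, |p g| * Real.exp (n * |g|)) * ew τ = ∫ g, (C * ew τ) * (|p g| * Real.exp (n * |g|)) := by
    rw [integral_const_mul]; ring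
  rw [this]
  refine norm_integral_le_of_norm_le (hi.const_mul _) (Eventually.of_forall fun g => ?_)
  rw [norm_mul, Complex.norm_real, Real.norm_eq_abs]
  calc _ ≤ |p g| * (C * (Real.exp (n * |g|) * ew τ)) :=
        mul_le_mul_of_nonneg_left ((hb _).trans (mul_le_mul_of_nonneg_left (ew_shift τ g) hC)) (abs_nonneg _)
    _ = _ := by ring

lemma ew_int_fin {n : ℕ} (μ : Measure (Fin n → ℝ)) [IsFiniteMeasure μ] : Integrable ew μ :=
  Integrable.of_bound ew_continuous.aestronglyMeasurable 1 (Eventually.of_forall fun τ => by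
    rw [Real.norm_of_nonneg (ew_pos τ).le]; exact ew_le_one τ)

lemma int_fin {n : ℕ} (μ : Measure (Fin n → ℝ)) [IsFiniteMeasure μ] {F : (Fin n → ℝ) → ℂ} (hF : AEStronglyMeasurable F μ)
    {C : ℝ} (hb : ∀ τ, ‖F τ‖ ≤ C * ew τ) : Integrable F μ :=
  ((ew_int_fin μ).const_mul C).mono' hF (Eventually.of_forall hb)

/-- uniform local mass bound -/
theorem ew_nuT_bound {α : ℝ} (hα : -1 < α) {x : ℝ} (h0 : 0 < x) (h1 : x < 1) (n : ℕ) :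
    ∃ K : ℝ, 0 < K ∧ ∀ᶠ N : ℕ in atTop, ∫ τ : Fin n → ℝ, ew τ ∂(nuT α x N n) ≤ K := by
  have hc0 : 0 < psiMP x * x := mul_pos (psi_eq h0 h1).1 h0
  set c := psiMP x * x with hc
  have hm : Measurable (fun τ : Fin n → ℝ => (ew τ : ℂ)) := Complex.measurable_ofReal.comp ew_continuous.measurable
  have hb : ∀ τ : Fin n → ℝ, ‖(ew τ : ℂ)‖ ≤ 1 * ew τ := fun τ => by
    rw [Complex.norm_real, Real.norm_of_nonneg (ew_pos τ).le, one_mul]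
  have hlim := conv_dk hα h0 h1 _ hm zero_le_one hb
  have hlim2 : Tendsto (fun N => ∫ τ : Fin n → ℝ, ew τ * dkN α x N τ) atTop (𝓝 (∫ τ : Fin n → ℝ, ew τ * dS τ)) := by
    have := (Complex.continuous_re.tendsto _).comp hlim
    refine (this.congr fun N => ?_).trans_eq ?_
    · simp only [Function.comp]
      rw [← Complex.ofReal_re (∫ τ : Fin n → ℝ, ew τ * dkN α x N τ), ← integral_complex_ofReal]
      push_cast; rfl
    · rw [← Complex.ofReal_re (∫ τ : Fin n → ℝ, ew τ * dS τ), ← integral_complex_ofReal]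
      push_cast; rfl
  set κ := ∫ g, pgau c g * Real.exp (-(n * |g|)) with hκ
  have hle : ∀ g : ℝ, Real.exp (-(n * |g|)) ≤ Real.exp (n * |g|) := fun g => by
    rw [Real.exp_le_exp]; have : (0:ℝ) ≤ n * |g| := by positivity
    linarith
  have hInteg : ∀ p : ℝ → ℝ, Continuous p → (∀ g, 0 ≤ p g) → Integrable (fun g => p g * Real.exp (n * |g|)) →
      Integrable (fun g => p g * Real.exp (-(n * |g|))) := fun p hp hp0 hi => by
    refine hi.mono' (Continuous.aestronglyMeasurable (by fun_prop)) (Eventually.of_forall fun g => ?_)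
    rw [Real.norm_of_nonneg (mul_nonneg (hp0 g) (Real.exp_pos _).le)]
    exact mul_le_mul_of_nonneg_left (hle g) (hp0 g)
  have ig := hInteg _ (pgau_continuous c) (fun g => (pgau_pos hc0 g).le) (pgau_exp_integrable hc0 n)
  have hκ0 : 0 < κ := by
    refine (integral_pos_iff_support_of_nonneg (fun g => (mul_pos (pgau_pos hc0 g) (Real.exp_pos _)).le) ig).2 ?_
    have : Function.support (fun g => pgau c g * Real.exp (-(n * |g|))) = Set.univ := by
      ext g; simp [(pgau_pos hc0 g).ne']
    rw [this]; simp
  have hκl : Tendsto (fun N => ∫ g, pmix α c N g * Real.exp (-(n * |g|))) atTop (𝓝 κ) := by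
    rw [tendsto_iff_norm_sub_tendsto_zero]
    refine squeeze_zero' (Eventually.of_forall fun N => norm_nonneg _) ?_ (pmix_conv α hc0 n)
    filter_upwards [pmix_exp_integrable α hc0 n] with N hN
    have im := hInteg _ (pmix_continuous α c N) (pmix_nonneg α c N) hN
    rw [hκ, ← integral_sub im ig]
    refine norm_integral_le_of_norm_le ?_ (Eventually.of_forall fun g => ?_)
    · have := (hN.sub (pgau_exp_integrable hc0 n)).norm
      refine this.congr (Eventually.of_forall fun g => ?_)
      simp only [Pi.sub_apply]
      rw [← sub_mul, norm_mul, Real.norm_eq_abs, Real.norm_of_nonneg (Real.exp_pos _).le]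
    · rw [← sub_mul, norm_mul, Real.norm_eq_abs, Real.norm_of_nonneg (Real.exp_pos _).le]
      exact mul_le_mul_of_nonneg_left (hle g) (abs_nonneg _)
  have hI0 : 0 ≤ ∫ τ : Fin n → ℝ, ew τ * dS τ := integral_nonneg fun τ => mul_nonneg (ew_pos τ).le (dS_nonneg τ)
  refine ⟨((∫ τ : Fin n → ℝ, ew τ * dS τ) + 1) / (κ / 2), by positivity, ?_⟩
  filter_upwards [eventually_ge_atTop 1, eventually_ge_atTop n, pmix_exp_integrable α hc0 n,
    hκl.eventually (lt_mem_nhds (half_lt_self hκ0)), hlim2.eventually (gt_mem_nhds (lt_add_one _))] with N hN hn hpi hk hl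
  have := nuT_finite hα x hN hn
  have e := dk_conv hα h0 h1 hN hn _ hm zero_le_one hb
  have e2 : ∫ τ : Fin n → ℝ, ew τ * dkN α x N τ = ∫ τ, (∫ g, pmix α c N g * ew (fun i => τ i + g)) ∂(nuT α x N n) := by
    have e3 : ((∫ τ : Fin n → ℝ, ew τ * dkN α x N τ : ℝ) : ℂ) = ((∫ τ, (∫ g, pmix α c N g * ew (fun i => τ i + g)) ∂(nuT α x N n) : ℝ) : ℂ) := by
      rw [← integral_complex_ofReal, ← integral_complex_ofReal]
      simp only [← integral_complex_ofReal]
      push_cast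
      exact e
    exact_mod_cast e3
  have hfi : ∀ τ : Fin n → ℝ, Integrable fun g => pmix α c N g * ew (fun i => τ i + g) := fun τ => by
    have := (wF_integrable (pmix_continuous α c N) (pmix_nonneg α c N) hpi _ hm zero_le_one hb τ).re
    refine this.congr (Eventually.of_forall fun g => ?_)
    simp
  have hkey : (κ / 2) * ∫ τ : Fin n → ℝ, ew τ ∂(nuT α x N n) ≤ ∫ τ : Fin n → ℝ, ew τ * dkN α x N τ := by
    rw [e2, ← integral_const_mul]
    refine integral_mono ((ew_int_fin _).const_mul _) ?_ fun τ => ?_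
    · have h3 := (int_fin (nuT α x N n) (wF_measurable (pmix_continuous α c N) _ hm).aestronglyMeasurable
        (wF_bound (hpi.congr (Eventually.of_forall fun g => by simp only [abs_of_nonneg (pmix_nonneg α c N g)])) _ zero_le_one hb)).re
      refine h3.congr (Eventually.of_forall fun τ => ?_)
      simp only [← Complex.ofReal_mul, integral_complex_ofReal]
      simp
    · calc κ / 2 * ew τ ≤ (∫ g, pmix α c N g * Real.exp (-(n * |g|))) * ew τ := mul_le_mul_of_nonneg_right hk.le (ew_pos τ).le
        _ = ∫ g, (pmix α c N g * Real.exp (-(n * |g|))) * ew τ := by rw [integral_mul_const]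
        _ ≤ _ := by
            refine integral_mono ((hInteg _ (pmix_continuous α c N) (pmix_nonneg α c N) hpi).mul_const _) (hfi τ) fun g => ?_
            simp only
            rw [mul_assoc]
            exact mul_le_mul_of_nonneg_left (ew_shift' τ g) (pmix_nonneg α c N g)
  rw [le_div_iff₀ (by positivity), mul_comm]
  linarith

/-- convergence of Gaussian-smoothed functionals -/
theorem conv_smooth {α : ℝ} (hα : -1 < α) {x : ℝ} (h0 : 0 < x) (h1 : x < 1) {n : ℕ}
    (F : (Fin n → ℝ) → ℂ) (hF : Measurable F) {C : ℝ} (hC : 0 ≤ C) (hb : ∀ τ, ‖F τ‖ ≤ C * ew τ) :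
    Tendsto (fun N => ∫ τ, (∫ g, (pgau (psiMP x * x) g : ℂ) * F (fun i => τ i + g)) ∂(nuT α x N n)) atTop (𝓝 (∫ τ, F τ * (dS τ : ℂ))) := by
  have hc0 : 0 < psiMP x * x := mul_pos (psi_eq h0 h1).1 h0
  set c := psiMP x * x with hc
  obtain ⟨K, hK, hKb⟩ := ew_nuT_bound hα h0 h1 n
  have h2 : Tendsto (fun N => (∫ τ, F τ * (dkN α x N τ : ℂ)) - ∫ τ, (∫ g, (pgau c g : ℂ) * F (fun i => τ i + g)) ∂(nuT α x N n)) atTop (𝓝 0) := by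
    have hz : Tendsto (fun N : ℕ => (C * ∫ g, |pmix α c N g - pgau c g| * Real.exp (n * |g|)) * K) atTop (𝓝 0) := by
      simpa using ((pmix_conv α hc0 n).const_mul C).mul_const K
    refine squeeze_zero_norm' ?_ hz
    filter_upwards [eventually_ge_atTop 1, eventually_ge_atTop n, pmix_exp_integrable α hc0 n, hKb] with N hN hn hpi hKN
    have := nuT_finite hα x hN hn
    have hgi := pgau_exp_integrable hc0 n
    have hdi : Integrable fun g => |pmix α c N g - pgau c g| * Real.exp (n * |g|) := by
      refine (hpi.sub hgi).norm.congr (Eventually.of_forall fun g => ?_)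
      simp only [Pi.sub_apply]
      rw [← sub_mul, norm_mul, Real.norm_eq_abs, Real.norm_of_nonneg (Real.exp_pos _).le]
    have i1 := int_fin (nuT α x N n) (wF_measurable (pmix_continuous α c N) F hF).aestronglyMeasurable
        (wF_bound (hpi.congr (Eventually.of_forall fun g => by simp only [abs_of_nonneg (pmix_nonneg α c N g)])) F hC hb)
    have i2 := int_fin (nuT α x N n) (wF_measurable (pgau_continuous c) F hF).aestronglyMeasurable
        (wF_bound (hgi.congr (Eventually.of_forall fun g => by simp only [abs_of_nonneg (pgau_pos hc0 g).le])) F hC hb)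
    rw [dk_conv hα h0 h1 hN hn F hF hC hb, ← integral_sub i1 i2]
    set ε := C * ∫ g, |pmix α c N g - pgau c g| * Real.exp (n * |g|) with hε
    have hε0 : 0 ≤ ε := mul_nonneg hC (integral_nonneg fun g => by positivity)
    calc _ ≤ ∫ τ, ε * ew τ ∂(nuT α x N n) := by
          refine norm_integral_le_of_norm_le ((ew_int_fin _).const_mul _) (Eventually.of_forall fun τ => ?_)
          rw [← integral_sub (wF_integrable (pmix_continuous α c N) (pmix_nonneg α c N) hpi F hF hC hb τ)
            (wF_integrable (pgau_continuous c) (fun g => (pgau_pos hc0 g).le) hgi F hF hC hb τ)]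
          have := wF_bound (p := fun g => pmix α c N g - pgau c g) hdi F hC hb τ
          push_cast at this
          simp only [sub_mul] at this ⊢
          simpa only [hε, sub_mul] using this
      _ = ε * ∫ τ, ew τ ∂(nuT α x N n) := integral_const_mul _ _
      _ ≤ ε * K := mul_le_mul_of_nonneg_left hKN hε0
  have h3 := (conv_dk hα h0 h1 F hF hC hb).sub h2
  simpa using h3

/-- the sine process functional is unchanged by smoothing -/
lemma dS_smooth {c : ℝ} (hc : 0 < c) {n : ℕ}
    (F : (Fin n → ℝ) → ℂ) (hF : Measurable F) {C : ℝ} (hC : 0 ≤ C) (hb : ∀ τ, ‖F τ‖ ≤ C * ew τ) :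
    ∫ τ, F τ * (dS τ : ℂ) = ∫ τ, (∫ g, (pgau c g : ℂ) * F (fun i => τ i + g)) * (dS τ : ℂ) := by
  have hm : Measurable (fun q : (Fin n → ℝ) × ℝ => fun i => q.1 i + q.2) := by fun_prop
  have hI : Integrable (fun q : (Fin n → ℝ) × ℝ => (pgau c q.2 : ℂ) * F (fun i => q.1 i + q.2) * (dS q.1 : ℂ)) (volume.prod volume) := by
    have hb1 := (ew_integrable (n := n)).mul_prod (pgau_exp_integrable hc n)
    refine (hb1.const_mul (C * n.factorial)).mono' ?_ (Eventually.of_forall fun q => ?_)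
    · exact (((Complex.measurable_ofReal.comp ((pgau_continuous c).measurable.comp measurable_snd)).mul (hF.comp hm)).mul
        (Complex.measurable_ofReal.comp (dS_continuous.measurable.comp measurable_fst))).aestronglyMeasurable
    · rw [norm_mul, norm_mul, Complex.norm_real, Complex.norm_real, Real.norm_of_nonneg (pgau_pos hc _).le]
      have hp := (pgau_pos hc q.2).le
      have he := ew_pos q.1
      calc _ ≤ (pgau c q.2 * (C * (Real.exp (n * |q.2|) * ew q.1))) * n.factorial := by
            refine mul_le_mul (mul_le_mul_of_nonneg_left ((hb _).trans (mul_le_mul_of_nonneg_left (ew_shift _ _) hC)) hp) (dS_bound _) (norm_nonneg _) (by positivity)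
        _ = _ := by ring
  have e1 : ∀ τ : Fin n → ℝ, (∫ g, (pgau c g : ℂ) * F (fun i => τ i + g)) * (dS τ : ℂ) = ∫ g, (pgau c g : ℂ) * F (fun i => τ i + g) * (dS τ : ℂ) :=
    fun τ => (integral_mul_const _ _).symm
  simp only [e1]
  rw [integral_integral_swap (f := fun τ g => (pgau c g : ℂ) * F (fun i => τ i + g) * (dS τ : ℂ)) hI]
  have e2 : ∀ g : ℝ, ∫ τ : Fin n → ℝ, (pgau c g : ℂ) * F (fun i => τ i + g) * (dS τ : ℂ) = (pgau c g : ℂ) * ∫ τ : Fin n → ℝ, F τ * (dS τ : ℂ) := by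
    intro g
    simp only [mul_assoc]
    rw [integral_const_mul]
    congr 1
    have := integral_add_right_eq_self (μ := (volume : Measure (Fin n → ℝ))) (fun τ => F τ * (dS τ : ℂ)) (fun _ => g)
    rw [← this]
    refine integral_congr_ae (Eventually.of_forall fun τ => ?_)
    have h4 : (τ + fun _ => g) = fun i => τ i + g := rfl
    simp only [h4, dS_shift]
  simp only [e2]
  rw [integral_mul_const, integral_complex_ofReal, pgau_integral hc]
  simp

end RMT

namespace RMT
open scoped ENNReal

/-- Gaussian test function -/
def Fxi {n : ℕ} (ξ τ : Fin n → ℝ) : ℂ := Complex.exp ((-∑ i, (τ i)^2 : ℝ) + ((∑ i, τ i * ξ i : ℝ) : ℂ) * Complex.I)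

/-- weight after smoothing -/
def qw {n : ℕ} (b : ℝ) (τ : Fin n → ℝ) : ℝ := Real.exp (-∑ i, (τ i)^2 + (∑ i, τ i)^2 / b)

lemma Fxi_continuous {n : ℕ} (ξ : Fin n → ℝ) : Continuous (Fxi ξ) := by unfold Fxi; fun_prop
lemma qw_continuous {n : ℕ} (b : ℝ) : Continuous (qw b : (Fin n → ℝ) → ℝ) := by unfold qw; fun_prop
lemma qw_pos {n : ℕ} (b : ℝ) (τ : Fin n → ℝ) : 0 < qw b τ := Real.exp_pos _

lemma quad_ew {n : ℕ} {κ : ℝ} (hκ : 0 < κ) (τ : Fin n → ℝ) : Real.exp (-(κ * ∑ i, (τ i)^2)) ≤ Real.exp (n / (4 * κ)) * ew τ := by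
  unfold ew
  rw [← Real.exp_add, Real.exp_le_exp]
  have h : ∀ i, |τ i| ≤ 1 / (4 * κ) + κ * (τ i)^2 := fun i => by
    rw [← sq_abs (τ i)]
    have h1 : 0 ≤ κ * (|τ i| - 1 / (2 * κ))^2 := by positivity
    have h2 : κ * (|τ i| - 1 / (2 * κ))^2 = κ * |τ i|^2 - |τ i| + 1 / (4 * κ) := by field_simp; ring
    linarith
  have := sum_le_sum fun i (_ : i ∈ (univ : Finset (Fin n))) => h i
  rw [sum_add_distrib, ← mul_sum] at this
  simp only [sum_const, card_univ, Fintype.card_fin, nsmul_eq_mul] at this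
  have e : (n:ℝ) * (1 / (4 * κ)) = n / (4 * κ) := by ring
  linarith

lemma Fxi_bound {n : ℕ} (ξ τ : Fin n → ℝ) : ‖Fxi ξ τ‖ ≤ Real.exp (n / (4 * 1)) * ew τ := by
  refine le_trans (le_of_eq ?_) (quad_ew one_pos τ)
  unfold Fxi
  rw [Complex.norm_exp]
  simp only [Complex.add_re, Complex.ofReal_re, Complex.re_ofReal_mul, Complex.I_re, mul_zero, add_zero, one_mul]

lemma qw_bound {n : ℕ} {b : ℝ} (hb : (n:ℝ) < b) (τ : Fin n → ℝ) : qw b τ ≤ Real.exp (n / (4 * (1 - n / b))) * ew τ := by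
  have hb0 : 0 < b := lt_of_le_of_lt (by positivity) hb
  have hκ : 0 < 1 - n / b := by rw [sub_pos, div_lt_one hb0]; exact hb
  refine le_trans ?_ (quad_ew hκ τ)
  unfold qw
  rw [Real.exp_le_exp]
  have h := sq_sum_le_card_mul_sum_sq (s := (univ : Finset (Fin n))) (f := τ)
  simp only [card_univ, Fintype.card_fin] at h
  have : (∑ i, τ i)^2 / b ≤ (n * ∑ i, (τ i)^2) / b := div_le_div_of_nonneg_right h hb0.le
  have e : (n * ∑ i, (τ i)^2) / b = n / b * ∑ i, (τ i)^2 := by ring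
  rw [e] at this
  linarith

lemma smooth_Fxi {n : ℕ} {c : ℝ} (hc : 0 < c) (ξ' : Fin n → ℝ) :
    ∃ ξ : Fin n → ℝ, ∃ D : ℂ, D ≠ 0 ∧ ∀ τ, ∫ g, (pgau c g : ℂ) * Fxi ξ (fun i => τ i + g) =
      D * ((qw (1 / (2 * c^2) + n) τ : ℂ) * Complex.exp (((∑ i, τ i * ξ' i : ℝ) : ℂ) * Complex.I)) := by
  set b : ℝ := 1 / (2 * c^2) + n with hb
  have hb1 : (n:ℝ) < b := by rw [hb]; have : 0 < 1 / (2 * c^2) := by positivity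
                             linarith
  have hb0 : 0 < b := lt_of_le_of_lt (by positivity) hb1
  have hκ : 0 < 1 - n / b := by rw [sub_pos, div_lt_one hb0]; exact hb1
  set X : ℝ := (∑ i, ξ' i) / (1 - n / b) with hX
  have hZ := gau_integral_pos hc
  set Z := ∫ s, gau c s with hZd
  set ξ : Fin n → ℝ := fun i => ξ' i + X / b with hξ
  have hsum : ∑ i, ξ i = X := by
    rw [hξ, sum_add_distrib]
    simp only [sum_const, card_univ, Fintype.card_fin, nsmul_eq_mul]
    have : ∑ i, ξ' i = X * (1 - n / b) := by rw [hX, div_mul_cancel₀ _ hκ.ne']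
    rw [this]; ring
  refine ⟨ξ, (Z : ℂ)⁻¹ * ((π / -(-(b:ℂ))) ^ (1 / 2 : ℂ) * Complex.exp (-((X^2 / (4 * b) : ℝ) : ℂ))), ?_, fun τ => ?_⟩
  · refine mul_ne_zero (inv_ne_zero (by exact_mod_cast hZ.ne')) (mul_ne_zero ?_ (Complex.exp_ne_zero _))
    rw [neg_neg]
    have : ((π : ℂ) / b) ≠ 0 := div_ne_zero (by exact_mod_cast Real.pi_ne_zero) (by exact_mod_cast hb0.ne')
    rw [Complex.cpow_def_of_ne_zero this]
    exact Complex.exp_ne_zero _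
  · have e1 : ∀ g : ℝ, (pgau c g : ℂ) * Fxi ξ (fun i => τ i + g) = (Z : ℂ)⁻¹ *
        Complex.exp (-(b:ℂ) * g^2 + (((-2 * ∑ i, τ i : ℝ) : ℂ) + (X:ℂ) * Complex.I) * g + ((-∑ i, (τ i)^2 : ℝ) + ((∑ i, τ i * ξ i : ℝ) : ℂ) * Complex.I)) := by
      intro g
      unfold pgau Fxi
      rw [← hZd]
      unfold gau
      push_cast
      rw [div_eq_mul_inv, mul_comm (Complex.exp _), mul_assoc, ← Complex.exp_add]
      congr 2
      have s1 : (∑ i, ((τ i : ℂ) + g)^2) = ∑ i, (τ i : ℂ)^2 + 2 * g * ∑ i, (τ i : ℂ) + n * g^2 := by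
        simp only [add_sq, sum_add_distrib, sum_const, card_univ, Fintype.card_fin, nsmul_eq_mul, mul_sum]
        congr 2
        refine sum_congr rfl fun i _ => by ring
      have s2 : (∑ i, ((τ i : ℂ) + g) * ξ i) = ∑ i, (τ i : ℂ) * ξ i + g * X := by
        rw [← hsum]
        push_cast
        simp only [add_mul, sum_add_distrib, mul_sum]
      rw [s1, s2, hb]
      push_cast
      ring
    simp only [e1]
    rw [integral_const_mul, integral_cexp_quadratic (by simpa using hb0)]
    rw [mul_assoc, mul_assoc]
    congr 2
    unfold qw
    rw [Complex.ofReal_exp, ← Complex.exp_add, ← Complex.exp_add]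
    congr 1
    have s3 : ∑ i, τ i * ξ i = ∑ i, τ i * ξ' i + (∑ i, τ i) * (X / b) := by
      rw [hξ]; simp only [mul_add, sum_add_distrib, sum_mul]
    rw [s3]
    have hbc : (b:ℂ) ≠ 0 := by exact_mod_cast hb0.ne'
    have hI : Complex.I ^ 2 = -1 := Complex.I_sq
    generalize ∑ i, τ i = s
    generalize ∑ i, τ i * ξ' i = u
    generalize ∑ i, τ i ^ 2 = v
    push_cast
    field_simp
    ring_nf
    rw [hI]
    ring

lemma dS_int {n : ℕ} : dS (fun i : Fin n => ((i : ℕ) : ℝ)) = 1 := by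
  unfold dS
  have : (Matrix.of fun i j : Fin n => Ksin ((i : ℕ) : ℝ) ((j : ℕ) : ℝ)) = 1 := by
    ext i j
    simp only [Matrix.of_apply, Matrix.one_apply, Ksin]
    by_cases h : i = j
    · simp [h]
    · have h' : ¬ ((i:ℕ):ℝ) = ((j:ℕ):ℝ) := by
        intro hh; apply h; apply Fin.ext; exact_mod_cast hh
      rw [if_neg h', if_neg h]
      have : Real.sin (π * (((i:ℕ):ℝ) - ((j:ℕ):ℝ))) = 0 := by
        have := Real.sin_int_mul_pi (((i:ℕ):ℤ) - ((j:ℕ):ℤ))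
        push_cast at this
        rw [mul_comm]; exact this
      rw [this, zero_div]
  rw [this, Matrix.det_one]

theorem conv_nuT {α : ℝ} (hα : -1 < α) {x : ℝ} (h0 : 0 < x) (h1 : x < 1) {n : ℕ}
    (f : (Fin n → ℝ) → ℝ) (hf : Continuous f) (hsupp : HasCompactSupport f) :
    Tendsto (fun N => ∫ τ, f τ ∂(nuT α x N n)) atTop (𝓝 (∫ τ, f τ * dS τ)) := by
  have hc0 : 0 < psiMP x * x := mul_pos (psi_eq h0 h1).1 h0
  set c := psiMP x * x with hc
  set b : ℝ := 1 / (2 * c^2) + n with hb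
  have hb1 : (n:ℝ) < b := by rw [hb]; have : 0 < 1 / (2 * c^2) := by positivity
                             linarith
  have hqm : Measurable fun τ : Fin n → ℝ => ENNReal.ofReal (qw b τ) := (qw_continuous b).measurable.ennreal_ofReal
  have hdm : Measurable fun τ : Fin n → ℝ => ENNReal.ofReal (qw b τ * dS τ) := ((qw_continuous b).mul dS_continuous).measurable.ennreal_ofReal
  have hq0 : ∀ τ : Fin n → ℝ, 0 ≤ qw b τ * dS τ := fun τ => mul_nonneg (qw_pos b τ).le (dS_nonneg τ)
  have hqi : Integrable fun τ : Fin n → ℝ => qw b τ * dS τ := by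
    refine (ew_integrable.const_mul (Real.exp (n / (4 * (1 - n / b))) * n.factorial)).mono'
      ((qw_continuous b).mul dS_continuous).aestronglyMeasurable (Eventually.of_forall fun τ => ?_)
    have := ew_pos τ
    rw [norm_mul, Real.norm_of_nonneg (qw_pos b τ).le]
    calc _ ≤ (Real.exp (n / (4 * (1 - n / b))) * ew τ) * n.factorial := mul_le_mul (qw_bound hb1 τ) (dS_bound τ) (abs_nonneg _) (by positivity)
      _ = _ := by ring
  set σ : ℕ → Measure (Fin n → ℝ) := fun N => (nuT α x N n).withDensity fun τ => ENNReal.ofReal (qw b τ) with hσ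
  set σ₀ : Measure (Fin n → ℝ) := volume.withDensity fun τ => ENNReal.ofReal (qw b τ * dS τ) with hσ₀
  have hi : ∀ {G : Type} [NormedAddCommGroup G] [NormedSpace ℝ G] (N : ℕ) (h : (Fin n → ℝ) → G), ∫ τ, h τ ∂(σ N) = ∫ τ, qw b τ • h τ ∂(nuT α x N n) := by
    intro G _ _ N h
    rw [hσ]
    simp only
    rw [integral_withDensity_eq_integral_toReal_smul hqm (Eventually.of_forall fun _ => ENNReal.ofReal_lt_top)]
    simp only [ENNReal.toReal_ofReal (qw_pos b _).le]
  have hi0 : ∀ {G : Type} [NormedAddCommGroup G] [NormedSpace ℝ G] (h : (Fin n → ℝ) → G), ∫ τ, h τ ∂σ₀ = ∫ τ, (qw b τ * dS τ) • h τ := by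
    intro G _ _ h
    rw [hσ₀]
    rw [integral_withDensity_eq_integral_toReal_smul hdm (Eventually.of_forall fun _ => ENNReal.ofReal_lt_top)]
    simp only [ENNReal.toReal_ofReal (hq0 _)]
  have H := levy_fin σ σ₀ ?_ ?_ ?_ ?_ (BoundedContinuousFunction.ofNormedAddCommGroup (fun τ => f τ / qw b τ)
      (hf.div (qw_continuous b) fun τ => (qw_pos b τ).ne')
      (HasCompactSupport.exists_bound_of_continuous (f := fun τ => f τ / qw b τ) (by
        simp only [div_eq_mul_inv]; exact hsupp.mul_right) (hf.div (qw_continuous b) fun τ => (qw_pos b τ).ne')).choose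
      (HasCompactSupport.exists_bound_of_continuous (f := fun τ => f τ / qw b τ) (by
        simp only [div_eq_mul_inv]; exact hsupp.mul_right) (hf.div (qw_continuous b) fun τ => (qw_pos b τ).ne')).choose_spec)
  · simp only [BoundedContinuousFunction.coe_ofNormedAddCommGroup, hi, hi0, smul_eq_mul] at H
    have e1 : ∀ τ : Fin n → ℝ, qw b τ * (f τ / qw b τ) = f τ := fun τ => mul_div_cancel₀ _ (qw_pos b τ).ne'
    have e2 : ∀ τ : Fin n → ℝ, qw b τ * dS τ * (f τ / qw b τ) = f τ * dS τ := fun τ => by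
      have := (qw_pos b τ).ne'
      field_simp
    simpa only [e1, e2] using H
  · filter_upwards [eventually_ge_atTop 1, eventually_ge_atTop n] with N hN hn
    have := nuT_finite hα x hN hn
    rw [hσ]
    simp only
    rw [withDensity_apply _ MeasurableSet.univ, setLIntegral_univ]
    have hqI : Integrable (fun τ : Fin n → ℝ => qw b τ) (nuT α x N n) :=
      ((ew_int_fin (nuT α x N n)).const_mul _).mono' (qw_continuous b).aestronglyMeasurable (Eventually.of_forall fun τ => by
        rw [Real.norm_of_nonneg (qw_pos b τ).le]; exact qw_bound hb1 τ)
    exact ((hasFiniteIntegral_iff_ofReal (Eventually.of_forall fun τ => (qw_pos b τ).le)).1 hqI.2).ne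
  · rw [hσ₀, withDensity_apply _ MeasurableSet.univ, setLIntegral_univ]
    intro hz
    rw [lintegral_eq_zero_iff hdm] at hz
    have hz2 : (fun τ : Fin n → ℝ => ENNReal.ofReal (qw b τ * dS τ)) = 0 :=
      (Continuous.ae_eq_iff_eq volume (ENNReal.continuous_ofReal.comp ((qw_continuous b).mul dS_continuous)) continuous_const).1 hz
    have := congrFun hz2 (fun i => ((i:ℕ):ℝ))
    rw [dS_int] at this
    simp only [mul_one, Pi.zero_apply, ENNReal.ofReal_eq_zero] at this
    exact absurd (qw_pos b _) (not_lt.2 this)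
  · rw [hσ₀, withDensity_apply _ MeasurableSet.univ, setLIntegral_univ]
    exact ((hasFiniteIntegral_iff_ofReal (Eventually.of_forall hq0)).1 hqi.2).ne
  · intro ξ'
    obtain ⟨ξ, D, hD, hs⟩ := smooth_Fxi (n := n) hc0 ξ'
    have l1 := conv_smooth hα h0 h1 (Fxi ξ) (Fxi_continuous ξ).measurable (Real.exp_pos _).le (Fxi_bound ξ)
    rw [dS_smooth hc0 (Fxi ξ) (Fxi_continuous ξ).measurable (Real.exp_pos _).le (Fxi_bound ξ)] at l1
    simp only [← hc, hs, integral_const_mul, mul_assoc] at l1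
    have l2 := l1.const_mul D⁻¹
    simp only [← mul_assoc, inv_mul_cancel₀ hD, one_mul] at l2
    simp only [hi, hi0, Complex.real_smul]
    refine l2.trans_eq ?_
    congr 1
    refine integral_congr_ae (Eventually.of_forall fun τ => ?_)
    push_cast
    ring

end RMT

namespace RMT
open scoped ENNReal

/-- unnormalised density of the bounded trace ensemble -/
def btW (α : ℝ) {N : ℕ} (r : ℝ) (x : Fin N → ℝ) : ℝ :=
  if (∀ i, 0 ≤ x i) ∧ (∑ i, x i) ≤ r then vdm2 x * lagWeight α x else 0

lemma btW_ae (α : ℝ) (N : ℕ) (r : ℝ) : ∀ᵐ x : Fin N → ℝ, btW α r x = (thD α r x).toReal := by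
  have h : ∀ i : Fin N, ∀ᵐ x : Fin N → ℝ, x i ≠ 0 := fun i => Measure.ae_eval_ne (μ := fun _ => volume) i 0
  filter_upwards [ae_all_iff.2 h] with x hx
  have : (∀ i, 0 < x i) ↔ ∀ i, 0 ≤ x i := forall_congr' fun i => ⟨le_of_lt, fun h => lt_of_le_of_ne h (hx i).symm⟩
  unfold btW thD
  simp only [this]
  split_ifs with h1
  · have hl : 0 ≤ lagWeight α x := prod_nonneg fun i _ => Real.rpow_nonneg (h1.1 i) _
    rw [ENNReal.toReal_ofReal (mul_nonneg (vdm2_nonneg x) hl)]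
  · simp

lemma thD_lt_top (α : ℝ) {N : ℕ} (r : ℝ) (x : Fin N → ℝ) : thD α r x < ∞ := by
  unfold thD; split_ifs
  · exact ENNReal.ofReal_lt_top
  · exact ENNReal.zero_lt_top

lemma btW_integral (α : ℝ) (N : ℕ) (h : (Fin N → ℝ) → ℝ) :
    ∫ y, h y ∂(ThM α N) = ∫ y, h y * btW α ((N + α) / 4) y := by
  rw [ThM, integral_withDensity_eq_integral_toReal_smul (thD_measurable α N _) (Eventually.of_forall fun _ => thD_lt_top _ _ _)]
  refine integral_congr_ae ?_
  filter_upwards [btW_ae α N ((N + α) / 4)] with y hy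
  rw [hy, smul_eq_mul, mul_comm]

lemma btlueZ_eq (α : ℝ) (N : ℕ) : btlueZ α N ((N + α) / 4) = (ThM α N Set.univ).toReal := by
  have := btW_integral α N (fun _ => 1)
  simp only [integral_const, smul_eq_mul, mul_one, one_mul, Measure.real] at this
  rw [this]; rfl

lemma btW_int {α : ℝ} (hα : -1 < α) {N : ℕ} (hN : 1 ≤ N) (h : (Fin N → ℝ) → ℝ) (hm : Measurable h) {C : ℝ} (hb : ∀ y, |h y| ≤ C) :
    Integrable fun y => h y * btW α ((N + α) / 4) y := by
  have hT := (mix_detK hα hN one_pos).1.2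
  have : IsFiniteMeasure (ThM α N) := ⟨lt_top_iff_ne_top.2 hT⟩
  have hi : Integrable h (ThM α N) := Integrable.of_bound hm.aestronglyMeasurable C (Eventually.of_forall hb)
  rw [ThM, integrable_withDensity_iff (thD_measurable α N _) (Eventually.of_forall fun _ => thD_lt_top _ _ _)] at hi
  refine hi.congr ?_
  filter_upwards [btW_ae α N ((N + α) / 4)] with y hy
  rw [hy]

/-- index splitting -/
def eSum {N n : ℕ} (hn : n ≤ N) : Fin n ⊕ Fin (N - n) ≃ Fin N := finSumFinEquiv.trans (finCongr (by omega))

lemma eSum_inl {N n : ℕ} (hn : n ≤ N) (i : Fin n) : ((eSum hn (Sum.inl i) : Fin N) : ℕ) = i := by simp [eSum]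
lemma eSum_inr {N n : ℕ} (hn : n ≤ N) (i : Fin (N - n)) : ((eSum hn (Sum.inr i) : Fin N) : ℕ) = n + i := by simp [eSum]

lemma fullVec_inl {N n : ℕ} (hn : n ≤ N) (t : Fin n → ℝ) (y : Fin (N - n) → ℝ) (i : Fin n) : fullVec N n t y (eSum hn (Sum.inl i)) = t i := by
  unfold fullVec; rw [eSum_inl, if_pos i.2]; simp [extFun]
lemma fullVec_inr {N n : ℕ} (hn : n ≤ N) (t : Fin n → ℝ) (y : Fin (N - n) → ℝ) (i : Fin (N - n)) : fullVec N n t y (eSum hn (Sum.inr i)) = y i := by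
  unfold fullVec; rw [eSum_inr, if_neg (by omega), Nat.add_sub_cancel_left]; simp [extFun]

/-- the splitting as a measurable equivalence -/
def spl {N n : ℕ} (hn : n ≤ N) : (Fin n → ℝ) × (Fin (N - n) → ℝ) ≃ᵐ (Fin N → ℝ) :=
  (MeasurableEquiv.sumPiEquivProdPi (fun _ : Fin n ⊕ Fin (N - n) => ℝ)).symm.trans (MeasurableEquiv.piCongrLeft (fun _ => ℝ) (eSum hn))

lemma spl_apply {N n : ℕ} (hn : n ≤ N) (p : (Fin n → ℝ) × (Fin (N - n) → ℝ)) : spl hn p = fullVec N n p.1 p.2 := by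
  ext i
  obtain ⟨s, rfl⟩ := (eSum hn).surjective i
  have : spl hn p (eSum hn s) = (MeasurableEquiv.sumPiEquivProdPi (fun _ : Fin n ⊕ Fin (N - n) => ℝ)).symm p s :=
    MeasurableEquiv.piCongrLeft_apply_apply (β := fun _ => ℝ) (eSum hn) _ s
  rw [this]
  cases s with
  | inl i => rw [fullVec_inl]; rfl
  | inr i => rw [fullVec_inr]; rfl

lemma spl_mp {N n : ℕ} (hn : n ≤ N) : MeasurePreserving (spl hn) (volume.prod volume) volume :=
  (volume_measurePreserving_sumPiEquivProdPi_symm (fun _ : Fin n ⊕ Fin (N - n) => ℝ)).trans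
    (volume_measurePreserving_piCongrLeft (fun _ => ℝ) (eSum hn))

lemma resN_fullVec {N n : ℕ} (hn : n ≤ N) (t : Fin n → ℝ) (y : Fin (N - n) → ℝ) : resN N n (fullVec N n t y) = t := by
  ext i
  have : (i:ℕ) < N := by omega
  simp [resN, fullVec, this, extFun]

lemma btlueR_eq (α : ℝ) {N n : ℕ} (hn : n ≤ N) (r : ℝ) (t : Fin n → ℝ) :
    btlueR α N n r t = ((N.factorial : ℝ) / ((N - n).factorial : ℝ)) / btlueZ α N r * ∫ y, btW α r (fullVec N n t y) := by
  have hpos : ∀ y : Fin (N - n) → ℝ, (∀ i, 0 ≤ fullVec N n t y i) ↔ (∀ i, 0 ≤ t i) ∧ ∀ k, 0 ≤ y k := by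
    intro y
    rw [← (eSum hn).forall_congr_right, Sum.forall]
    simp only [fullVec_inl, fullVec_inr]
  have hsum : ∀ y : Fin (N - n) → ℝ, ∑ i, fullVec N n t y i = ∑ i, t i + ∑ k, y k := by
    intro y
    rw [← (eSum hn).sum_comp, Fintype.sum_sum_type]
    simp only [fullVec_inl, fullVec_inr]
  unfold btlueR btW
  simp only [hpos, hsum]
  by_cases ht : ∀ i, 0 ≤ t i
  · simp [ht]
  · simp [ht]

lemma R_muT {α : ℝ} (hα : -1 < α) {N n : ℕ} (hN : 1 ≤ N) (hn : n ≤ N) (h : (Fin n → ℝ) → ℝ) (hm : Measurable h) {C : ℝ} (hb : ∀ y, |h y| ≤ C) :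
    ∫ t, h t * btlueR α N n ((N + α) / 4) t = ∫ t, h t ∂(muT α N n) := by
  have hI := btW_int hα hN (fun y => h (resN N n y)) (hm.comp (resN_measurable N n)) (fun y => hb _)
  have hI2 := ((spl_mp hn).integrable_comp_emb (spl hn).measurableEmbedding).2 hI
  have e1 : ∫ y : Fin N → ℝ, h (resN N n y) * btW α ((N + α) / 4) y = ∫ t, h t * ∫ y, btW α ((N + α) / 4) (fullVec N n t y) := by
    rw [← (spl_mp hn).integral_comp (spl hn).measurableEmbedding]
    refine (integral_prod _ hI2).trans ?_
    refine integral_congr_ae (Eventually.of_forall fun t => ?_)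
    simp only [Function.comp_apply, spl_apply, resN_fullVec hn]
    exact integral_const_mul _ _
  rw [muT, integral_smul_measure, integral_map (resN_measurable N n).aemeasurable hm.aestronglyMeasurable, btW_integral, e1, smul_eq_mul, ← integral_const_mul]
  refine integral_congr_ae (Eventually.of_forall fun t => ?_)
  simp only [btlueR_eq α hn, btlueZ_eq, ENNReal.toReal_div, ENNReal.toReal_natCast]
  ring

lemma lhs_eq {α : ℝ} (hα : -1 < α) {x : ℝ} (h0 : 0 < x) (h1 : x < 1) {N n : ℕ} (hN : 1 ≤ N) (hn : n ≤ N)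
    (f : (Fin n → ℝ) → ℝ) (hf : Continuous f) (hsupp : HasCompactSupport f) :
    (∫ t : Fin n → ℝ, f t * btlueR α N n (((N : ℝ) + α) / 4) (fun i => x + t i / ((N : ℝ) * psiMP x))) / ((N : ℝ) * psiMP x) ^ n =
      ∫ τ, f (fun i => (N * (psiMP x * x)) * (Real.exp (τ i / (N * (psiMP x * x))) - 1)) ∂(nuT α x N n) := by
  have hψ := (psi_eq h0 h1).1
  have hNr : (0:ℝ) < N := by exact_mod_cast hN
  set a : ℝ := N * psiMP x with ha
  have ha0 : 0 < a := by positivity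
  have hma : N * (psiMP x * x) = a * x := by rw [ha]; ring
  rw [hma]
  obtain ⟨C, hC⟩ := hsupp.exists_bound_of_continuous hf
  set G : (Fin n → ℝ) → ℝ := fun u => f (fun i => a * (u i - x)) * btlueR α N n (((N : ℝ) + α) / 4) u with hG
  have e1 : ∀ t : Fin n → ℝ, f t * btlueR α N n (((N : ℝ) + α) / 4) (fun i => x + t i / a) = G ((fun _ => x) + a⁻¹ • t) := by
    intro t
    have h2 : ((fun _ => x) + a⁻¹ • t) = fun i => x + t i / a := by
      ext i; simp only [Pi.add_apply, Pi.smul_apply, smul_eq_mul]; ring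
    rw [h2, hG]
    simp only
    congr 2
    ext i; field_simp; ring
  simp only [e1]
  rw [Measure.integral_comp_inv_smul volume (fun t => G ((fun _ => x) + t)) a, integral_add_left_eq_self]
  rw [Module.finrank_fin_fun, abs_of_pos (by positivity), smul_eq_mul, mul_div_cancel_left₀ _ (by positivity)]
  have hfm : Measurable fun u : Fin n → ℝ => f (fun i => a * (u i - x)) := (hf.comp (by fun_prop)).measurable
  have hfc : Continuous fun τ : Fin n → ℝ => f (fun i => a * x * (Real.exp (τ i / (a * x)) - 1)) := hf.comp (by fun_prop)
  rw [hG, R_muT hα hN hn _ hfm (fun y => hC _), nuT, hma,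
    integral_map (lgc_measurable _ _).aemeasurable hfc.aestronglyMeasurable]
  refine integral_congr_ae ?_
  filter_upwards [muT_pos α hn] with t ht
  simp only [lgc]
  congr 1
  ext i
  rw [mul_div_cancel_left₀ _ (by positivity), Real.exp_log (div_pos (ht i) h0)]
  field_simp

lemma exp_far {m R s : ℝ} (hR : 0 < R) (hm : 2 * R < m) (hs : 2 * R < |s|) : R < |m * (Real.exp (s / m) - 1)| := by
  have hm0 : 0 < m := by linarith
  rcases abs_cases s with ⟨h, _⟩ | ⟨h, _⟩
  · have h2 := Real.add_one_le_exp (s / m)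
    have h3 : s ≤ m * (Real.exp (s / m) - 1) := by
      have : s = m * (s / m) := by field_simp
      calc s = m * (s / m) := this
        _ ≤ _ := mul_le_mul_of_nonneg_left (by linarith) hm0.le
    have := le_abs_self (m * (Real.exp (s / m) - 1))
    linarith
  · have hs2 : s / m ≤ -(2 * R / m) := by
      rw [← neg_div]; exact div_le_div_of_nonneg_right (by linarith) hm0.le
    have h2 : Real.exp (s / m) * (1 + 2 * R / m) ≤ 1 := by
      calc Real.exp (s / m) * (1 + 2 * R / m) ≤ Real.exp (-(2 * R / m)) * Real.exp (2 * R / m) := by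
            refine mul_le_mul (Real.exp_le_exp.2 hs2) (by linarith [Real.add_one_le_exp (2 * R / m)]) (by positivity) (Real.exp_pos _).le
        _ = 1 := by rw [← Real.exp_add]; simp
    have h3 : Real.exp (s / m) * (m + 2 * R) ≤ m := by
      have : Real.exp (s / m) * (m + 2 * R) = m * (Real.exp (s / m) * (1 + 2 * R / m)) := by field_simp
      rw [this]; nlinarith
    have h4 := neg_le_abs (m * (Real.exp (s / m) - 1))
    have h5 : R < -(m * (Real.exp (s / m) - 1)) := by
      have h6 : Real.exp (s / m) ≤ m / (m + 2 * R) := by rw [le_div_iff₀ (by linarith)]; exact h3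
      have h7 : m * (m / (m + 2 * R)) < m - R := by
        rw [← mul_div_assoc, div_lt_iff₀ (by linarith)]; nlinarith
      have h8 := mul_le_mul_of_nonneg_left h6 hm0.le
      linarith
    linarith

lemma unif_approx {n : ℕ} (f : (Fin n → ℝ) → ℝ) (hf : Continuous f) (hsupp : HasCompactSupport f) {c : ℝ} (hc : 0 < c) {ε : ℝ} (hε : 0 < ε) :
    ∀ᶠ N : ℕ in atTop, ∀ τ : Fin n → ℝ, |f (fun i => (N * c) * (Real.exp (τ i / (N * c)) - 1)) - f τ| ≤ ε * ew τ := by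
  obtain ⟨R0, hR0⟩ := hsupp.isCompact.isBounded.subset_closedBall (0 : Fin n → ℝ)
  set R := max R0 1 with hR
  have hRp : 0 < R := lt_of_lt_of_le one_pos (le_max_right _ _)
  have hz : ∀ t : Fin n → ℝ, ∀ i, R < |t i| → f t = 0 := by
    intro t i hi
    by_contra hne
    have h1 := hR0 (subset_tsupport f hne)
    rw [mem_closedBall_zero_iff] at h1
    have h2 := norm_le_pi_norm t i
    rw [Real.norm_eq_abs] at h2
    have := le_max_left R0 1
    linarith
  have huc := hsupp.uniformContinuous_of_continuous hf
  rw [Metric.uniformContinuous_iff] at huc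
  obtain ⟨δ, hδ, hd⟩ := huc (ε * Real.exp (-(n * (2 * R)))) (by positivity)
  have hT : Tendsto (fun N : ℕ => (N:ℝ) * c) atTop atTop := tendsto_natCast_atTop_atTop.atTop_mul_const hc
  filter_upwards [hT.eventually_gt_atTop (2 * R), hT.eventually_gt_atTop ((2 * R)^2 / δ)] with N hN1 hN2 τ
  set m := (N:ℝ) * c with hm
  have hm0 : 0 < m := by linarith
  by_cases hτ : ∃ i, 2 * R < |τ i|
  · obtain ⟨i, hi⟩ := hτ
    rw [hz τ i (by linarith), hz (fun i => m * (Real.exp (τ i / m) - 1)) i (exp_far hRp hN1 hi)]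
    have := ew_pos τ
    simp; positivity
  · push Not at hτ
    have hdist : dist (fun i => m * (Real.exp (τ i / m) - 1)) τ < δ := by
      rw [dist_pi_lt_iff hδ]
      intro i
      rw [Real.dist_eq]
      have h1 : |τ i / m| ≤ 1 := by
        rw [abs_div, abs_of_pos hm0, div_le_one hm0]; linarith [hτ i]
      have h2 := Real.abs_exp_sub_one_sub_id_le h1
      have e : m * (Real.exp (τ i / m) - 1) - τ i = m * (Real.exp (τ i / m) - 1 - τ i / m) := by field_simp
      rw [e, abs_mul, abs_of_pos hm0]
      calc _ ≤ m * (τ i / m)^2 := mul_le_mul_of_nonneg_left h2 hm0.le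
        _ = |τ i|^2 / m := by rw [sq_abs]; field_simp
        _ ≤ (2 * R)^2 / m := by
            refine div_le_div_of_nonneg_right ?_ hm0.le
            exact pow_le_pow_left₀ (abs_nonneg _) (hτ i) 2
        _ < δ := by rw [div_lt_iff₀ hm0]; rw [div_lt_iff₀ hδ] at hN2; linarith
    have h3 := hd hdist
    rw [Real.dist_eq] at h3
    refine h3.le.trans (mul_le_mul_of_nonneg_left ?_ hε.le)
    unfold ew
    rw [Real.exp_le_exp]
    have := sum_le_sum fun i (_ : i ∈ (univ : Finset (Fin n))) => hτ i
    simp only [sum_const, card_univ, Fintype.card_fin, nsmul_eq_mul] at this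
    linarith

theorem main_lim {α : ℝ} (hα : -1 < α) {x : ℝ} (h0 : 0 < x) (h1 : x < 1) {n : ℕ}
    (f : (Fin n → ℝ) → ℝ) (hf : Continuous f) (hsupp : HasCompactSupport f) :
    Tendsto (fun N : ℕ => (∫ t : Fin n → ℝ, f t * btlueR α N n (((N : ℝ) + α) / 4) (fun i => x + t i / ((N : ℝ) * psiMP x))) / ((N : ℝ) * psiMP x) ^ n)
      atTop (𝓝 (∫ t : Fin n → ℝ, f t * dS t)) := by
  have hc0 : 0 < psiMP x * x := mul_pos (psi_eq h0 h1).1 h0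
  obtain ⟨K, hK, hKb⟩ := ew_nuT_bound hα h0 h1 n
  obtain ⟨C, hC⟩ := hsupp.exists_bound_of_continuous hf
  have h2 : Tendsto (fun N : ℕ => (∫ τ, f (fun i => (N * (psiMP x * x)) * (Real.exp (τ i / (N * (psiMP x * x))) - 1)) ∂(nuT α x N n)) - ∫ τ, f τ ∂(nuT α x N n)) atTop (𝓝 0) := by
    rw [Metric.tendsto_nhds]
    intro ε hε
    filter_upwards [unif_approx f hf hsupp hc0 (show 0 < ε / (2 * K) by positivity), hKb, eventually_ge_atTop 1, eventually_ge_atTop n] with N hu hKN hN hn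
    have := nuT_finite hα x hN hn
    have hfc : Continuous fun τ : Fin n → ℝ => f (fun i => (N * (psiMP x * x)) * (Real.exp (τ i / (N * (psiMP x * x))) - 1)) := hf.comp (by fun_prop)
    rw [dist_zero_right, ← integral_sub
      (Integrable.of_bound hfc.aestronglyMeasurable C (Eventually.of_forall fun τ => hC _))
      (Integrable.of_bound hf.aestronglyMeasurable C (Eventually.of_forall fun τ => hC _))]
    calc _ ≤ ∫ τ, ε / (2 * K) * ew τ ∂(nuT α x N n) :=
          norm_integral_le_of_norm_le ((ew_int_fin _).const_mul _) (Eventually.of_forall fun τ => hu τ)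
      _ = ε / (2 * K) * ∫ τ, ew τ ∂(nuT α x N n) := integral_const_mul _ _
      _ ≤ ε / (2 * K) * K := mul_le_mul_of_nonneg_left hKN (by positivity)
      _ = ε / 2 := by field_simp
      _ < ε := half_lt_self hε
  have h3 := h2.add (conv_nuT hα h0 h1 f hf hsupp)
  rw [zero_add] at h3
  refine h3.congr' ?_
  filter_upwards [eventually_ge_atTop 1, eventually_ge_atTop n] with N hN hn
  rw [lhs_eq hα h0 h1 hN hn f hf hsupp]
  ring

end RMT

namespace RMT

/-- bulk universality of the bounded trace LUE (sine-kernel limit). -/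
theorem btlue_bulk_universality (α : ℝ) (hα : -1 < α) (n : ℕ) (hn : 1 ≤ n)
    (x : ℝ) (hx : x ∈ Set.Ioo (0 : ℝ) 1)
    (f : (Fin n → ℝ) → ℝ) (hf : Continuous f) (hsupp : HasCompactSupport f) :
    Tendsto (fun N : ℕ =>
        (∫ t : Fin n → ℝ, f t *
            btlueR α N n (((N : ℝ) + α) / 4)
              (fun i => x + t i / ((N : ℝ) * psiMP x))) /
          ((N : ℝ) * psiMP x) ^ n)
      atTop
      (𝓝 (∫ t : Fin n → ℝ,
            f t * Matrix.det (Matrix.of fun i j : Fin n => Ksin (t i) (t j)))) := by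
  exact main_lim hα hx.1 hx.2 f hf hsupp

end RMT
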